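/- Let ν > 0, let u₀ ∈ L²(ℝ³;ℝ³) be divergence-free with ∫(1+|ξ|²)|𝓕u₀(ξ)|² dξ < ∞ (i.e. u₀ ∈ H¹(ℝ³)), let u be a Leray–Hopf weak solution of the Navier–Stokes equations with initial datum u₀, and let 0 < T < ∞. If there exists σ ∈ (−1,0) such that ∫₀^T ‖u(t)‖_{B^σ_{∞,∞}}^{2/(1+σ)} dt < ∞, then u is regular in (0,T]. -/

import Mathlib

/-!
Common setup: the Fourier–Plancherel transform on `L²(ℝ³;ℂ)` (Mathlib's unitary
Fourier transform with kernel `e^{-2πi x·ξ}`), characterized -- uniquely up to a.e.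
equality -- by the multiplication formula against Schwartz functions; sharp
frequency cut-offs; Besov norms; and the notion of Leray–Hopf weak solution.
-/

noncomputable section

open MeasureTheory Real Complex Filter Function
open scoped ENNReal NNReal FourierTransform ComplexConjugate Classical

namespace NSE

abbrev V := EuclideanSpace ℝ (Fin 3)

/-- `IsFourierPair u v` says: `u, v ∈ L²(ℝ³;ℂ)` and `v` is (a version of) the
Fourier–Plancherel transform `𝓕u` of `u` (unitary Fourier transform, kernel
`e^{-2πi x·ξ}`), characterized by the multiplication formula
`∫ v g = ∫ u 𝓕g` for all Schwartz functions `g`. -/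
def IsFourierPair (u v : V → ℂ) : Prop :=
  MemLp u 2 volume ∧ MemLp v 2 volume ∧
    ∀ g : SchwartzMap V ℂ,
      ∫ ξ, v ξ * g ξ = ∫ x, u x * FourierTransform.fourier (⇑g) x

/-- The Fourier–Plancherel transform `𝓕u` of `u ∈ L²` (a choice of representative;
`0` if `u ∉ L²`). -/
def FT (u : V → ℂ) : V → ℂ :=
  if h : ∃ v, IsFourierPair u v then h.choose else 0

/-- The inverse Fourier–Plancherel transform `𝓕⁻¹v` of `v ∈ L²` (a choice of
representative; `0` if `v ∉ L²`). -/
def FTinv (v : V → ℂ) : V → ℂ :=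
  if h : ∃ u, IsFourierPair u v then h.choose else 0

/-- Frequency cut-off: `𝓕⁻¹(1_S · 𝓕u)`. -/
def cut (S : Set V) (u : V → ℂ) : V → ℂ := FTinv (S.indicator (FT u))

/-- High-frequency part `u^k = 𝓕⁻¹(1_{|ξ|≥k} 𝓕u)`. -/
def hi (k : ℝ) (u : V → ℂ) : V → ℂ := cut {ξ : V | k ≤ ‖ξ‖} u

/-- Low-frequency part `u_k = 𝓕⁻¹(1_{|ξ|<k} 𝓕u)`. -/
def lo (k : ℝ) (u : V → ℂ) : V → ℂ := cut {ξ : V | ‖ξ‖ < k} u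

/-- Frequency band `u_{h,k} = 𝓕⁻¹(1_{h≤|ξ|<k} 𝓕u)`. -/
def band (h k : ℝ) (u : V → ℂ) : V → ℂ := cut {ξ : V | h ≤ ‖ξ‖ ∧ ‖ξ‖ < k} u

/-- Sharp dyadic piece `Δ_j v = 𝓕⁻¹(1_{2^{j-1}≤|ξ|<2^j} 𝓕v)`. -/
def Δd (j : ℤ) (v : V → ℂ) : V → ℂ := band ((2:ℝ) ^ (j - 1)) ((2:ℝ) ^ j) v

/-- `Δ̃₀ v = 𝓕⁻¹(1_{|ξ|<1} 𝓕v)`. -/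
def Δt0 (v : V → ℂ) : V → ℂ := lo 1 v

/-- The `L^∞` norm (essential sup norm; for the frequency-localized pieces this is
the sup norm of the bounded continuous representative), valued in `[0,∞]`. -/
def nInf (v : V → ℂ) : ℝ≥0∞ := eLpNorm v ⊤ volume

/-- Inhomogeneous Besov norm `‖v‖_{B^σ_{∞,∞}}`, valued in `[0,∞]`. -/
def besov (σ : ℝ) (v : V → ℂ) : ℝ≥0∞ :=
  max (nInf (Δt0 v))
    (⨆ j : {j : ℕ // 1 ≤ j}, ENNReal.ofReal ((2:ℝ) ^ (σ * (j : ℕ))) * nInf (Δd ((j : ℕ) : ℤ) v))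

/-- Homogeneous Besov norm `‖v‖_{Ḃ^{-1}_{∞,∞}} = sup_{j∈ℤ} 2^{-j} ‖Δ_j v‖_∞`,
valued in `[0,∞]`. -/
def hbesovNeg1 (v : V → ℂ) : ℝ≥0∞ :=
  ⨆ j : ℤ, ENNReal.ofReal ((2:ℝ) ^ (-(j : ℝ))) * nInf (Δd j v)

/-- `i`-th component of a vector field, as a complex-valued function. -/
def comp (w : V → V) (i : Fin 3) : V → ℂ := fun x => ((w x i : ℝ) : ℂ)

/-- `|𝓕w(ξ)|²` (sum over the three components), valued in `[0,∞]`. -/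
def frSq (w : V → V) (ξ : V) : ℝ≥0∞ := ∑ i : Fin 3, (‖FT (comp w i) ξ‖₊ : ℝ≥0∞) ^ 2

/-- `∫ |ξ|² |𝓕w(ξ)|² dξ`. -/
def gradSq (w : V → V) : ℝ≥0∞ := ∫⁻ ξ, (‖ξ‖₊ : ℝ≥0∞) ^ 2 * frSq w ξ

/-- `‖∇w‖_{L²}² = ∫ 4π²|ξ|²|𝓕w(ξ)|² dξ`. -/
def gradSq4π (w : V → V) : ℝ≥0∞ :=
  ∫⁻ ξ, ENNReal.ofReal (4 * π ^ 2) * (‖ξ‖₊ : ℝ≥0∞) ^ 2 * frSq w ξ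

/-- `∫ (1+|ξ|²) |𝓕w(ξ)|² dξ` (squared `H¹` norm). -/
def h1Sq (w : V → V) : ℝ≥0∞ := ∫⁻ ξ, (1 + (‖ξ‖₊ : ℝ≥0∞) ^ 2) * frSq w ξ

/-- `∫ (1+|ξ|²)² |𝓕w(ξ)|² dξ` (squared `H²` norm). -/
def h2Sq (w : V → V) : ℝ≥0∞ := ∫⁻ ξ, (1 + (‖ξ‖₊ : ℝ≥0∞) ^ 2) ^ 2 * frSq w ξ

/-- Divergence-free on the Fourier side: `𝓕w(ξ)·ξ = 0` for a.e. `ξ`. -/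
def DivFreeF (w : V → V) : Prop :=
  ∀ᵐ ξ : V, (∑ i : Fin 3, FT (comp w i) ξ * ((ξ i : ℝ) : ℂ)) = 0

/-- Partial derivative `∂_i f (x)` of a scalar field. -/
def pd (f : V → ℝ) (i : Fin 3) (x : V) : ℝ :=
  fderiv ℝ f x (EuclideanSpace.single i (1:ℝ))

/-- A Leray–Hopf weak solution of the 3D Navier–Stokes equations on `(0,∞)×ℝ³`
with viscosity `ν` and divergence-free initial datum `u₀ ∈ L²(ℝ³;ℝ³)`. -/
structure IsLerayHopf (ν : ℝ) (u₀ : V → V) (u : ℝ → V → V) : Prop where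
  /-- measurability of `u` -/
  meas : Measurable (Function.uncurry u)
  /-- `u(t) ∈ L²` for `t > 0` -/
  memL2 : ∀ t : ℝ, 0 < t → MemLp (u t) 2 volume
  /-- (i) `ess sup_{t>0} ‖u(t)‖_{L²} < ∞` -/
  bddL2 : essSup (fun t => eLpNorm (u t) 2 volume) (volume.restrict (Set.Ioi (0:ℝ))) < ⊤
  /-- (i) `∫₀^∞ ∫ |ξ|²|𝓕u(t)(ξ)|² dξ dt < ∞` -/
  gradL2 : (∫⁻ t in Set.Ioi (0:ℝ), gradSq (u t)) < ⊤
  /-- (ii) `u(t)` is divergence-free for a.e. `t` -/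
  divFree : ∀ᵐ t ∂(volume.restrict (Set.Ioi (0:ℝ))), DivFreeF (u t)
  /-- (iii) the weak formulation against smooth compactly supported
  divergence-free test fields -/
  weak : ∀ φ : ℝ → V → V, ContDiff ℝ (⊤ : ℕ∞) (Function.uncurry φ) →
      HasCompactSupport (Function.uncurry φ) →
      (∀ t x, (∑ i : Fin 3, pd (fun y => φ t y i) i x) = 0) →
      (∫ t in Set.Ioi (0:ℝ), ∫ x,
          ((∑ j : Fin 3, u t x j * deriv (fun s => φ s x j) t)
            + ν * (∑ j : Fin 3, u t x j *
                ∑ i : Fin 3, pd (fun y => pd (fun z => φ t z j) i y) i x)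
            + ∑ i : Fin 3, ∑ j : Fin 3, u t x i * u t x j * pd (fun y => φ t y j) i x))
        + (∫ x, ∑ j : Fin 3, u₀ x j * φ 0 x j) = 0
  /-- (iv) the energy inequality for a.e. `t > 0` -/
  energy : ∀ᵐ t ∂(volume.restrict (Set.Ioi (0:ℝ))),
      (1/2 : ℝ≥0∞) * eLpNorm (u t) 2 volume ^ 2
          + ENNReal.ofReal ν * ∫⁻ τ in Set.Ioc (0:ℝ) t, gradSq4π (u τ)
        ≤ (1/2 : ℝ≥0∞) * eLpNorm u₀ 2 volume ^ 2

/-- `u` is regular in `(0,T]`: `u ∈ L^∞(0,T;H¹) ∩ L²(0,T;H²)`. -/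
def RegularOn (u : ℝ → V → V) (T : ℝ) : Prop :=
  essSup (fun t => h1Sq (u t)) (volume.restrict (Set.Ioo (0:ℝ) T)) < ⊤ ∧
    (∫⁻ t in Set.Ioo (0:ℝ) T, h2Sq (u t)) < ⊤

/-- Besov norm of a vector field: the largest Besov norm of its components. -/
def besovV (σ : ℝ) (w : V → V) : ℝ≥0∞ := ⨆ i : Fin 3, besov σ (comp w i)

section helpers
open scoped SchwartzMap Topology
open scoped InnerProductSpace

lemma ae_zero_of_schwartz {f : V → ℂ} (hf : LocallyIntegrable f volume)
    (h : ∀ g : SchwartzMap V ℂ, ∫ ξ, f ξ * g ξ = 0) : f =ᵐ[volume] 0 := by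
  apply ae_eq_zero_of_integral_contDiff_smul_eq_zero hf
  intro g g_smooth g_cpt
  have hg₁ : HasCompactSupport (Complex.ofRealCLM ∘ g) := g_cpt.comp_left rfl
  have hg₂ : ContDiff ℝ (⊤ : ℕ∞) (Complex.ofRealCLM ∘ g) := by
    exact (Complex.ofRealCLM.contDiff).comp g_smooth
  have := h (hg₁.toSchwartzMap hg₂)
  rw [← this]
  congr 1
  ext x
  simp [mul_comm]

lemma schwartz_memLp2 (g : SchwartzMap V ℂ) : MemLp g 2 volume := g.memLp 2 volume

lemma memLp_mul_int {f g : V → ℂ} (hf : MemLp f 2 volume) (hg : MemLp g 2 volume) :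
    Integrable (fun x => f x * g x) volume := by
  exact MemLp.integrable_mul hf hg

lemma memLp2_li {f : V → ℂ} (hf : MemLp f 2 volume) : LocallyIntegrable f volume :=
  hf.locallyIntegrable (by norm_num)

lemma ae_eq_of_schwartz {f g : V → ℂ} (hf : LocallyIntegrable f volume)
    (hg : LocallyIntegrable g volume)
    (hfi : ∀ φ : SchwartzMap V ℂ, Integrable (fun x => f x * φ x))
    (hgi : ∀ φ : SchwartzMap V ℂ, Integrable (fun x => g x * φ x))
    (h : ∀ φ : SchwartzMap V ℂ, ∫ ξ, f ξ * φ ξ = ∫ ξ, g ξ * φ ξ) : f =ᵐ[volume] g := by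
  have := ae_zero_of_schwartz (f := fun x => f x - g x) (hf.sub hg) (by
    intro φ
    simp only [sub_mul]
    rw [integral_sub (hfi φ) (hgi φ), h φ, sub_self])
  filter_upwards [this] with x hx
  simpa [sub_eq_zero] using hx

lemma pair_unique_right {u v v' : V → ℂ} (h : IsFourierPair u v) (h' : IsFourierPair u v') :
    v =ᵐ[volume] v' :=
  ae_eq_of_schwartz (memLp2_li h.2.1) (memLp2_li h'.2.1)
    (fun φ => memLp_mul_int h.2.1 (schwartz_memLp2 φ))
    (fun φ => memLp_mul_int h'.2.1 (schwartz_memLp2 φ))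
    (fun φ => by rw [h.2.2, h'.2.2])

lemma fourier_surj (φ : SchwartzMap V ℂ) :
    (⇑φ : V → ℂ) = FourierTransform.fourier (⇑(𝓕⁻ φ : SchwartzMap V ℂ)) := by
  rw [← SchwartzMap.fourier_coe, FourierTransform.fourier_fourierInv_eq]

lemma pair_unique_left {u u' v : V → ℂ} (h : IsFourierPair u v) (h' : IsFourierPair u' v) :
    u =ᵐ[volume] u' :=
  ae_eq_of_schwartz (memLp2_li h.1) (memLp2_li h'.1)
    (fun φ => memLp_mul_int h.1 (schwartz_memLp2 φ))
    (fun φ => memLp_mul_int h'.1 (schwartz_memLp2 φ))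
    (fun φ => by rw [fourier_surj φ, ← h.2.2, ← h'.2.2])

lemma pair_lp (f : Lp (α := V) ℂ 2) : IsFourierPair (f : V → ℂ) ((𝓕 f : Lp (α := V) ℂ 2) : V → ℂ) := by
  refine ⟨Lp.memLp _, Lp.memLp _, fun g => ?_⟩
  have := congrArg (fun T => T g) (Lp.fourier_toTemperedDistribution_eq f)
  simp only [TemperedDistribution.fourier_apply, Lp.toTemperedDistribution_apply] at this
  simp only [smul_eq_mul, SchwartzMap.fourier_coe] at this
  simp only [mul_comm _ (g _)]
  rw [← this]
  congr 1; ext x; rw [mul_comm]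

lemma IsFourierPair.congr {u v u' v' : V → ℂ} (h : IsFourierPair u v) (hu : u =ᵐ[volume] u')
    (hv : v =ᵐ[volume] v') : IsFourierPair u' v' := by
  refine ⟨h.1.ae_eq hu, h.2.1.ae_eq hv, fun g => ?_⟩
  rw [← integral_congr_ae (hv.mono fun x hx => by simp only [hx] :
    (fun ξ => v ξ * g ξ) =ᵐ[volume] fun ξ => v' ξ * g ξ), h.2.2]
  exact integral_congr_ae (hu.mono fun x hx => by simp only [hx])

lemma pair_exists {u : V → ℂ} (hu : MemLp u 2 volume) : ∃ v, IsFourierPair u v :=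
  ⟨_, (pair_lp (hu.toLp u)).congr hu.coeFn_toLp (ae_eq_refl _)⟩

lemma pair_exists_inv {v : V → ℂ} (hv : MemLp v 2 volume) : ∃ u, IsFourierPair u v := by
  refine ⟨_, (pair_lp (𝓕⁻ (hv.toLp v))).congr (ae_eq_refl _) ?_⟩
  rw [FourierTransform.fourier_fourierInv_eq]
  exact hv.coeFn_toLp

lemma FT_spec {u : V → ℂ} (hu : MemLp u 2 volume) : IsFourierPair u (FT u) := by
  have h := pair_exists hu
  unfold FT
  rw [dif_pos h]
  exact h.choose_spec

lemma FTinv_spec {v : V → ℂ} (hv : MemLp v 2 volume) : IsFourierPair (FTinv v) v := by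
  have h := pair_exists_inv hv
  unfold FTinv
  rw [dif_pos h]
  exact h.choose_spec

lemma pair_toLp {u v : V → ℂ} (h : IsFourierPair u v) :
    𝓕 (h.1.toLp u) = h.2.1.toLp v := by
  apply Lp.ext
  have h1 := (pair_lp (h.1.toLp u)).congr h.1.coeFn_toLp (ae_eq_refl _)
  exact (pair_unique_right h1 h).trans h.2.1.coeFn_toLp.symm

lemma parseval {u v u' v' : V → ℂ} (h : IsFourierPair u v) (h' : IsFourierPair u' v') :
    ∫ x, u x * conj (u' x) = ∫ ξ, v ξ * conj (v' ξ) := by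
  have := Lp.inner_fourier_eq (h'.1.toLp u') (h.1.toLp u)
  rw [pair_toLp h, pair_toLp h', L2.inner_def, L2.inner_def] at this
  have e1 : ∫ x, u x * conj (u' x) = ∫ x, ⟪(h'.1.toLp u') x, (h.1.toLp u) x⟫_ℂ := by
    apply integral_congr_ae
    filter_upwards [h.1.coeFn_toLp, h'.1.coeFn_toLp] with x hx hx'
    rw [hx, hx']; simp
  have e2 : ∫ x, v x * conj (v' x) = ∫ x, ⟪(h'.2.1.toLp v') x, (h.2.1.toLp v) x⟫_ℂ := by
    apply integral_congr_ae
    filter_upwards [h.2.1.coeFn_toLp, h'.2.1.coeFn_toLp] with x hx hx'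
    rw [hx, hx']; simp
  rw [e1, e2, this]

lemma plancherel {u v : V → ℂ} (h : IsFourierPair u v) :
    eLpNorm u 2 volume = eLpNorm v 2 volume := by
  have := Lp.norm_fourier_eq (h.1.toLp u)
  rw [pair_toLp h, Lp.norm_toLp, Lp.norm_toLp] at this
  exact ((ENNReal.toReal_eq_toReal_iff' h.2.1.2.ne h.1.2.ne).1 this).symm

lemma eLpNorm_two_sq {E : Type*} [NormedAddCommGroup E] (u : V → E) :
    eLpNorm u 2 volume ^ 2 = ∫⁻ x, ‖u x‖ₑ ^ 2 := by
  rw [eLpNorm_eq_lintegral_rpow_enorm_toReal (by norm_num) (by norm_num)]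
  simp only [ENNReal.toReal_ofNat]
  rw [← ENNReal.rpow_natCast, ← ENNReal.rpow_mul]
  norm_num

/-- exponential kernel -/
def ex (x ξ : V) : ℂ := Complex.exp (((2 * π * ⟪x, ξ⟫_ℝ : ℝ) : ℂ) * Complex.I)

/-- inverse Fourier integral -/
def Fi (p : V → ℂ) (x : V) : ℂ := ∫ ξ, p ξ * ex x ξ

lemma ex_symm (x ξ : V) : ex x ξ = ex ξ x := by simp [ex, real_inner_comm]

@[simp] lemma norm_ex (x ξ : V) : ‖ex x ξ‖ = 1 := by
  unfold ex; exact Complex.norm_exp_ofReal_mul_I _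

lemma continuous_ex : Continuous (fun q : V × V => ex q.1 q.2) := by
  unfold ex; fun_prop

lemma ex_add (x ξ η : V) : ex x (ξ + η) = ex x ξ * ex x η := by
  simp only [ex, ← Complex.exp_add, inner_add_right]
  congr 1; push_cast; ring

lemma ex_add_left (x y ξ : V) : ex (x + y) ξ = ex x ξ * ex y ξ := by
  simp only [ex, ← Complex.exp_add, inner_add_left]
  congr 1; push_cast; ring

lemma ex_neg (x ξ : V) : ex (-x) ξ = conj (ex x ξ) := by
  simp only [ex, ← Complex.exp_conj, inner_neg_left]
  congr 1; rw [map_mul, Complex.conj_ofReal, Complex.conj_I]; push_cast; ring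

lemma ex_neg_right (x ξ : V) : ex x (-ξ) = conj (ex x ξ) := by
  rw [ex_symm, ex_neg, ex_symm]

lemma ex_zero (ξ : V) : ex 0 ξ = 1 := by simp [ex]

lemma fourier_eq_Fi (p : V → ℂ) (x : V) : 𝓕 p x = Fi p (-x) := by
  rw [Real.fourier_eq', Fi]
  congr 1; ext ξ
  simp only [ex, smul_eq_mul, inner_neg_left]
  rw [mul_comm, real_inner_comm]
  congr 2
  push_cast; ring

lemma fourierInv_eq_Fi (p : V → ℂ) (x : V) : 𝓕⁻ p x = Fi p x := by
  rw [Real.fourierInv_eq_fourier_neg, fourier_eq_Fi, neg_neg]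

lemma continuous_ex_right (x : V) : Continuous (fun ξ => ex x ξ) := by
  unfold ex; fun_prop
lemma continuous_ex_left (ξ : V) : Continuous (fun x => ex x ξ) := by
  unfold ex; fun_prop

lemma int_ex {p : V → ℂ} (hp : Integrable p) (x : V) : Integrable (fun ξ => p ξ * ex x ξ) := by
  have := hp.bdd_mul (c := 1) (f := fun ξ => ex x ξ)
    ((continuous_ex_right x).aestronglyMeasurable) (Eventually.of_forall fun ξ => by simp)
  simpa [mul_comm] using this

lemma norm_Fi_le (p : V → ℂ) (x : V) : ‖Fi p x‖ ≤ ∫ ξ, ‖p ξ‖ := by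
  refine (norm_integral_le_integral_norm _).trans (le_of_eq ?_)
  simp

lemma continuous_Fi {p : V → ℂ} (hp : Integrable p) : Continuous (Fi p) := by
  unfold Fi
  refine continuous_of_dominated (bound := fun ξ => ‖p ξ‖) (fun x => (int_ex hp x).1) (fun x => ?_)
    hp.norm ?_
  · exact Eventually.of_forall fun ξ => by simp
  · exact Eventually.of_forall fun ξ => continuous_const.mul (continuous_ex_left ξ)

lemma int_kernel {p g : V → ℂ} (hp : Integrable p) (hg : Integrable g) :
    Integrable (fun q : V × V => p q.1 * g q.2 * ex q.2 q.1) (volume.prod volume) := by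
  have h := hp.mul_prod hg
  have := h.bdd_mul (c := 1) (f := fun q : V × V => ex q.2 q.1)
    ((continuous_ex.comp continuous_swap).aestronglyMeasurable)
    (Eventually.of_forall fun ξ => by simp)
  simpa [mul_comm] using this

lemma Fi_flip {p g : V → ℂ} (hp : Integrable p) (hg : Integrable g) :
    ∫ x, Fi p x * g x = ∫ ξ, p ξ * Fi g ξ := by
  have h := integral_integral_swap (f := fun ξ x => p ξ * g x * ex x ξ) (int_kernel hp hg)
  simp only [Fi]
  calc _ = ∫ x, ∫ ξ, p ξ * g x * ex x ξ := by
        congr 1; ext x; rw [← integral_mul_const]; congr 1; ext ξ; ring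
    _ = _ := h.symm
    _ = _ := by
        congr 1; ext x; rw [← integral_const_mul]; congr 1; ext ξ; rw [ex_symm]; ring

lemma int_bdd_mul {p g : V → ℂ} (hp : Continuous p) {C : ℝ} (hb : ∀ x, ‖p x‖ ≤ C)
    (hg : Integrable g) : Integrable (fun x => p x * g x) :=
  hg.bdd_mul hp.aestronglyMeasurable (Eventually.of_forall hb)

lemma pair_of_L1L2 {p : V → ℂ} (h1 : Integrable p volume) (h2 : MemLp p 2 volume) :
    IsFourierPair p (fun ξ => Fi p (-ξ)) := by
  obtain ⟨v, hv⟩ := pair_exists h2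
  refine hv.congr (ae_eq_refl _) ?_
  have hc : Continuous (fun ξ => Fi p (-ξ)) := (continuous_Fi h1).comp continuous_neg
  have hb : ∀ φ : SchwartzMap V ℂ, Integrable (fun x => Fi p (-x) * φ x) := fun φ =>
    int_bdd_mul hc (fun x => norm_Fi_le p _) (φ.integrable (μ := volume))
  refine ae_eq_of_schwartz (memLp2_li hv.2.1) hc.locallyIntegrable
    (fun φ => memLp_mul_int hv.2.1 (schwartz_memLp2 φ)) hb (fun φ => ?_)
  rw [hv.2.2]
  have := Fi_flip h1 (g := fun x => φ (-x)) (φ.integrable (μ := volume)).comp_neg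
  rw [← integral_neg_eq_self] at this
  simp only [neg_neg] at this
  rw [this]
  congr 1; ext x
  rw [fourier_eq_Fi, Fi, Fi, ← integral_neg_eq_self]
  simp [ex_neg, ex_neg_right]

lemma pair_Fi {p : V → ℂ} (h1 : Integrable p volume) (h2 : MemLp p 2 volume) :
    IsFourierPair (Fi p) p := by
  obtain ⟨u, hu⟩ := pair_exists_inv h2
  refine hu.congr ?_ (ae_eq_refl _)
  have hc : Continuous (Fi p) := continuous_Fi h1
  refine ae_eq_of_schwartz (memLp2_li hu.1) hc.locallyIntegrable
    (fun φ => memLp_mul_int hu.1 (schwartz_memLp2 φ))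
    (fun φ => int_bdd_mul hc (fun x => norm_Fi_le p _) (φ.integrable (μ := volume)))
    (fun φ => ?_)
  rw [Fi_flip h1 φ.integrable]
  have := hu.2.2 (𝓕⁻ φ : SchwartzMap V ℂ)
  rw [← fourier_surj] at this
  rw [← this]
  congr 1; ext x
  rw [SchwartzMap.fourierInv_coe, fourierInv_eq_Fi]

/-- uniqueness for L1 Fourier integral -/
lemma Fi_inj {p : V → ℂ} (hp : Integrable p) (h : ∀ x, Fi p x = 0) : p =ᵐ[volume] 0 := by
  refine ae_zero_of_schwartz hp.locallyIntegrable (fun g => ?_)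
  have : (⇑g : V → ℂ) = Fi (fun x => (𝓕 g : SchwartzMap V ℂ) x) := by
    have h1 : (⇑g : V → ℂ) = ⇑(𝓕⁻ (𝓕 g : SchwartzMap V ℂ) : SchwartzMap V ℂ) := by
      rw [FourierTransform.fourierInv_fourier_eq]
    rw [h1, SchwartzMap.fourierInv_coe]
    ext x
    rw [fourierInv_eq_Fi]
  rw [this]
  simp only [← Fi_flip hp (SchwartzMap.integrable _), h, zero_mul, integral_zero]

lemma Fi_shift (p : V → ℂ) (ζ x : V) : Fi (fun ξ => p (ξ - ζ)) x = Fi p x * ex x ζ := by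
  rw [Fi, Fi, ← integral_add_right_eq_self (μ := volume) _ ζ, ← integral_mul_const]
  congr 1; ext ξ
  simp [ex_add, mul_assoc]

/-- multiplication formula for `h ∈ L²` and `p ∈ L¹∩L²` -/
lemma pair_mult {h hh p : V → ℂ} (H : IsFourierPair h hh) (h1 : Integrable p volume)
    (h2 : MemLp p 2 volume) : ∫ x, h x * p x = ∫ ζ, hh ζ * Fi p ζ := by
  have hp : IsFourierPair (fun x => conj (p x)) (fun ξ => Fi (fun x => conj (p x)) (-ξ)) := by
    apply pair_of_L1L2
    · exact (Complex.conjLIE.toContinuousLinearEquiv.toContinuousLinearMap.integrable_comp h1 :)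
    · exact h2.star
  have := parseval H hp
  simp only [Complex.conj_conj] at this
  rw [this]
  congr 1; ext ξ
  simp only [Fi, ← integral_conj]
  simp [ex_neg]

/-- Fourier multiplier of `∂_i` -/
def dmul (i : Fin 3) (p : V → ℂ) : V → ℂ := fun ξ => (2 * π * Complex.I * ((ξ i : ℝ) : ℂ)) * p ξ

/-- sharp low-pass cut-off on the Fourier side -/
def cutf (R : ℝ) (p : V → ℂ) : V → ℂ := {ξ : V | ‖ξ‖ < R}.indicator p

lemma coord_le (ξ : V) (i : Fin 3) : |ξ i| ≤ ‖ξ‖ := by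
  have := EuclideanSpace.norm_eq ξ
  have h2 := PiLp.norm_apply_le (p := 2) ξ i
  simpa using h2

lemma cutf_apply (R : ℝ) (p : V → ℂ) (ξ : V) : cutf R p ξ = if ‖ξ‖ < R then p ξ else 0 := by
  simp [cutf, Set.indicator_apply]

lemma meas_ballset (R : ℝ) : MeasurableSet {ξ : V | ‖ξ‖ < R} :=
  measurableSet_lt measurable_norm measurable_const

lemma cutf_memLp {p : V → ℂ} (hp : MemLp p 2 volume) (R : ℝ) : MemLp (cutf R p) 2 volume :=
  hp.indicator (meas_ballset R)

lemma volume_ballset (R : ℝ) : volume {ξ : V | ‖ξ‖ < R} < ⊤ := by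
  have : {ξ : V | ‖ξ‖ < R} = Metric.ball 0 R := by ext; simp
  rw [this]; exact measure_ball_lt_top

lemma supp_integrable {p : V → ℂ} (hp : MemLp p 2 volume) {R : ℝ} (hs : ∀ ξ, R ≤ ‖ξ‖ → p ξ = 0) :
    Integrable p := by
  have h1 : p = {ξ : V | ‖ξ‖ < R}.indicator p := by
    ext ξ; by_cases h : ‖ξ‖ < R
    · simp [h]
    · simp [h, hs ξ (not_lt.1 h)]
  rw [h1, integrable_indicator_iff (meas_ballset R)]
  have : IsFiniteMeasure (volume.restrict {ξ : V | ‖ξ‖ < R}) :=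
    ⟨by simpa using volume_ballset R⟩
  exact (hp.restrict _).integrable (by norm_num)

lemma cutf_supp (R : ℝ) (p : V → ℂ) : ∀ ξ, R ≤ ‖ξ‖ → cutf R p ξ = 0 := by
  intro ξ h; simp [cutf_apply, not_lt.2 h]

lemma dmul_supp (i : Fin 3) {R : ℝ} {p : V → ℂ} (hs : ∀ ξ, R ≤ ‖ξ‖ → p ξ = 0) :
    ∀ ξ, R ≤ ‖ξ‖ → dmul i p ξ = 0 := by
  intro ξ h; simp [dmul, hs ξ h]

lemma norm_dmul_le (i : Fin 3) {R : ℝ} {p : V → ℂ} (hs : ∀ ξ, R ≤ ‖ξ‖ → p ξ = 0) (ξ : V) :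
    ‖dmul i p ξ‖ ≤ 2 * π * R * ‖p ξ‖ := by
  by_cases h : R ≤ ‖ξ‖
  · simp [dmul, hs ξ h]
  · push Not at h
    simp only [dmul, norm_mul, Complex.norm_real, Complex.norm_I, Complex.norm_ofNat, mul_one,
      Real.norm_eq_abs, abs_of_pos Real.pi_pos]
    have := coord_le ξ i
    gcongr
    linarith

lemma meas_coord (i : Fin 3) : Continuous (fun ξ : V => ξ i) := by fun_prop

lemma dmul_memLp (i : Fin 3) {R : ℝ} {p : V → ℂ} (hp : MemLp p 2 volume)
    (hs : ∀ ξ, R ≤ ‖ξ‖ → p ξ = 0) : MemLp (dmul i p) 2 volume := by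
  refine MemLp.of_le_mul (c := 2 * π * R) hp ?_ (Eventually.of_forall (norm_dmul_le i hs))
  refine AEStronglyMeasurable.mul ?_ hp.1
  apply Continuous.aestronglyMeasurable
  fun_prop

lemma exists_kernel : ∃ K : Fin 3 → SchwartzMap V ℂ, ∀ i (η : V), ‖η‖ ≤ 1 →
    Fi (K i) η = 2 * π * Complex.I * ((η i : ℝ) : ℂ) := by
  let b : ContDiffBump (0 : V) := ⟨1, 2, one_pos, one_lt_two⟩
  let g0 : Fin 3 → V → ℂ := fun i η => (2 * π * Complex.I * ((η i : ℝ) : ℂ)) * ((b η : ℝ) : ℂ)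
  have hc : ∀ i, HasCompactSupport (g0 i) := fun i =>
    HasCompactSupport.mul_left (b.hasCompactSupport.comp_left (g := fun r : ℝ => (r : ℂ)) (by simp))
  have hs : ∀ i, ContDiff ℝ (⊤ : ℕ∞) (g0 i) := fun i => by
    have h1 : ContDiff ℝ (⊤ : ℕ∞) (fun η : V => ((b η : ℝ) : ℂ)) :=
      Complex.ofRealCLM.contDiff.comp b.contDiff
    have h2 : ContDiff ℝ (⊤ : ℕ∞) (fun η : V => ((η i : ℝ) : ℂ)) :=
      Complex.ofRealCLM.contDiff.comp (EuclideanSpace.proj i : V →L[ℝ] ℝ).contDiff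
    exact (contDiff_const.mul h2).mul h1
  let G : Fin 3 → SchwartzMap V ℂ := fun i => (hc i).toSchwartzMap (hs i)
  let K : Fin 3 → SchwartzMap V ℂ := fun i => 𝓕 (G i)
  refine ⟨K, fun i η hη => ?_⟩
  have hG : g0 i η = Fi (K i) η := by
    have h1 : G i = 𝓕⁻ (K i) := by simp [K]
    have h2 : g0 i η = G i η := rfl
    rw [h2, h1, SchwartzMap.fourierInv_coe, fourierInv_eq_Fi]
  rw [← hG]
  have hb : b η = 1 := by
    apply b.one_of_mem_closedBall
    simpa using hη
  simp only [g0, hb]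
  simp

lemma int_kernel2 {p g : V → ℂ} (hp : Integrable p) (hg : Integrable g) (r : ℝ) :
    Integrable (fun q : V × V => p q.1 * g q.2 * ex (r • q.2) q.1) (volume.prod volume) := by
  have h := hp.mul_prod hg
  have hc : Continuous (fun q : V × V => ex (r • q.2) q.1) :=
    continuous_ex.comp ((continuous_snd.const_smul r).prodMk continuous_fst)
  have := h.bdd_mul (c := 1) (f := fun q : V × V => ex (r • q.2) q.1)
    hc.aestronglyMeasurable (Eventually.of_forall fun ξ => by simp)
  simpa [mul_comm] using this

lemma exists_bernstein : ∃ C : ℝ, 0 < C ∧ ∀ (R : ℝ) (p : V → ℂ) (M : ℝ), 0 < R → MemLp p 2 volume →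
    (∀ ξ, R ≤ ‖ξ‖ → p ξ = 0) → (∀ x, ‖Fi p x‖ ≤ M) → ∀ i x, ‖Fi (dmul i p) x‖ ≤ C * R * M := by
  obtain ⟨K, hK⟩ := exists_kernel
  let C : ℝ := ∑ i, ∫ y, ‖K i y‖
  refine ⟨C + 1, by positivity, ?_⟩
  intro R p M hR hp hsupp hM i x
  have hM0 : 0 ≤ M := (norm_nonneg _).trans (hM 0)
  have hp1 : Integrable p := supp_integrable hp hsupp
  have key : Fi (dmul i p) x = R * ∫ y, K i y * Fi p (x + R⁻¹ • y) := by
    have hint := int_kernel2 (int_ex hp1 x) ((K i).integrable (μ := volume)) R⁻¹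
    have h := integral_integral_swap
      (f := fun ξ y => (p ξ * ex x ξ) * K i y * ex (R⁻¹ • y) ξ) hint
    calc Fi (dmul i p) x = ∫ ξ, R * ∫ y, (p ξ * ex x ξ) * K i y * ex (R⁻¹ • y) ξ := by
          rw [Fi]; congr 1; ext ξ
          have e1 : ∀ y, (p ξ * ex x ξ) * K i y * ex (R⁻¹ • y) ξ
              = (p ξ * ex x ξ) * (K i y * ex (R⁻¹ • ξ) y) := by
            intro y
            have : ex (R⁻¹ • y) ξ = ex (R⁻¹ • ξ) y := by
              simp only [ex, inner_smul_left, real_inner_comm]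
            rw [this]; ring
          simp only [e1]
          rw [integral_const_mul]
          have e2 : ∫ y, K i y * ex (R⁻¹ • ξ) y = Fi (K i) (R⁻¹ • ξ) := rfl
          rw [e2]
          by_cases hξ : R ≤ ‖ξ‖
          · simp [dmul, hsupp ξ hξ]
          · push Not at hξ
            have hb : ‖R⁻¹ • ξ‖ ≤ 1 := by
              simp only [norm_smul, norm_inv, Real.norm_eq_abs, abs_of_pos hR]
              rw [inv_mul_le_iff₀ hR]; linarith
            rw [hK i _ hb, dmul]
            simp only [PiLp.smul_apply, smul_eq_mul]
            have : (R : ℂ) ≠ 0 := by exact_mod_cast hR.ne'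
            push_cast
            field_simp
      _ = R * ∫ ξ, ∫ y, (p ξ * ex x ξ) * K i y * ex (R⁻¹ • y) ξ := by rw [integral_const_mul]
      _ = _ := by
          rw [h]; congr 2; ext y
          rw [Fi, ← integral_const_mul]; congr 1; ext ξ
          rw [ex_add_left]; ring
  rw [key, norm_mul]
  have h1 : ‖∫ y, K i y * Fi p (x + R⁻¹ • y)‖ ≤ (∫ y, ‖K i y‖) * M := by
    rw [← integral_mul_const]
    refine norm_integral_le_of_norm_le (((K i).integrable (μ := volume)).norm.mul_const M)
      (Eventually.of_forall fun y => ?_)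
    rw [norm_mul]; gcongr; exact hM _
  have h2 : (∫ y, ‖K i y‖) ≤ C :=
    Finset.single_le_sum (f := fun i => ∫ y, ‖K i y‖)
      (fun j _ => integral_nonneg fun y => norm_nonneg _) (Finset.mem_univ i)
  have h3 : ‖(R : ℂ)‖ = R := by simp [abs_of_pos hR]
  rw [h3]
  calc R * _ ≤ R * ((∫ y, ‖K i y‖) * M) := by gcongr
    _ ≤ R * ((C + 1) * M) := by gcongr; linarith
    _ = _ := by ring

lemma memLp_conj {f : V → ℂ} (hf : MemLp f 2 volume) : MemLp (fun x => conj (f x)) 2 volume :=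
  hf.star

lemma memLp_mul_bdd {f g : V → ℂ} {M : ℝ} (hf : MemLp f 2 volume) (hg : AEStronglyMeasurable g volume)
    (hM : ∀ x, ‖g x‖ ≤ M) : MemLp (fun x => f x * g x) 2 volume := by
  refine MemLp.of_le_mul (c := M) hf (hf.1.mul hg) (Eventually.of_forall fun x => ?_)
  rw [norm_mul, mul_comm]; gcongr; exact hM x

/-- bundle: a band-limited function `Fi p`. -/
structure BL (R : ℝ) (p : V → ℂ) : Prop where
  mem : MemLp p 2 volume
  supp : ∀ ξ, R ≤ ‖ξ‖ → p ξ = 0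

lemma BL.int {R : ℝ} {p : V → ℂ} (h : BL R p) : Integrable p := supp_integrable h.mem h.supp
lemma BL.pair {R : ℝ} {p : V → ℂ} (h : BL R p) : IsFourierPair (Fi p) p := pair_Fi h.int h.mem
lemma BL.cont {R : ℝ} {p : V → ℂ} (h : BL R p) : Continuous (Fi p) := continuous_Fi h.int
lemma BL.dmul {R : ℝ} {p : V → ℂ} (h : BL R p) (i : Fin 3) : BL R (dmul i p) :=
  ⟨dmul_memLp i h.mem h.supp, dmul_supp i h.supp⟩
lemma BL.cutf {p : V → ℂ} (h : MemLp p 2 volume) (R : ℝ) : BL R (cutf R p) :=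
  ⟨cutf_memLp h R, cutf_supp R p⟩

lemma BL.prod_L1 {R R' : ℝ} {p q : V → ℂ} (h : BL R p) (h' : BL R' q) :
    Integrable (fun x => Fi p x * conj (Fi q x)) := memLp_mul_int h.pair.1 (memLp_conj h'.pair.1)

lemma BL.prod_L2 {R R' : ℝ} {p q : V → ℂ} (h : BL R p) (h' : BL R' q) :
    MemLp (fun x => Fi p x * conj (Fi q x)) 2 volume :=
  memLp_mul_bdd h.pair.1 (memLp_conj h'.pair.1).1 (M := ∫ ξ, ‖q ξ‖)
    (fun x => by simpa using norm_Fi_le q x)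

/-- Fourier transform of a product of band-limited functions -/
lemma BL.prod_Fi {R R' : ℝ} {p q : V → ℂ} (h : BL R p) (h' : BL R' q) (ζ : V) :
    Fi (fun x => Fi p x * conj (Fi q x)) ζ = ∫ ξ, p (ξ - ζ) * conj (q ξ) := by
  have h1 : Integrable (fun ξ => p (ξ - ζ)) := h.int.comp_sub_right ζ
  have h2 : MemLp (fun ξ => p (ξ - ζ)) 2 volume :=
    h.mem.comp_measurePreserving (measurePreserving_sub_right volume ζ)
  have := parseval (pair_Fi h1 h2) h'.pair
  rw [← this, Fi]
  congr 1; ext x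
  rw [Fi_shift, ex_symm]; ring

lemma hi_orth {h hh α β : V → ℂ} {ρ : ℝ} (H : IsFourierPair h hh) (hz : ∀ ζ, ‖ζ‖ < 2 * ρ → hh ζ = 0)
    (hα : BL ρ α) (hβ : BL ρ β) : ∫ x, h x * (Fi α x * conj (Fi β x)) = 0 := by
  rw [pair_mult H (hα.prod_L1 hβ) (hα.prod_L2 hβ)]
  rw [← integral_zero V ℂ (μ := volume)]
  congr 1; ext ζ
  by_cases hζ : ‖ζ‖ < 2 * ρ
  · simp [hz ζ hζ]
  · rw [hα.prod_Fi hβ]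
    have : ∫ ξ, α (ξ - ζ) * conj (β ξ) = ∫ ξ : V, (0 : ℂ) := by
      congr 1; ext ξ
      by_cases h1 : ρ ≤ ‖ξ‖
      · simp [hβ.supp ξ h1]
      · rw [hα.supp (ξ - ζ), zero_mul]
        have := norm_sub_norm_le ζ ξ
        rw [norm_sub_rev] at this
        push Not at h1 hζ
        linarith
    simp [this]

lemma shift_int {R : ℝ} {p q : V → ℂ} (h : BL R p) {R' : ℝ} (h' : BL R' q) (ζ : V) :
    Integrable (fun ξ => p (ξ - ζ) * conj (q ξ)) := by
  have h2 : MemLp (fun ξ => p (ξ - ζ)) 2 volume :=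
    h.mem.comp_measurePreserving (measurePreserving_sub_right volume ζ)
  exact memLp_mul_int h2 (memLp_conj h'.mem)

lemma div_cancel {u w : Fin 3 → V → ℂ} (H : ∀ i, IsFourierPair (u i) (w i))
    (hreal : ∀ i x, conj (u i x) = u i x)
    (hdiv : ∀ᵐ ξ : V, (∑ i : Fin 3, w i ξ * ((ξ i : ℝ) : ℂ)) = 0) {R : ℝ} {p : V → ℂ} (hp : BL R p) :
    (∑ i, ∫ x, u i x * (Fi p x * conj (Fi (dmul i p) x))).re = 0 := by
  let P : Fin 3 → V → ℂ := fun i x => Fi p x * conj (Fi (dmul i p) x) + Fi (dmul i p) x * conj (Fi p x)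
  have hP1 : ∀ i, Integrable (P i) := fun i => (hp.prod_L1 (hp.dmul i)).add ((hp.dmul i).prod_L1 hp)
  have hP2 : ∀ i, MemLp (P i) 2 volume :=
    fun i => (hp.prod_L2 (hp.dmul i)).add ((hp.dmul i).prod_L2 hp)
  have hF : ∀ i ζ, Fi (P i) ζ = - (2 * π * Complex.I * ((ζ i : ℝ) : ℂ)) * ∫ ξ, p (ξ - ζ) * conj (p ξ) := by
    intro i ζ
    have e : Fi (P i) ζ = Fi (fun x => Fi p x * conj (Fi (dmul i p) x)) ζ
        + Fi (fun x => Fi (dmul i p) x * conj (Fi p x)) ζ := by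
      show (∫ x, P i x * ex ζ x) = (∫ x, Fi p x * conj (Fi (dmul i p) x) * ex ζ x)
        + ∫ x, Fi (dmul i p) x * conj (Fi p x) * ex ζ x
      rw [← integral_add (int_ex (hp.prod_L1 (hp.dmul i)) ζ) (int_ex ((hp.dmul i).prod_L1 hp) ζ)]
      congr 1; ext x; simp only [P]; ring
    rw [e, hp.prod_Fi (hp.dmul i), (hp.dmul i).prod_Fi hp,
      ← integral_add (shift_int hp (hp.dmul i) ζ) (shift_int (hp.dmul i) hp ζ), ← integral_const_mul]
    congr 1; ext ξ
    simp only [dmul, map_mul, Complex.conj_ofReal, Complex.conj_I, map_ofNat, PiLp.sub_apply]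
    push_cast; ring
  have hsum : ∑ i, ∫ x, u i x * P i x = 0 := by
    have e1 : ∀ i, ∫ x, u i x * P i x = ∫ ζ, w i ζ * Fi (P i) ζ := fun i => pair_mult (H i) (hP1 i) (hP2 i)
    simp only [e1]
    have hi : ∀ i, Integrable (fun ζ => w i ζ * Fi (P i) ζ) := by
      intro i
      refine memLp_mul_int (H i).2.1 ?_
      have := (pair_of_L1L2 (hP1 i) (hP2 i)).2.1.comp_measurePreserving
        (Measure.measurePreserving_neg (volume : Measure V))
      simpa [Function.comp_def] using this
    rw [← integral_finsetSum _ (fun i _ => hi i)]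
    rw [← integral_zero V ℂ (μ := volume)]
    apply integral_congr_ae
    filter_upwards [hdiv] with ζ hζ
    have : ∑ i, w i ζ * Fi (P i) ζ
        = (∑ i, w i ζ * ((ζ i : ℝ) : ℂ)) * (- (2 * π * Complex.I) * ∫ ξ, p (ξ - ζ) * conj (p ξ)) := by
      rw [Finset.sum_mul]
      refine Finset.sum_congr rfl fun i _ => ?_
      rw [hF]; ring
    rw [this, hζ, zero_mul]
  have hre : ∀ i, (∫ x, u i x * P i x) = 2 * ((∫ x, u i x * (Fi p x * conj (Fi (dmul i p) x))).re : ℂ) := by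
    intro i
    have hi : Integrable (fun x => u i x * (Fi p x * conj (Fi (dmul i p) x))) :=
      memLp_mul_int (H i).1 (hp.prod_L2 (hp.dmul i))
    have e2 : (∫ x, u i x * P i x) = (∫ x, u i x * (Fi p x * conj (Fi (dmul i p) x)))
       + conj (∫ x, u i x * (Fi p x * conj (Fi (dmul i p) x))) := by
      have hi' : Integrable (fun x => conj (u i x * (Fi p x * conj (Fi (dmul i p) x)))) :=
        memLp_one_iff_integrable.1 (memLp_one_iff_integrable.2 hi).star
      rw [← integral_conj, ← integral_add hi hi']
      congr 1; ext x
      simp only [P, map_mul, hreal, Complex.conj_conj]; ring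
    rw [e2, Complex.add_conj]; push_cast; ring
  simp only [hre] at hsum
  rw [← Finset.mul_sum, ← Complex.ofReal_sum] at hsum
  rw [Complex.re_sum]
  have := (mul_eq_zero.1 hsum).resolve_left two_ne_zero
  exact_mod_cast this

lemma tri_bound {f g φ : V → ℂ} {M s : ℝ} (hs : 0 < s) (hf : MemLp f 2 volume) (hg : MemLp g 2 volume)
    (hM : ∀ x, ‖φ x‖ ≤ M) :
    ‖∫ x, f x * g x * φ x‖ ≤ M / 2 * (s * (∫ x, ‖f x‖ ^ 2) + s⁻¹ * ∫ x, ‖g x‖ ^ 2) := by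
  have hM0 : 0 ≤ M := (norm_nonneg _).trans (hM 0)
  rw [← integral_const_mul, ← integral_const_mul]
  have hf2 : Integrable (fun x => ‖f x‖ ^ 2) := hf.integrable_norm_pow (by norm_num)
  have hg2 : Integrable (fun x => ‖g x‖ ^ 2) := hg.integrable_norm_pow (by norm_num)
  rw [← integral_add (hf2.const_mul s) (hg2.const_mul _), ← integral_const_mul]
  refine norm_integral_le_of_norm_le (((hf2.const_mul s).add (hg2.const_mul _)).const_mul _)
    (Eventually.of_forall fun x => ?_)
  rw [norm_mul, norm_mul]
  have h1 : ‖f x‖ * ‖g x‖ ≤ (s * ‖f x‖ ^ 2 + s⁻¹ * ‖g x‖ ^ 2) / 2 := by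
    have e : s⁻¹ * (s * ‖f x‖ - ‖g x‖) ^ 2 = s * ‖f x‖ ^ 2 + s⁻¹ * ‖g x‖ ^ 2 - 2 * (‖f x‖ * ‖g x‖) := by
      field_simp; ring
    have : 0 ≤ s⁻¹ * (s * ‖f x‖ - ‖g x‖) ^ 2 := by positivity
    linarith
  calc _ ≤ ((s * ‖f x‖ ^ 2 + s⁻¹ * ‖g x‖ ^ 2) / 2) * M := by gcongr; exact hM x
    _ = _ := by ring

lemma plancherel_int {u v : V → ℂ} (h : IsFourierPair u v) : ∫ x, ‖u x‖ ^ 2 = ∫ ξ, ‖v ξ‖ ^ 2 := by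
  have := parseval h h
  simp only [Complex.mul_conj, Complex.normSq_eq_norm_sq] at this
  rw [integral_complex_ofReal, integral_complex_ofReal] at this
  exact_mod_cast this

lemma Fi_sub {p q : V → ℂ} (hp : Integrable p) (hq : Integrable q) (x : V) :
    Fi (fun ξ => p ξ - q ξ) x = Fi p x - Fi q x := by
  simp only [Fi]
  rw [← integral_sub (int_ex hp x) (int_ex hq x)]
  congr 1; ext ξ; ring

lemma pair_sub {u v u' v' : V → ℂ} (h : IsFourierPair u v) (h' : IsFourierPair u' v') :
    IsFourierPair (fun x => u x - u' x) (fun x => v x - v' x) := by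
  refine ⟨h.1.sub h'.1, h.2.1.sub h'.2.1, fun g => ?_⟩
  have hg : MemLp (FourierTransform.fourier (⇑g)) 2 volume := by
    rw [← SchwartzMap.fourier_coe]; exact schwartz_memLp2 _
  simp only [sub_mul]
  rw [integral_sub (memLp_mul_int h.2.1 (schwartz_memLp2 g)) (memLp_mul_int h'.2.1 (schwartz_memLp2 g)),
    integral_sub (memLp_mul_int h.1 hg) (memLp_mul_int h'.1 hg), h.2.2, h'.2.2]

lemma tri_int {f g φ : V → ℂ} {M : ℝ} (hf : MemLp f 2 volume) (hg : MemLp g 2 volume)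
    (hφ : AEStronglyMeasurable φ volume) (hM : ∀ x, ‖φ x‖ ≤ M) :
    Integrable (fun x => f x * g x * φ x) := by
  have := memLp_mul_int hf (memLp_mul_bdd hg hφ hM)
  simpa [mul_assoc] using this

/-- energy above frequency `ρ` -/
def hiA (ρ : ℝ) (w : V → ℂ) : ℝ := ∫ ξ in {ξ : V | ρ ≤ ‖ξ‖}, ‖w ξ‖ ^ 2

lemma meas_hiset (R : ℝ) : MeasurableSet {ξ : V | R ≤ ‖ξ‖} :=
  measurableSet_le measurable_const measurable_norm

lemma sq_int {w : V → ℂ} (h : MemLp w 2 volume) : Integrable (fun ξ => ‖w ξ‖ ^ 2) :=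
  h.integrable_norm_pow (by norm_num)

lemma le_hiA {w p : V → ℂ} {ρ : ℝ} (hw : MemLp w 2 volume) (h : ∀ ξ, ‖p ξ‖ ≤ ‖w ξ‖)
    (hz : ∀ ξ, ‖ξ‖ < ρ → p ξ = 0) : ∫ ξ, ‖p ξ‖ ^ 2 ≤ hiA ρ w := by
  unfold hiA
  rw [← integral_indicator (meas_hiset ρ)]
  refine integral_mono_of_nonneg (Eventually.of_forall fun ξ => by positivity)
    ((sq_int hw).indicator (meas_hiset ρ)) (Eventually.of_forall fun ξ => ?_)
  by_cases hξ : ρ ≤ ‖ξ‖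
  · simp only [Set.indicator, Set.mem_ofPred_eq, hξ, if_true]
    gcongr; exact h ξ
  · simp only [Set.indicator, Set.mem_ofPred_eq, hξ, if_false]
    simp [hz ξ (not_le.1 hξ)]

lemma int4 {f a b c d : V → ℂ} (ha : Integrable a) (hb : Integrable b) (hc : Integrable c)
    (hd : Integrable d) (hz : ∫ x, d x = 0) (h : ∀ x, f x = a x + b x + c x + d x) :
    ∫ x, f x = (∫ x, a x) + (∫ x, b x) + ∫ x, c x := by
  have e : f = a + b + c + d := funext h
  rw [e, integral_add' ((ha.add hb).add hc) hd, integral_add' (ha.add hb) hc, integral_add' ha hb, hz,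
    add_zero]

/-- the trilinear term -/
def TT (R : ℝ) (u w : Fin 3 → V → ℂ) : ℝ :=
  (∑ m, ∑ i, ∫ x, u i x * u m x * conj (Fi (dmul i (cutf R (w m))) x)).re

lemma TT_zero {u w : Fin 3 → V → ℂ} (H : ∀ i, IsFourierPair (u i) (w i)) {R M1 : ℝ}
    (hM1 : ∀ i m x, ‖Fi (dmul i (cutf R (w m))) x‖ ≤ M1) :
    |TT R u w| ≤ 3 * M1 * ∑ m, hiA 0 (w m) := by
  have key : ∀ m i, ‖∫ x, u i x * u m x * conj (Fi (dmul i (cutf R (w m))) x)‖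
      ≤ M1 / 2 * (hiA 0 (w i) + hiA 0 (w m)) := by
    intro m i
    have hM0 : 0 ≤ M1 := (norm_nonneg _).trans (hM1 0 0 0)
    refine (tri_bound (s := 1) one_pos (H i).1 (H m).1 (M := M1) (fun x => ?_)).trans ?_
    · rw [RCLike.norm_conj]; exact hM1 i m x
    · rw [plancherel_int (H i), plancherel_int (H m), inv_one, one_mul, one_mul]
      gcongr
      · exact le_hiA (H i).2.1 (fun ξ => le_rfl) (fun ξ h => absurd h (not_lt.2 (norm_nonneg _)))
      · exact le_hiA (H m).2.1 (fun ξ => le_rfl) (fun ξ h => absurd h (not_lt.2 (norm_nonneg _)))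
  refine (Complex.abs_re_le_norm _).trans ((norm_sum_le _ _).trans ?_)
  refine (Finset.sum_le_sum fun m _ => (norm_sum_le _ _).trans (Finset.sum_le_sum fun i _ => key m i)).trans ?_
  simp only [Fin.sum_univ_three]
  apply le_of_eq; ring

lemma TT_bound {u w : Fin 3 → V → ℂ} (H : ∀ i, IsFourierPair (u i) (w i))
    (hreal : ∀ i x, conj (u i x) = u i x)
    (hdiv : ∀ᵐ ξ : V, (∑ i : Fin 3, w i ξ * ((ξ i : ℝ) : ℂ)) = 0) {ρ M0 M1 : ℝ} (hρ : 0 < ρ)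
    (hM0 : ∀ m x, ‖Fi (cutf ρ (w m)) x‖ ≤ M0)
    (hM1 : ∀ i m x, ‖Fi (dmul i (cutf (2 * ρ) (w m))) x‖ ≤ M1) :
    |TT (2 * ρ) u w| ≤ 3 * (M1 + 4 * π * ρ * M0) * ∑ m, hiA ρ (w m) := by
  have hM00 : 0 ≤ M0 := (norm_nonneg _).trans (hM0 0 0)
  have hM10 : 0 ≤ M1 := (norm_nonneg _).trans (hM1 0 0 0)
  have BLl : ∀ m, BL (2 * ρ) (cutf (2 * ρ) (w m)) := fun m => BL.cutf (H m).2.1 _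
  have BLl' : ∀ m, BL ρ (cutf ρ (w m)) := fun m => BL.cutf (H m).2.1 _
  have BLd : ∀ m, BL (2 * ρ) (fun ξ => cutf (2 * ρ) (w m) ξ - cutf ρ (w m) ξ) := fun m =>
    ⟨(BLl m).mem.sub (BLl' m).mem, fun ξ hξ => by
      rw [(BLl m).supp ξ hξ, (BLl' m).supp ξ (by linarith), sub_zero]⟩
  have Hg : ∀ i, IsFourierPair (fun x => u i x - Fi (cutf ρ (w i)) x)
    (fun ξ => w i ξ - cutf ρ (w i) ξ) := fun i => pair_sub (H i) (BLl' i).pair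
  have Hh : ∀ i, IsFourierPair (fun x => u i x - Fi (cutf (2 * ρ) (w i)) x)
    (fun ξ => w i ξ - cutf (2 * ρ) (w i) ξ) := fun i => pair_sub (H i) (BLl i).pair
  have bconj : ∀ i m x, ‖conj (Fi (dmul i (cutf (2 * ρ) (w m))) x)‖ ≤ M1 := fun i m x => by
    rw [RCLike.norm_conj]; exact hM1 i m x
  have mconj : ∀ i m, AEStronglyMeasurable (fun x => conj (Fi (dmul i (cutf (2 * ρ) (w m))) x)) volume :=
    fun i m => (memLp_conj ((BLl m).dmul i).pair.1).1
  have split : ∀ m i, ∫ x, u i x * u m x * conj (Fi (dmul i (cutf (2 * ρ) (w m))) x)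
      = (∫ x, u i x * (Fi (cutf (2 * ρ) (w m)) x * conj (Fi (dmul i (cutf (2 * ρ) (w m))) x)))
      + (∫ x, (u i x - Fi (cutf ρ (w i)) x) * (u m x - Fi (cutf (2 * ρ) (w m)) x) *
          conj (Fi (dmul i (cutf (2 * ρ) (w m))) x))
      + ∫ x, (u m x - Fi (cutf (2 * ρ) (w m)) x) *
          conj (Fi (dmul i (fun ξ => cutf (2 * ρ) (w m) ξ - cutf ρ (w m) ξ)) x) * Fi (cutf ρ (w i)) x := by
    intro m i
    have z := hi_orth (Hh m) (ρ := ρ) (fun ζ hζ => by simp [cutf_apply, hζ]) (BLl' i) ((BLl' m).dmul i)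
    have i1 : Integrable (fun x => u i x * (Fi (cutf (2 * ρ) (w m)) x * conj (Fi (dmul i (cutf (2 * ρ) (w m))) x))) :=
      memLp_mul_int (H i).1 ((BLl m).prod_L2 ((BLl m).dmul i))
    have i2 := tri_int (Hg i).1 (Hh m).1 (mconj i m) (bconj i m)
    have i3 := tri_int (Hh m).1 (memLp_conj ((BLd m).dmul i).pair.1) (BLl' i).cont.aestronglyMeasurable (hM0 i)
    have i4 : Integrable (fun x => (u m x - Fi (cutf (2 * ρ) (w m)) x) *
      (Fi (cutf ρ (w i)) x * conj (Fi (dmul i (cutf ρ (w m))) x))) :=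
      memLp_mul_int (Hh m).1 ((BLl' i).prod_L2 ((BLl' m).dmul i))
    refine int4 i1 i2 i3 i4 z (fun x => ?_)
    have e : Fi (dmul i (fun ξ => cutf (2 * ρ) (w m) ξ - cutf ρ (w m) ξ)) x =
      Fi (dmul i (cutf (2 * ρ) (w m))) x - Fi (dmul i (cutf ρ (w m))) x := by
      rw [← Fi_sub ((BLl m).dmul i).int ((BLl' m).dmul i).int]
      congr 1; ext ξ; simp only [dmul]; ring
    rw [e, map_sub]; ring
  have main : ∀ m, ∀ i, ‖(∫ x, (u i x - Fi (cutf ρ (w i)) x) * (u m x - Fi (cutf (2 * ρ) (w m)) x) *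
          conj (Fi (dmul i (cutf (2 * ρ) (w m))) x))
      + ∫ x, (u m x - Fi (cutf (2 * ρ) (w m)) x) *
          conj (Fi (dmul i (fun ξ => cutf (2 * ρ) (w m) ξ - cutf ρ (w m) ξ)) x) * Fi (cutf ρ (w i)) x‖
      ≤ M1 / 2 * (hiA ρ (w i) + hiA ρ (w m)) + 4 * π * ρ * M0 * hiA ρ (w m) := by
    intro m i
    have ag : ∫ x, ‖u i x - Fi (cutf ρ (w i)) x‖ ^ 2 ≤ hiA ρ (w i) := by
      rw [plancherel_int (Hg i)]
      refine le_hiA (H i).2.1 (fun ξ => ?_) (fun ξ hξ => by simp [cutf_apply, hξ])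
      rw [cutf_apply]; split_ifs <;> simp
    have ah : ∫ x, ‖u m x - Fi (cutf (2 * ρ) (w m)) x‖ ^ 2 ≤ hiA ρ (w m) := by
      rw [plancherel_int (Hh m)]
      refine le_hiA (H m).2.1 (fun ξ => ?_) (fun ξ hξ => ?_)
      · rw [cutf_apply]; split_ifs <;> simp
      · have : ‖ξ‖ < 2 * ρ := by linarith
        simp [cutf_apply, this]
    have ad : ∫ x, ‖conj (Fi (dmul i (fun ξ => cutf (2 * ρ) (w m) ξ - cutf ρ (w m) ξ)) x)‖ ^ 2
        ≤ (4 * π * ρ) ^ 2 * hiA ρ (w m) := by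
      simp only [RCLike.norm_conj]
      rw [plancherel_int ((BLd m).dmul i).pair]
      have : ∫ ξ, ‖cutf (2 * ρ) (w m) ξ - cutf ρ (w m) ξ‖ ^ 2 ≤ hiA ρ (w m) := by
        refine le_hiA (H m).2.1 (fun ξ => ?_) (fun ξ hξ => ?_)
        · rw [cutf_apply, cutf_apply]; split_ifs <;> simp
        · have : ‖ξ‖ < 2 * ρ := by linarith
          simp [cutf_apply, this, hξ]
      refine le_trans ?_ (mul_le_mul_of_nonneg_left this (by positivity))
      rw [← integral_const_mul]
      refine integral_mono_of_nonneg (Eventually.of_forall fun ξ => by positivity)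
        ((sq_int (BLd m).mem).const_mul _) (Eventually.of_forall fun ξ => ?_)
      have := norm_dmul_le i (BLd m).supp ξ
      calc _ ≤ (2 * π * (2 * ρ) * ‖cutf (2 * ρ) (w m) ξ - cutf ρ (w m) ξ‖) ^ 2 :=
            pow_le_pow_left₀ (norm_nonneg _) this 2
        _ = _ := by ring
    refine (norm_add_le _ _).trans (add_le_add ?_ ?_)
    · refine (tri_bound (s := 1) one_pos (Hg i).1 (Hh m).1 (bconj i m)).trans ?_
      rw [inv_one, one_mul, one_mul]
      gcongr
    · have hs : 0 < 4 * π * ρ := by positivity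
      refine (tri_bound hs (Hh m).1 (memLp_conj ((BLd m).dmul i).pair.1) (hM0 i)).trans ?_
      calc _ ≤ M0 / 2 * ((4 * π * ρ) * hiA ρ (w m) + (4 * π * ρ)⁻¹ * ((4 * π * ρ) ^ 2 * hiA ρ (w m))) := by
            gcongr
        _ = _ := by field_simp; ring
  unfold TT
  have hT : (∑ m, ∑ i, ∫ x, u i x * u m x * conj (Fi (dmul i (cutf (2 * ρ) (w m))) x)).re
     = (∑ m, ∑ i, ((∫ x, (u i x - Fi (cutf ρ (w i)) x) * (u m x - Fi (cutf (2 * ρ) (w m)) x) *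
          conj (Fi (dmul i (cutf (2 * ρ) (w m))) x))
      + ∫ x, (u m x - Fi (cutf (2 * ρ) (w m)) x) *
          conj (Fi (dmul i (fun ξ => cutf (2 * ρ) (w m) ξ - cutf ρ (w m) ξ)) x) * Fi (cutf ρ (w i)) x)).re := by
    rw [Complex.re_sum, Complex.re_sum]
    refine Finset.sum_congr rfl fun m _ => ?_
    have := div_cancel H hreal hdiv (BLl m)
    simp only [split, add_assoc]
    rw [Finset.sum_add_distrib, Complex.add_re, this, zero_add]
  rw [hT]
  refine (Complex.abs_re_le_norm _).trans ((norm_sum_le _ _).trans ?_)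
  refine (Finset.sum_le_sum fun m _ => (norm_sum_le _ _).trans (Finset.sum_le_sum fun i _ => main m i)).trans ?_
  simp only [Fin.sum_univ_three]
  apply le_of_eq; ring

lemma geo_aux {X : ℕ → ℝ} {c q : ℝ} (hc : 0 ≤ c) (hq : 1 < q) (h0 : X 0 ≤ c)
    (hs : ∀ k, X (k + 1) ≤ X k + c * q ^ (k + 1)) (k : ℕ) : X k ≤ c * (q / (q - 1)) * q ^ k := by
  have hq1 : 0 < q - 1 := by linarith
  induction k with
  | zero =>
    have : 1 ≤ q / (q - 1) := by rw [le_div_iff₀ hq1]; linarith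
    simp only [pow_zero, mul_one]
    nlinarith
  | succ k ih =>
    refine (hs k).trans ((add_le_add_left ih _).trans (le_of_eq ?_))
    field_simp; ring

/-- radii: `rad 0 = 0`, `rad (k+1) = 2^k` -/
def rad : ℕ → ℝ
  | 0 => 0
  | (k + 1) => 2 ^ k

lemma TT_dyadic {qr : ℝ} (hqr : 1 < qr) : ∃ C : ℝ, 0 < C ∧ ∀ (u w : Fin 3 → V → ℂ) (b : ℝ),
    (∀ i, IsFourierPair (u i) (w i)) → (∀ i x, conj (u i x) = u i x) →
    (∀ᵐ ξ : V, (∑ i : Fin 3, w i ξ * ((ξ i : ℝ) : ℂ)) = 0) →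
    (∀ m x, ‖Fi (cutf 1 (w m)) x‖ ≤ b) →
    (∀ k : ℕ, ∀ m x, ‖Fi (fun ξ => cutf (2 ^ (k + 1)) (w m) ξ - cutf (2 ^ k) (w m) ξ) x‖ ≤ b * qr ^ (k + 1)) →
    ∀ k : ℕ, |TT (2 ^ k) u w| ≤ C * (2 * qr) ^ k * b * ∑ m, hiA (rad k) (w m) := by
  obtain ⟨CB, hCB, hB⟩ := exists_bernstein
  have h2q : 1 < 2 * qr := by linarith
  have hqr1 : 0 < qr - 1 := by linarith
  have hqr2 : 0 < 2 * qr - 1 := by linarith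
  have hqr0 : 0 < qr := by linarith
  set K1 : ℝ := (2 * qr) / (2 * qr - 1)
  set K0 : ℝ := qr / (qr - 1)
  have hK1 : 0 < K1 := by positivity
  have hK0 : 0 < K0 := by positivity
  refine ⟨3 * (CB * K1 + 4 * π * K0), by positivity, ?_⟩
  intro u w b H hreal hdiv hb0 hb k
  have hb0' : 0 ≤ b := (norm_nonneg _).trans (hb0 0 0)
  have BLl : ∀ (k : ℕ) m, BL (2 ^ k) (cutf (2 ^ k) (w m)) := fun k m => BL.cutf (H m).2.1 _
  have BLd : ∀ (k : ℕ) m, BL (2 ^ (k + 1)) (fun ξ => cutf (2 ^ (k + 1)) (w m) ξ - cutf (2 ^ k) (w m) ξ) := fun k m =>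
    ⟨(BLl _ m).mem.sub (BLl _ m).mem, fun ξ hξ => by
      rw [(BLl _ m).supp ξ hξ, (BLl k m).supp ξ (le_trans (by gcongr <;> norm_num) hξ), sub_zero]⟩
  have hM0 : ∀ (k : ℕ) m x, ‖Fi (cutf (2 ^ k) (w m)) x‖ ≤ b * K0 * qr ^ k := by
    intro k m x
    refine geo_aux (X := fun k => ‖Fi (cutf (2 ^ k) (w m)) x‖) hb0' hqr ?_ (fun k => ?_) k
    · simpa using hb0 m x
    · refine le_trans ?_ (add_le_add_right (hb k m x) _)
      rw [Fi_sub (BLl _ m).int (BLl _ m).int]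
      simpa using norm_add_le (Fi (cutf (2 ^ k) (w m)) x) (Fi (cutf (2 ^ (k + 1)) (w m)) x - Fi (cutf (2 ^ k) (w m)) x)
  have hM1 : ∀ (k : ℕ) i m x, ‖Fi (dmul i (cutf (2 ^ k) (w m))) x‖ ≤ CB * b * K1 * (2 * qr) ^ k := by
    intro k i m x
    refine geo_aux (X := fun k => ‖Fi (dmul i (cutf (2 ^ k) (w m))) x‖) (by positivity) h2q ?_ (fun k => ?_) k
    · simpa using hB 1 (cutf 1 (w m)) b one_pos (cutf_memLp (H m).2.1 1) (cutf_supp _ _) (hb0 m) i x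
    · have h1 := hB (2 ^ (k + 1)) _ _ (by positivity) (BLd k m).mem (BLd k m).supp (hb k m) i x
      have e : Fi (dmul i (fun ξ => cutf (2 ^ (k + 1)) (w m) ξ - cutf (2 ^ k) (w m) ξ)) x =
        Fi (dmul i (cutf (2 ^ (k + 1)) (w m))) x - Fi (dmul i (cutf (2 ^ k) (w m))) x := by
        rw [← Fi_sub ((BLl _ m).dmul i).int ((BLl _ m).dmul i).int]
        congr 1; ext ξ; simp only [dmul]; ring
      rw [e] at h1
      have h2 := norm_add_le (Fi (dmul i (cutf (2 ^ k) (w m))) x) (Fi (dmul i (cutf (2 ^ (k + 1)) (w m))) x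
        - Fi (dmul i (cutf (2 ^ k) (w m))) x)
      rw [add_sub_cancel] at h2
      refine h2.trans ((add_le_add_right h1 _).trans (le_of_eq ?_))
      rw [mul_pow]; ring
  have hsum : ∀ ρ, 0 ≤ ∑ m, hiA ρ (w m) := fun ρ => Finset.sum_nonneg fun m _ => by
    unfold hiA; positivity
  cases k with
  | zero =>
    have := TT_zero H (hM1 0)
    refine this.trans ?_
    simp only [rad]
    refine mul_le_mul_of_nonneg_right ?_ (hsum 0)
    have : 0 ≤ 4 * π * K0 * b := by positivity
    simp only [pow_zero, mul_one]; linarith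
  | succ k =>
    have := TT_bound H hreal hdiv (ρ := 2 ^ k) (by positivity) (hM0 k) (by
      intro i m x
      have := hM1 (k + 1) i m x
      rwa [show (2 : ℝ) * 2 ^ k = 2 ^ (k + 1) by ring])
    rw [show (2 : ℝ) * 2 ^ k = 2 ^ (k + 1) by ring] at this
    refine this.trans ?_
    simp only [rad]
    refine mul_le_mul_of_nonneg_right ?_ (hsum _)
    have h1 : 0 ≤ 4 * π * K0 * b * (2 ^ k * qr ^ k) := by positivity
    have h2 : 4 * π * K0 * b * (2 ^ k * qr ^ k) ≤ 4 * π * K0 * b * (2 ^ k * qr ^ k) * (2 * qr) :=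
      le_mul_of_one_le_right h1 h2q.le
    have e1 : (2 * qr) ^ (k + 1) = (2 ^ k * qr ^ k) * (2 * qr) := by rw [pow_succ, mul_pow]
    rw [e1]
    nlinarith

/-- sequence of bump functions -/
def bmp (n : ℕ) : ContDiffBump (0 : V) :=
  ⟨1 / (n + 1), 2 / (n + 1), by positivity, by gcongr; norm_num⟩

def bmpC (n : ℕ) : V → ℂ := fun η => (((bmp n).normed volume η : ℝ) : ℂ)

lemma bmpC_cont (n : ℕ) : Continuous (bmpC n) :=
  Complex.continuous_ofReal.comp (bmp n).continuous_normed

lemma bmpC_supp (n : ℕ) : HasCompactSupport (bmpC n) :=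
  (bmp n).hasCompactSupport_normed.comp_left (g := fun x : ℝ => (x : ℂ)) rfl

lemma bmpC_int (n : ℕ) : Integrable (bmpC n) :=
  (bmpC_cont n).integrable_of_hasCompactSupport (bmpC_supp n)

def Un (n : ℕ) (v : ℝ → V → ℂ) (q : ℝ × V) : ℂ :=
  ∫ x, v q.1 x * (Fi (bmpC n) (-x) * ex (-x) q.2)

/-- jointly measurable version of the Fourier transform -/
def Uh (v : ℝ → V → ℂ) (q : ℝ × V) : ℂ := limUnder atTop (fun n => Un n v q)

lemma Uh_meas {v : ℝ → V → ℂ} (hv : Measurable (uncurry v)) : StronglyMeasurable (Uh v) := by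
  apply StronglyMeasurable.limUnder
  intro n
  unfold Un
  have : StronglyMeasurable (fun q : (ℝ × V) × V => v q.1.1 q.2 * (Fi (bmpC n) (-q.2) * ex (-q.2) q.1.2)) := by
    have h1 : StronglyMeasurable (fun q : (ℝ × V) × V => v q.1.1 q.2) :=
      (hv.comp ((measurable_fst.comp measurable_fst).prodMk measurable_snd)).stronglyMeasurable
    have h2 : Continuous (fun q : (ℝ × V) × V => Fi (bmpC n) (-q.2)) :=
      (continuous_Fi (bmpC_int n)).comp continuous_snd.neg
    have h3 : Continuous (fun q : (ℝ × V) × V => ex (-q.2) q.1.2) := by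
      unfold ex; fun_prop
    exact StronglyMeasurable.mul h1 (StronglyMeasurable.mul h2.stronglyMeasurable h3.stronglyMeasurable)
  exact this.integral_prod_right'

lemma Uh_pair {v : ℝ → V → ℂ} {t : ℝ} {w : V → ℂ} (h : IsFourierPair (v t) w) :
    (fun ξ => Uh v (t, ξ)) =ᵐ[volume] w := by
  have hlim : Tendsto (fun i => (bmp i).rOut) atTop (𝓝 0) := by
    have : Tendsto (fun n : ℕ => 2 * (1 / ((n : ℝ) + 1))) atTop (𝓝 (2 * 0)) :=
      tendsto_one_div_add_atTop_nhds_zero_nat.const_mul 2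
    rw [mul_zero] at this
    refine this.congr fun n => ?_
    simp [bmp]; ring
  have := ContDiffBump.ae_convolution_tendsto_right_of_locallyIntegrable (φ := bmp) (K := 2) hlim
    (Eventually.of_forall fun n => by simp [bmp]; ring_nf; exact le_rfl) (memLp2_li h.2.1) (μ := volume)
  filter_upwards [this] with ξ hξ
  apply Tendsto.limUnder_eq
  refine hξ.congr fun n => ?_
  rw [convolution_eq_swap]
  let g0 : V → ℂ := fun η => bmpC n (η - ξ)
  have hc : HasCompactSupport g0 := (bmpC_supp n).comp_homeomorph (Homeomorph.subRight ξ)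
  have hs : ContDiff ℝ (⊤ : ℕ∞) g0 := by
    refine (Complex.ofRealCLM.contDiff.comp ((bmp n).contDiff_normed (n := (⊤ : ℕ∞)))).comp ?_
    exact contDiff_id.sub contDiff_const
  have e := h.2.2 (hc.toSchwartzMap hs)
  simp only [Un]
  have e2 : ∀ x, FourierTransform.fourier (⇑(hc.toSchwartzMap hs)) x = Fi (bmpC n) (-x) * ex (-x) ξ := by
    intro x
    rw [fourier_eq_Fi, ← Fi_shift]; rfl
  simp only [e2] at e
  rw [← e]
  congr 1; ext η
  rw [mul_comm]
  show ((bmp n).normed volume (ξ - η) : ℝ) • w η = (((bmp n).normed volume (η - ξ) : ℝ) : ℂ) * w η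
  rw [← neg_sub η ξ, ContDiffBump.normed_neg]
  simp

lemma Uh_spec {v : ℝ → V → ℂ} {t : ℝ} (hv : MemLp (v t) 2 volume) :
    IsFourierPair (v t) (fun ξ => Uh v (t, ξ)) :=
  (FT_spec hv).congr (ae_eq_refl _) (Uh_pair (FT_spec hv)).symm

/-! ### Besov pieces -/

lemma enorm_le_nInf {f : V → ℂ} (hf : Continuous f) (x : V) : ‖f x‖ₑ ≤ nInf f := by
  have h : ∀ᵐ x : V, ‖f x‖ₑ ≤ nInf f := by
    unfold nInf; rw [eLpNorm_exponent_top]; exact ae_le_eLpNormEssSup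
  have hd := Measure.dense_of_ae h
  have hc : IsClosed {x | ‖f x‖ₑ ≤ nInf f} := isClosed_le hf.enorm continuous_const
  have := hd.closure_eq
  rw [hc.closure_eq] at this
  have hx : x ∈ {x | ‖f x‖ₑ ≤ nInf f} := by rw [this]; trivial
  exact hx

lemma nInf_cut {v w : V → ℂ} (h : IsFourierPair v w) {S : Set V} (hS : MeasurableSet S) {R : ℝ}
    (hR : ∀ ξ, R ≤ ‖ξ‖ → ξ ∉ S) (x : V) : ‖Fi (S.indicator w) x‖ₑ ≤ nInf (cut S v) := by
  have hb : BL R (S.indicator w) := ⟨h.2.1.indicator hS, fun ξ hξ => by simp [hR ξ hξ]⟩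
  have h0 := FT_spec h.1
  have h1 : IsFourierPair (cut S v) (S.indicator (FT v)) := FTinv_spec (h0.2.1.indicator hS)
  have e : S.indicator (FT v) =ᵐ[volume] S.indicator w :=
    (pair_unique_right h0 h).mono fun ξ hξ => by simp [Set.indicator, hξ]
  have h2 := pair_unique_left (h1.congr (ae_eq_refl _) e) hb.pair
  have : nInf (cut S v) = nInf (Fi (S.indicator w)) := eLpNorm_congr_ae h2
  rw [this]
  exact enorm_le_nInf hb.cont x

lemma besov_low {σ : ℝ} {v w : V → ℂ} (h : IsFourierPair v w) (x : V) :
    ‖Fi (cutf 1 w) x‖ₑ ≤ besov σ v :=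
  (nInf_cut h (meas_ballset 1) (R := 1) (fun _ hξ hh => absurd hh (not_lt.2 hξ)) x).trans (le_max_left _ _)

lemma besov_piece {σ : ℝ} {v w : V → ℂ} (h : IsFourierPair v w) (k : ℕ) (x : V) :
    ‖Fi (fun ξ => cutf (2 ^ (k + 1)) w ξ - cutf (2 ^ k) w ξ) x‖ₑ
      ≤ ENNReal.ofReal (((2 : ℝ) ^ (-σ)) ^ (k + 1)) * besov σ v := by
  let S : Set V := {ξ : V | (2 : ℝ) ^ ((((k + 1 : ℕ) : ℤ)) - 1) ≤ ‖ξ‖ ∧ ‖ξ‖ < (2 : ℝ) ^ ((k + 1 : ℕ) : ℤ)}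
  have hS : MeasurableSet S := (meas_hiset _).inter (meas_ballset _)
  have e1 : (2 : ℝ) ^ ((((k + 1 : ℕ) : ℤ)) - 1) = 2 ^ k := by simp
  have e2 : (2 : ℝ) ^ ((k + 1 : ℕ) : ℤ) = 2 ^ (k + 1) := by rw [zpow_natCast]
  have hk : (2 : ℝ) ^ k ≤ 2 ^ (k + 1) := by gcongr <;> norm_num
  have e : (fun ξ => cutf (2 ^ (k + 1)) w ξ - cutf (2 ^ k) w ξ) = S.indicator w := by
    ext ξ
    simp only [cutf_apply, Set.indicator_apply, S, e1, e2, Set.mem_ofPred_eq]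
    by_cases h1 : ‖ξ‖ < 2 ^ k
    · simp [h1, h1.trans_le hk]
    · by_cases h2 : ‖ξ‖ < 2 ^ (k + 1)
      · simp [h1, h2, not_lt.1 h1]
      · simp [h1, h2]
  rw [e]
  have h1 := nInf_cut h hS (R := 2 ^ (k + 1)) (fun ξ hξ hh => by
    have := hh.2; rw [e2] at this; linarith) x
  have h2 : ENNReal.ofReal ((2:ℝ) ^ (σ * ((k + 1 : ℕ) : ℝ))) * nInf (cut S v) ≤ besov σ v :=
    (le_iSup (fun j : {j : ℕ // 1 ≤ j} => ENNReal.ofReal ((2:ℝ) ^ (σ * (j : ℕ))) * nInf (Δd ((j : ℕ) : ℤ) v))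
      ⟨k + 1, by omega⟩).trans (le_max_right _ _)
  refine h1.trans ?_
  calc nInf (cut S v) = ENNReal.ofReal (((2 : ℝ) ^ (-σ)) ^ (k + 1)) *
        (ENNReal.ofReal ((2:ℝ) ^ (σ * ((k + 1 : ℕ) : ℝ))) * nInf (cut S v)) := by
        rw [← mul_assoc, ← ENNReal.ofReal_mul (by positivity), ← Real.rpow_natCast, ← Real.rpow_mul (by norm_num),
          ← Real.rpow_add (by norm_num)]
        simp
    _ ≤ _ := by gcongr

/-- measurable substitute for the Besov norm -/
def bb (qr : ℝ) (w : Fin 3 → ℝ → V → ℂ) (t : ℝ) : ℝ≥0∞ :=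
  ⨆ m : Fin 3, ⨆ n : ℕ, max ‖Fi (cutf 1 (w m t)) (TopologicalSpace.denseSeq V n)‖ₑ
    (⨆ k : ℕ, (ENNReal.ofReal (qr ^ (k + 1)))⁻¹ *
      ‖Fi (fun ξ => cutf (2 ^ (k + 1)) (w m t) ξ - cutf (2 ^ k) (w m t) ξ) (TopologicalSpace.denseSeq V n)‖ₑ)

lemma cutf_meas {w : ℝ → V → ℂ} (hw : StronglyMeasurable (uncurry w)) (R : ℝ) :
    StronglyMeasurable (fun q : ℝ × V => cutf R (w q.1) q.2) := by
  have : (fun q : ℝ × V => cutf R (w q.1) q.2) = {q : ℝ × V | ‖q.2‖ < R}.indicator (uncurry w) := by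
    ext q; simp [cutf_apply, Set.indicator_apply, uncurry]
  rw [this]
  exact hw.indicator (measurableSet_lt measurable_snd.norm measurable_const)

lemma Fi_meas {w : ℝ → V → ℂ} (hw : StronglyMeasurable (uncurry w)) (x : V) :
    StronglyMeasurable (fun t => Fi (w t) x) := by
  unfold Fi
  have : StronglyMeasurable (fun q : ℝ × V => w q.1 q.2 * ex x q.2) :=
    hw.mul ((continuous_ex_right x).comp continuous_snd).stronglyMeasurable
  exact this.integral_prod_right'

lemma bb_meas (qr : ℝ) {w : Fin 3 → ℝ → V → ℂ} (hw : ∀ m, StronglyMeasurable (uncurry (w m))) :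
    Measurable (bb qr w) := by
  unfold bb
  refine Measurable.iSup fun m => Measurable.iSup fun n => Measurable.max ?_ (Measurable.iSup fun k => ?_)
  · exact (Fi_meas (w := fun t ξ => cutf 1 (w m t) ξ) (cutf_meas (hw m) 1) _).measurable.enorm
  · refine Measurable.const_mul ?_ _
    exact (Fi_meas (w := fun t ξ => cutf (2 ^ (k + 1)) (w m t) ξ - cutf (2 ^ k) (w m t) ξ)
      ((cutf_meas (hw m) _).sub (cutf_meas (hw m) _)) _).measurable.enorm

lemma bb_le {σ : ℝ} {u : ℝ → V → V} {w : Fin 3 → ℝ → V → ℂ} {t : ℝ}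
    (h : ∀ m, IsFourierPair (comp (u t) m) (w m t)) : bb ((2 : ℝ) ^ (-σ)) w t ≤ besovV σ (u t) := by
  unfold bb
  refine iSup_le fun m => iSup_le fun n => max_le ?_ (iSup_le fun k => ?_)
  · exact (besov_low (h m) _).trans (le_iSup (fun i => besov σ (comp (u t) i)) m)
  · have hpos : 0 < ((2 : ℝ) ^ (-σ)) ^ (k + 1) := by positivity
    rw [mul_comm, ← div_eq_mul_inv]
    apply ENNReal.div_le_of_le_mul
    rw [mul_comm]
    refine (besov_piece (σ := σ) (h m) k _).trans ?_
    gcongr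
    exact le_iSup (fun i => besov σ (comp (u t) i)) m

lemma bound_of_dense {f : V → ℂ} (hf : Continuous f) {c : ℝ≥0∞} (hc : c ≠ ⊤)
    (h : ∀ n, ‖f (TopologicalSpace.denseSeq V n)‖ₑ ≤ c) (x : V) : ‖f x‖ ≤ c.toReal := by
  have hd := TopologicalSpace.denseRange_denseSeq V
  have hcl : IsClosed {x | ‖f x‖ₑ ≤ c} := isClosed_le hf.enorm continuous_const
  have hx : ‖f x‖ₑ ≤ c := hd.induction_on (p := fun x => ‖f x‖ₑ ≤ c) x hcl h
  rw [← toReal_enorm]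
  exact ENNReal.toReal_mono hc hx

lemma bb_spec {qr : ℝ} (hq : 0 < qr) {w : Fin 3 → ℝ → V → ℂ} {t : ℝ} (hw : ∀ m, MemLp (w m t) 2 volume)
    (hb : bb qr w t ≠ ⊤) :
    (∀ m x, ‖Fi (cutf 1 (w m t)) x‖ ≤ (bb qr w t).toReal) ∧
    (∀ k : ℕ, ∀ m x, ‖Fi (fun ξ => cutf (2 ^ (k + 1)) (w m t) ξ - cutf (2 ^ k) (w m t) ξ) x‖
      ≤ (bb qr w t).toReal * qr ^ (k + 1)) := by
  constructor
  · intro m x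
    refine bound_of_dense (BL.cutf (hw m) 1).cont hb (fun n => ?_) x
    unfold bb
    exact le_iSup_of_le m (le_iSup_of_le n (le_max_left _ _))
  · intro k m x
    have hpos : 0 < qr ^ (k + 1) := by positivity
    have hne : bb qr w t * ENNReal.ofReal (qr ^ (k + 1)) ≠ ⊤ := ENNReal.mul_ne_top hb ENNReal.ofReal_ne_top
    have := bound_of_dense (f := Fi (fun ξ => cutf (2 ^ (k + 1)) (w m t) ξ - cutf (2 ^ k) (w m t) ξ))
      (continuous_Fi ((BL.cutf (hw m) _).int.sub (BL.cutf (hw m) _).int)) hne (fun n => ?_) x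
    · rwa [ENNReal.toReal_mul, ENNReal.toReal_ofReal hpos.le] at this
    · rw [mul_comm]
      have h2 : (ENNReal.ofReal (qr ^ (k + 1)))⁻¹ *
        ‖Fi (fun ξ => cutf (2 ^ (k + 1)) (w m t) ξ - cutf (2 ^ k) (w m t) ξ) (TopologicalSpace.denseSeq V n)‖ₑ ≤ bb qr w t := by
        unfold bb
        exact le_iSup_of_le m (le_iSup_of_le n (le_max_of_le_right (le_iSup_of_le k le_rfl)))
      rwa [ENNReal.inv_mul_le_iff (by simpa using hpos) ENNReal.ofReal_ne_top] at h2

/-- real test functions -/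
structure TF (f : V → ℝ) : Prop where
  smooth : ContDiff ℝ (⊤ : ℕ∞) f
  cpt : HasCompactSupport f

/-- complexification -/
def cc (f : V → ℝ) : V → ℂ := fun x => ((f x : ℝ) : ℂ)

lemma TF.pd {f : V → ℝ} (h : TF f) (i : Fin 3) : TF (fun x => pd f i x) := by
  constructor
  · have h1 : ContDiff ℝ (⊤ : ℕ∞) (fderiv ℝ f) := h.smooth.fderiv_right (m := (⊤ : ℕ∞)) (by simp)
    exact h1.clm_apply contDiff_const
  · have := h.cpt.fderiv (𝕜 := ℝ)
    exact this.comp_left (g := fun L : V →L[ℝ] ℝ => L (EuclideanSpace.single i (1:ℝ))) rfl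

lemma TF.sub {f g : V → ℝ} (h : TF f) (h' : TF g) : TF (fun x => f x - g x) :=
  ⟨h.smooth.sub h'.smooth, by
    have := h.cpt.add (h'.cpt.comp_left (g := fun r : ℝ => -r) (by simp))
    have e : (fun x => f x - g x) = f + (fun r : ℝ => -r) ∘ g := by ext; simp [sub_eq_add_neg]
    rw [e]; exact this⟩

lemma TF.add {f g : V → ℝ} (h : TF f) (h' : TF g) : TF (fun x => f x + g x) :=
  ⟨h.smooth.add h'.smooth, h.cpt.add h'.cpt⟩

lemma TF.zero : TF (fun _ => 0) := ⟨contDiff_const, HasCompactSupport.zero⟩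

lemma TF.sum3 {f : Fin 3 → V → ℝ} (h : ∀ i, TF (f i)) : TF (fun x => ∑ i, f i x) := by
  simp only [Fin.sum_univ_three]
  exact ((h 0).add (h 1)).add (h 2)

lemma TF.cc_smooth {f : V → ℝ} (h : TF f) : ContDiff ℝ (⊤ : ℕ∞) (cc f) :=
  Complex.ofRealCLM.contDiff.comp h.smooth
lemma TF.cc_cpt {f : V → ℝ} (h : TF f) : HasCompactSupport (cc f) :=
  h.cpt.comp_left (g := fun r : ℝ => (r : ℂ)) (by simp)

def TF.S {f : V → ℝ} (h : TF f) : SchwartzMap V ℂ := h.cc_cpt.toSchwartzMap h.cc_smooth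

lemma TF.S_coe {f : V → ℝ} (h : TF f) : (⇑h.S : V → ℂ) = cc f := rfl

lemma TF.int {f : V → ℝ} (h : TF f) : Integrable (cc f) := h.S.integrable
lemma TF.mem {f : V → ℝ} (h : TF f) : MemLp (cc f) 2 volume := schwartz_memLp2 h.S

/-- the Schwartz function `Fi (cc f)`. -/
def TF.K {f : V → ℝ} (h : TF f) : SchwartzMap V ℂ := 𝓕⁻ h.S

lemma TF.K_coe {f : V → ℝ} (h : TF f) : (⇑h.K : V → ℂ) = Fi (cc f) := by
  ext x; rw [TF.K, SchwartzMap.fourierInv_coe, fourierInv_eq_Fi]; rfl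

lemma TF.bdd {f : V → ℝ} (h : TF f) : ∃ C, ∀ x, ‖cc f x‖ ≤ C :=
  h.cc_cpt.exists_bound_of_continuous h.cc_smooth.continuous

lemma Fi_pd {f : V → ℝ} (h : TF f) (i : Fin 3) (ξ : V) :
    Fi (cc (fun x => pd f i x)) ξ = -(2 * π * Complex.I * ((ξ i : ℝ) : ℂ)) * Fi (cc f) ξ := by
  have hd : ∀ x, fderiv ℝ (cc f) x = Complex.ofRealCLM.comp (fderiv ℝ f x) := by
    intro x
    exact (Complex.ofRealCLM.hasFDerivAt.comp x
      (h.smooth.differentiable (by simp) x).hasFDerivAt).fderiv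
  have hint : Integrable (fderiv ℝ (cc f)) :=
    (h.cc_smooth.continuous_fderiv (by simp)).integrable_of_hasCompactSupport (h.cc_cpt.fderiv (𝕜 := ℝ))
  have e1 : cc (fun x => pd f i x) = fun x => fderiv ℝ (cc f) x (EuclideanSpace.single i (1:ℝ)) := by
    ext x; rw [hd]; rfl
  have e2 := Real.fourier_fderiv h.int (h.cc_smooth.differentiable (by simp)) hint
  have e3 := congrArg (fun F => F (-ξ) (EuclideanSpace.single i (1:ℝ))) e2
  simp only [Real.fourier_continuousLinearMap_apply hint, VectorFourier.fourierSMulRight_apply] at e3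
  rw [← e1, fourier_eq_Fi, fourier_eq_Fi, neg_neg] at e3
  rw [e3]
  have e4 : (innerSL ℝ ξ) (EuclideanSpace.single i (1:ℝ)) = ξ i := by
    rw [innerSL_apply_apply]; simp [EuclideanSpace.inner_single_right]
  simp [e4]
  ring

lemma TF.eq_zero {f : V → ℝ} (h : TF f) (hz : ∀ ξ, Fi (cc f) ξ = 0) (x : V) : f x = 0 := by
  have h1 := Fi_inj h.int hz
  have h2 := Continuous.ae_eq_iff_eq (μ := (volume : Measure V)) h.cc_smooth.continuous
    (continuous_zero) |>.1 h1
  have := congrFun h2 x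
  simpa [cc] using this

/-- Parseval against an L¹ function -/
lemma L1_mult {g : V → ℝ} (h : TF g) {p : V → ℂ} (hp : Integrable p) :
    ∫ x, p x * cc g x = ∫ ξ, Fi (cc g) ξ * Fi p (-ξ) := by
  let A : SchwartzMap V ℂ := 𝓕 h.S
  have e : ∀ x, cc g x = Fi A x := by
    intro x
    rw [← fourierInv_eq_Fi, ← SchwartzMap.fourierInv_coe]
    simp only [A, FourierTransform.fourierInv_fourier_eq]; rfl
  have e2 : ∀ ξ, A (-ξ) = Fi (cc g) ξ := by
    intro ξ
    simp only [A, SchwartzMap.fourier_coe, fourier_eq_Fi, neg_neg]; rfl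
  calc ∫ x, p x * cc g x = ∫ x, Fi A x * p x := by congr 1; ext x; rw [e, mul_comm]
    _ = ∫ ξ, A ξ * Fi p ξ := Fi_flip A.integrable hp
    _ = ∫ ξ, A (-ξ) * Fi p (-ξ) := (integral_neg_eq_self (fun ξ => A ξ * Fi p ξ) volume).symm
    _ = _ := by simp only [e2]

/-- the divergence free test field `∂_j∂_m f - δ_{jm} Δ f` -/
def WW (f : V → ℝ) (m j : Fin 3) (x : V) : ℝ :=
  pd (fun y => pd f m y) j x - (if j = m then ∑ i : Fin 3, pd (fun y => pd f i y) i x else 0)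

lemma WW_TF {f : V → ℝ} (h : TF f) (m j : Fin 3) : TF (WW f m j) := by
  unfold WW
  split_ifs
  · exact ((h.pd m).pd j).sub (TF.sum3 fun i => (h.pd i).pd i)
  · exact ((h.pd m).pd j).sub TF.zero

lemma Fi_sum3 {p : Fin 3 → V → ℂ} (hp : ∀ i, Integrable (p i)) (ξ : V) :
    Fi (fun x => ∑ i, p i x) ξ = ∑ i, Fi (p i) ξ := by
  simp only [Fi]
  rw [← integral_finsetSum _ (fun i _ => int_ex (hp i) ξ)]
  congr 1; ext x; rw [Finset.sum_mul]

lemma sq_norm_eq (ξ : V) : ((‖ξ‖ ^ 2 : ℝ) : ℂ) = ∑ i, ((ξ i : ℝ) : ℂ) ^ 2 := by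
  rw [EuclideanSpace.norm_sq_eq]; simp only [Real.norm_eq_abs, sq_abs]; push_cast; rfl

lemma Fi_lap {f : V → ℝ} (h : TF f) (ξ : V) :
    Fi (cc (fun x => ∑ i : Fin 3, pd (fun y => pd f i y) i x)) ξ
      = -(4 * π ^ 2 * ((‖ξ‖ ^ 2 : ℝ) : ℂ)) * Fi (cc f) ξ := by
  have e : cc (fun x => ∑ i : Fin 3, pd (fun y => pd f i y) i x)
    = fun x => ∑ i : Fin 3, cc (fun x => pd (fun y => pd f i y) i x) x := by
    ext x; simp [cc]
  rw [e, Fi_sum3 (fun i => ((h.pd i).pd i).int)]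
  simp only [Fi_pd (h.pd _), Fi_pd h, sq_norm_eq, Fin.sum_univ_three]
  linear_combination (4 * π ^ 2 * (((ξ 0 : ℝ) : ℂ) ^ 2 + ((ξ 1 : ℝ) : ℂ) ^ 2 + ((ξ 2 : ℝ) : ℂ) ^ 2) * Fi (cc f) ξ) * Complex.I_sq

lemma Fi_WW {f : V → ℝ} (h : TF f) (m j : Fin 3) (ξ : V) :
    Fi (cc (WW f m j)) ξ = -(4 * π ^ 2) * (((ξ j : ℝ) : ℂ) * ((ξ m : ℝ) : ℂ)
      - (if j = m then ((‖ξ‖ ^ 2 : ℝ) : ℂ) else 0)) * Fi (cc f) ξ := by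
  have e1 : Fi (cc (fun x => pd (fun y => pd f m y) j x)) ξ
     = -(4 * π ^ 2) * (((ξ j : ℝ) : ℂ) * ((ξ m : ℝ) : ℂ)) * Fi (cc f) ξ := by
    rw [Fi_pd (h.pd _), Fi_pd h]
    linear_combination (4 * π ^ 2 * (((ξ j : ℝ) : ℂ) * ((ξ m : ℝ) : ℂ)) * Fi (cc f) ξ) * Complex.I_sq
  by_cases hj : j = m
  · have e : cc (WW f m j) = fun x => cc (fun x => pd (fun y => pd f m y) j x) x
      - cc (fun x => ∑ i : Fin 3, pd (fun y => pd f i y) i x) x := by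
      ext x; simp [cc, WW, hj]
    rw [e, Fi_sub ((h.pd m).pd j).int (TF.sum3 fun i => (h.pd i).pd i).int, e1, Fi_lap h, if_pos hj]
    ring
  · have e : cc (WW f m j) = cc (fun x => pd (fun y => pd f m y) j x) := by
      ext x; simp [cc, WW, hj]
    rw [e, e1, if_neg hj]; ring

lemma WW_div {f : V → ℝ} (h : TF f) (m : Fin 3) (x : V) : ∑ j, pd (WW f m j) j x = 0 := by
  have ht : TF (fun x => ∑ j, pd (WW f m j) j x) := TF.sum3 fun j => (WW_TF h m j).pd j
  refine ht.eq_zero (fun ξ => ?_) x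
  have e : cc (fun x => ∑ j, pd (WW f m j) j x) = fun x => ∑ j, cc (fun x => pd (WW f m j) j x) x := by
    ext x; simp [cc]
  rw [e, Fi_sum3 (fun i => ((WW_TF h m i).pd i).int)]
  simp only [Fi_pd (WW_TF h m _), Fi_WW h, sq_norm_eq]
  fin_cases m <;> simp [Fin.sum_univ_three] <;> ring

lemma pd_const_mul {f : V → ℝ} (hf : Differentiable ℝ f) (c : ℝ) (i : Fin 3) (x : V) :
    pd (fun y => c * f y) i x = c * pd f i x := by
  unfold pd
  rw [fderiv_const_mul (hf x)]; simp

lemma AC_of {H : ℝ → ℝ} {M c : ℝ} (_hM : 0 ≤ M) (hH : IntervalIntegrable H volume 0 M) :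
    AbsolutelyContinuousOnInterval (fun t => c + ∫ s in (0:ℝ)..t, H s) 0 M ∧
    ∀ᵐ t : ℝ, t ∈ Set.uIcc 0 M → deriv (fun t => c + ∫ s in (0:ℝ)..t, H s) t = H t := by
  have h1 := hH.absolutelyContinuousOnInterval_intervalIntegral (c := 0) (by simp)
  constructor
  · have h2 : AbsolutelyContinuousOnInterval (fun _ : ℝ => c) 0 M :=
      (contDiff_const (n := 1)).contDiffOn.absolutelyContinuousOnInterval
    exact h2.add h1
  · filter_upwards [hH.ae_hasDerivAt_integral] with t ht htt
    exact ((ht htt 0 (by simp)).const_add c).deriv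

lemma oneD {G H : ℝ → ℝ} {G0 : ℝ} (hG : ∀ T, 0 ≤ T → IntervalIntegrable G volume 0 T)
    (hH : ∀ T, 0 ≤ T → IntervalIntegrable H volume 0 T)
    (h : ∀ θ : ℝ → ℝ, ContDiff ℝ (⊤ : ℕ∞) θ → HasCompactSupport θ →
      (∫ t in Set.Ioi (0:ℝ), (deriv θ t * G t + θ t * H t)) + θ 0 * G0 = 0) :
    ∀ᵐ t : ℝ, 0 < t → G t = G0 + ∫ s in (0:ℝ)..t, H s := by
  let J : ℝ → ℝ := fun t => G0 + ∫ s in (0:ℝ)..t, H s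
  let f : ℝ → ℝ := (Set.Ioi 0).indicator (fun t => G t - J t)
  have hGJ : ∀ M, 0 ≤ M → IntervalIntegrable (fun t => G t - J t) volume 0 M := fun M hM =>
    (hG M hM).sub ((AC_of hM (hH M hM)).1.continuousOn.intervalIntegrable)
  have hf : LocallyIntegrable f volume := by
    rw [locallyIntegrable_iff]
    intro K hK
    obtain ⟨M, hM⟩ := hK.isBounded.subset_closedBall 0
    have hM1 := (intervalIntegrable_iff_integrableOn_Ioc_of_le (le_max_right M 0)).1 (hGJ (max M 0) (le_max_right _ _))
    have : IntegrableOn f (Set.Iic (max M 0)) volume := by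
      rw [integrableOn_indicator_iff measurableSet_Ioi]
      rwa [Set.Ioi_inter_Iic]
    refine this.mono_set fun x hx => ?_
    have := hM hx
    simp only [Metric.mem_closedBall, dist_zero_right, Real.norm_eq_abs] at this
    exact ((le_abs_self x).trans this).trans (le_max_left _ _)
  have key : ∀ᵐ t : ℝ, f t = 0 := by
    refine ae_eq_zero_of_integral_contDiff_smul_eq_zero hf (fun η hη hηc => ?_)
    obtain ⟨M0, hM0⟩ := hηc.isCompact.isBounded.subset_closedBall 0
    obtain ⟨M, hMM, hM1⟩ : ∃ M, M0 < M ∧ 0 < M := ⟨max M0 0 + 1, by linarith [le_max_left M0 0], by linarith [le_max_right M0 0]⟩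
    have hη0 : ∀ t, M ≤ t → η t = 0 := by
      intro t ht
      by_contra hne
      have := hM0 (subset_tsupport _ hne)
      simp only [Metric.mem_closedBall, dist_zero_right, Real.norm_eq_abs] at this
      linarith [le_abs_self t]
    let E : ℝ → ℝ := fun t => ∫ s in M..t, η s
    have hE : ∀ t, HasDerivAt E (η t) t := fun t =>
      intervalIntegral.integral_hasDerivAt_right (hη.continuous.intervalIntegrable _ _)
        (hη.continuous.stronglyMeasurableAtFilter _ _) hη.continuous.continuousAt
    have hEs : ContDiff ℝ (⊤ : ℕ∞) E := by
      rw [contDiff_infty_iff_deriv]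
      refine ⟨fun t => (hE t).differentiableAt, ?_⟩
      rwa [show deriv E = η from funext fun t => (hE t).deriv]
    have hE0 : ∀ t, M ≤ t → E t = 0 := by
      intro t ht
      apply intervalIntegral.integral_zero_ae
      refine Eventually.of_forall fun s hs => hη0 s ?_
      rw [Set.uIoc_of_le ht] at hs; exact hs.1.le
    let θ : ℝ → ℝ := fun t => Real.smoothTransition (t + 2) * E t
    have hθ : ContDiff ℝ (⊤ : ℕ∞) θ :=
      (Real.smoothTransition.contDiff.comp (contDiff_id.add contDiff_const)).mul hEs
    have hθc : HasCompactSupport θ := by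
      refine HasCompactSupport.intro (isCompact_Icc (a := -2) (b := M)) fun t ht => ?_
      simp only [Set.mem_Icc, not_and_or, not_le] at ht
      rcases ht with ht | ht
      · simp only [θ]; rw [Real.smoothTransition.zero_of_nonpos (by linarith), zero_mul]
      · simp only [θ]; rw [hE0 t ht.le, mul_zero]
    have hθE : ∀ t, -1 ≤ t → θ t = E t := fun t ht => by
      simp only [θ]; rw [Real.smoothTransition.one_of_one_le (by linarith), one_mul]
    have hθd : ∀ t, 0 ≤ t → deriv θ t = η t := by
      intro t ht
      have : θ =ᶠ[𝓝 t] E := by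
        filter_upwards [eventually_gt_nhds (show (-1:ℝ) < t by linarith)] with s hs using hθE s hs.le
      rw [this.deriv_eq]; exact (hE t).deriv
    have hw := h θ hθ hθc
    have trunc : ∀ g : ℝ → ℝ, (∀ t, M < t → g t = 0) → ∫ t in Set.Ioi (0:ℝ), g t = ∫ t in (0:ℝ)..M, g t := by
      intro g hg
      rw [intervalIntegral.integral_of_le hM1.le]
      refine (setIntegral_eq_of_subset_of_forall_sdiff_eq_zero measurableSet_Ioi (fun x hx => hx.1) ?_)
      rintro x ⟨hx1, hx2⟩
      exact hg x (by by_contra hh; exact hx2 ⟨hx1, not_lt.1 hh⟩)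
    rw [trunc _ (fun t ht => by rw [hθd t (hM1.le.trans ht.le), hη0 t ht.le, hθE t (by linarith), hE0 t ht.le]; simp)] at hw
    have hAC := AC_of (c := G0) hM1.le (hH M hM1.le)
    have hθAC : AbsolutelyContinuousOnInterval θ 0 M :=
      (hθ.of_le (m := 1) (by exact_mod_cast le_top)).contDiffOn.absolutelyContinuousOnInterval
    have hp := hθAC.integral_mul_deriv_eq_deriv_mul hAC.1
    have e1 : ∫ t in (0:ℝ)..M, θ t * deriv (fun t => G0 + ∫ s in (0:ℝ)..t, H s) t = ∫ t in (0:ℝ)..M, θ t * H t := by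
      apply intervalIntegral.integral_congr_ae
      filter_upwards [hAC.2] with t ht htt
      rw [ht (Set.uIoc_subset_uIcc htt)]
    have e2 : ∫ t in (0:ℝ)..M, deriv θ t * (G0 + ∫ s in (0:ℝ)..t, H s) = ∫ t in (0:ℝ)..M, η t * J t := by
      apply intervalIntegral.integral_congr
      intro t ht
      rw [Set.uIcc_of_le hM1.le] at ht
      simp only [hθd t ht.1, J]
    have e3 : ∫ t in (0:ℝ)..M, (deriv θ t * G t + θ t * H t) = (∫ t in (0:ℝ)..M, η t * G t) + ∫ t in (0:ℝ)..M, θ t * H t := by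
      rw [← intervalIntegral.integral_add ((hG M hM1.le).continuousOn_mul hη.continuous.continuousOn)
        ((hH M hM1.le).continuousOn_mul hθ.continuous.continuousOn)]
      apply intervalIntegral.integral_congr
      intro t ht
      rw [Set.uIcc_of_le hM1.le] at ht
      simp only [hθd t ht.1]
    have e4 : ∫ t, η t • f t = ∫ t in (0:ℝ)..M, η t * (G t - J t) := by
      rw [← trunc _ (fun t ht => by rw [hη0 t ht.le, zero_mul]), ← integral_indicator measurableSet_Ioi]
      congr 1; ext t
      by_cases ht : t ∈ Set.Ioi (0:ℝ) <;> simp [f, ht, -Set.mem_Ioi]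
    have e5 : ∫ t in (0:ℝ)..M, η t * (G t - J t) = (∫ t in (0:ℝ)..M, η t * G t) - ∫ t in (0:ℝ)..M, η t * J t := by
      simp only [mul_sub]
      exact intervalIntegral.integral_sub ((hG M hM1.le).continuousOn_mul hη.continuous.continuousOn)
        ((hη.continuous.continuousOn.mul hAC.1.continuousOn).intervalIntegrable)
    rw [e1, e2, hθE M (by linarith), hE0 M le_rfl] at hp
    rw [e3] at hw
    rw [e4, e5]
    simp only [intervalIntegral.integral_same, add_zero] at hp
    linarith
  filter_upwards [key] with t ht ht0
  simp only [f, Set.indicator_of_mem (show t ∈ Set.Ioi (0:ℝ) from ht0), J] at ht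
  linarith

/-- real product rule -/
lemma prod_rule {z H : ℝ → ℝ} {z0 M : ℝ} (hM : 0 ≤ M) (hH : IntervalIntegrable H volume 0 M)
    (hz : ∀ᵐ t : ℝ, 0 < t → t ≤ M → z t = z0 + ∫ s in (0:ℝ)..t, H s) {t : ℝ} (ht0 : 0 < t) (htM : t ≤ M)
    (hzt : z t = z0 + ∫ s in (0:ℝ)..t, H s) :
    z t ^ 2 = z0 ^ 2 + 2 * ∫ s in (0:ℝ)..t, z s * H s := by
  have hH' : IntervalIntegrable H volume 0 t := hH.mono_set (by
    rw [Set.uIcc_of_le hM, Set.uIcc_of_le ht0.le]; exact Set.Icc_subset_Icc le_rfl htM)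
  have hAC := AC_of (c := z0) ht0.le hH'
  have hp := hAC.1.integral_mul_deriv_eq_deriv_mul hAC.1
  have e1 : ∫ x in (0:ℝ)..t, (z0 + ∫ s in (0:ℝ)..x, H s) * deriv (fun t => z0 + ∫ s in (0:ℝ)..t, H s) x
      = ∫ s in (0:ℝ)..t, z s * H s := by
    apply intervalIntegral.integral_congr_ae
    filter_upwards [hAC.2, hz] with x hx hzx hxx
    rw [hx (Set.uIoc_subset_uIcc hxx)]
    rw [Set.uIoc_of_le ht0.le] at hxx
    rw [hzx hxx.1 (hxx.2.trans htM)]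
  have e2 : ∫ x in (0:ℝ)..t, deriv (fun t => z0 + ∫ s in (0:ℝ)..t, H s) x * (z0 + ∫ s in (0:ℝ)..x, H s)
      = ∫ s in (0:ℝ)..t, z s * H s := by
    rw [← e1]; congr 1; ext x; ring
  rw [e1, e2, ← hzt] at hp
  simp only [intervalIntegral.integral_same, add_zero] at hp
  nlinarith

/-- the solution modified on a null set of times -/
structure Sol (ν : ℝ) (u₀ : V → V) (u : ℝ → V → V) (K : ℝ) : Prop where
  meas : Measurable (Function.uncurry u)
  mem : ∀ t, MemLp (u t) 2 volume
  bdd : ∀ t, eLpNorm (u t) 2 volume ^ 2 ≤ ENNReal.ofReal K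
  div : ∀ t, DivFreeF (u t)
  u0mem : MemLp u₀ 2 volume
  u0div : DivFreeF u₀
  weak : ∀ φ : ℝ → V → V, ContDiff ℝ (⊤ : ℕ∞) (Function.uncurry φ) →
      HasCompactSupport (Function.uncurry φ) →
      (∀ t x, (∑ i : Fin 3, pd (fun y => φ t y i) i x) = 0) →
      (∫ t in Set.Ioi (0:ℝ), ∫ x,
          ((∑ j : Fin 3, u t x j * deriv (fun s => φ s x j) t)
            + ν * (∑ j : Fin 3, u t x j *
                ∑ i : Fin 3, pd (fun y => pd (fun z => φ t z j) i y) i x)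
            + ∑ i : Fin 3, ∑ j : Fin 3, u t x i * u t x j * pd (fun y => φ t y j) i x))
        + (∫ x, ∑ j : Fin 3, u₀ x j * φ 0 x j) = 0

lemma divFree_zero : DivFreeF 0 := by
  unfold DivFreeF
  have h : ∀ i, FT (comp 0 i) =ᵐ[volume] 0 := by
    intro i
    have e : comp 0 i = (0 : V → ℂ) := by ext x; simp [comp]
    rw [e]
    have h1 : IsFourierPair (0 : V → ℂ) (0 : V → ℂ) := ⟨MemLp.zero, MemLp.zero, fun g => by simp⟩
    exact pair_unique_right (FT_spec MemLp.zero) h1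
  have h' := ae_all_iff.2 h
  filter_upwards [h'] with ξ hξ
  simp [hξ]

lemma exists_sol {ν : ℝ} {u₀ : V → V} {u : ℝ → V → V} (hu : IsLerayHopf ν u₀ u)
    (h0 : MemLp u₀ 2 volume) (h0d : DivFreeF u₀) :
    ∃ u' K, Sol ν u₀ u' K ∧ ∀ᵐ t ∂(volume.restrict (Set.Ioi (0:ℝ))), u' t = u t := by
  have hae : ∀ᵐ t ∂(volume.restrict (Set.Ioi (0:ℝ))), 0 < t ∧ DivFreeF (u t) ∧
      eLpNorm (u t) 2 volume ^ 2 ≤ eLpNorm u₀ 2 volume ^ 2 := by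
    filter_upwards [hu.divFree, hu.energy, ae_restrict_mem measurableSet_Ioi] with t h1 h2 h3
    refine ⟨h3, h1, ?_⟩
    have h4 := (le_self_add).trans h2
    rw [ENNReal.mul_le_mul_iff_right (by norm_num) (by norm_num)] at h4
    exact h4
  obtain ⟨S, hS, hSm, hSp⟩ := hae.exists_measurable_mem
  have hK : ENNReal.ofReal (eLpNorm u₀ 2 volume ^ 2).toReal = eLpNorm u₀ 2 volume ^ 2 :=
    ENNReal.ofReal_toReal (ENNReal.pow_ne_top h0.2.ne)
  let u' : ℝ → V → V := fun t => if t ∈ S then u t else 0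
  have heq : ∀ᵐ t ∂(volume.restrict (Set.Ioi (0:ℝ))), u' t = u t := by
    filter_upwards [hS] with t ht
    simp only [u', if_pos ht]
  refine ⟨u', (eLpNorm u₀ 2 volume ^ 2).toReal, ⟨?_, ?_, ?_, ?_, h0, h0d, ?_⟩, heq⟩
  · have : Function.uncurry u' = (S ×ˢ Set.univ).indicator (Function.uncurry u) := by
      ext1 ⟨t, x⟩
      by_cases ht : t ∈ S <;> simp [u', ht, Function.uncurry]
    rw [this]
    exact hu.meas.indicator (hSm.prod MeasurableSet.univ)
  · intro t
    by_cases ht : t ∈ S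
    · simp only [u', if_pos ht]; exact hu.memL2 t (hSp t ht).1
    · simp only [u', if_neg ht]; exact MemLp.zero
  · intro t
    rw [hK]
    by_cases ht : t ∈ S
    · simp only [u', if_pos ht]; exact (hSp t ht).2.2
    · simp only [u', if_neg ht]; simp
  · intro t
    by_cases ht : t ∈ S
    · simp only [u', if_pos ht]; exact (hSp t ht).2.1
    · simp only [u', if_neg ht]; exact divFree_zero
  · intro φ h1 h2 h3
    refine Eq.trans ?_ (hu.weak φ h1 h2 h3)
    congr 1
    apply integral_congr_ae
    filter_upwards [heq] with t ht
    rw [ht]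

/-- the linear functional -/
def GG (u : V → V) (W : Fin 3 → V → ℝ) : ℝ := ∫ x, ∑ j, u x j * W j x
def HH (ν : ℝ) (u : V → V) (W : Fin 3 → V → ℝ) : ℝ :=
  ∫ x, (ν * ∑ j, u x j * (∑ i : Fin 3, pd (fun y => pd (W j) i y) i x)
     + ∑ i, ∑ j, u x i * u x j * pd (W j) i x)

lemma comp_mem {u : V → V} (h : MemLp u 2 volume) (i : Fin 3) : MemLp (comp u i) 2 volume := by
  have h1 : MemLp (fun x => u x i) 2 volume := by
    have := (EuclideanSpace.proj (𝕜 := ℝ) (ι := Fin 3) i : V →L[ℝ] ℝ).comp_memLp' h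
    exact this
  exact Complex.ofRealCLM.comp_memLp' h1

lemma int_uW {u : V → V} (h : MemLp u 2 volume) {g : V → ℝ} (hg : TF g) (j : Fin 3) :
    Integrable (fun x => u x j * g x) := by
  have := (memLp_mul_int (comp_mem h j) hg.mem).re
  refine this.congr (Eventually.of_forall fun x => ?_)
  simp [comp, cc]

lemma int_uu {u : V → V} (h : MemLp u 2 volume) (i j : Fin 3) :
    Integrable (fun x => comp u i x * comp u j x) := memLp_mul_int (comp_mem h i) (comp_mem h j)

lemma int_uuW {u : V → V} (h : MemLp u 2 volume) {g : V → ℝ} (hg : TF g) (i j : Fin 3) :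
    Integrable (fun x => u x i * u x j * g x) := by
  obtain ⟨C, hC⟩ := hg.bdd
  have := (int_bdd_mul hg.cc_smooth.continuous hC (int_uu h i j)).re
  refine this.congr (Eventually.of_forall fun x => ?_)
  simp [comp, cc]; ring

lemma TF.lap {g : V → ℝ} (hg : TF g) :
    TF (fun x => ∑ i : Fin 3, NSE.pd (fun y => NSE.pd g i y) i x) :=
  TF.sum3 fun i => (hg.pd i).pd i

lemma int_GG {u : V → V} (h : MemLp u 2 volume) {W : Fin 3 → V → ℝ} (hW : ∀ j, TF (W j)) :
    Integrable (fun x => ∑ j, u x j * W j x) :=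
  integrable_finsetSum _ fun j _ => int_uW h (hW j) j

lemma int_HH1 {u : V → V} (h : MemLp u 2 volume) {W : Fin 3 → V → ℝ} (hW : ∀ j, TF (W j)) (ν : ℝ) :
    Integrable (fun x => ν * ∑ j, u x j * (∑ i : Fin 3, pd (fun y => pd (W j) i y) i x)) :=
  (integrable_finsetSum _ fun j _ => int_uW h (hW j).lap j).const_mul ν

lemma int_HH2 {u : V → V} (h : MemLp u 2 volume) {W : Fin 3 → V → ℝ} (hW : ∀ j, TF (W j)) :
    Integrable (fun x => ∑ i, ∑ j, u x i * u x j * pd (W j) i x) :=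
  integrable_finsetSum _ fun i _ => integrable_finsetSum _ fun j _ => int_uuW h ((hW j).pd i) i j

lemma int_HH {u : V → V} (h : MemLp u 2 volume) {W : Fin 3 → V → ℝ} (hW : ∀ j, TF (W j)) (ν : ℝ) :
    Integrable (fun x => ν * ∑ j, u x j * (∑ i : Fin 3, pd (fun y => pd (W j) i y) i x)
     + ∑ i, ∑ j, u x i * u x j * pd (W j) i x) := (int_HH1 h hW ν).add (int_HH2 h hW)

lemma weak_sep {ν K : ℝ} {u₀ : V → V} {u : ℝ → V → V} (hs : Sol ν u₀ u K)
    {W : Fin 3 → V → ℝ} (hW : ∀ j, TF (W j)) (hdiv : ∀ x, ∑ j, pd (W j) j x = 0)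
    {θ : ℝ → ℝ} (hθ : ContDiff ℝ (⊤ : ℕ∞) θ) (hθc : HasCompactSupport θ) :
    (∫ t in Set.Ioi (0:ℝ), (deriv θ t * GG (u t) W + θ t * HH ν (u t) W)) + θ 0 * GG u₀ W = 0 := by
  have hWd : ∀ j, Differentiable ℝ (W j) := fun j => (hW j).smooth.differentiable (by simp)
  have hWd2 : ∀ j i, Differentiable ℝ (fun y => pd (W j) i y) := fun j i => ((hW j).pd i).smooth.differentiable (by simp)
  let φ : ℝ → V → V := fun t y => WithLp.toLp 2 (fun j => θ t * W j y)
  have hφ : ∀ t y j, φ t y j = θ t * W j y := fun t y j => rfl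
  have h1 : ContDiff ℝ (⊤ : ℕ∞) (Function.uncurry φ) := by
    rw [contDiff_euclidean]
    intro j
    exact (hθ.comp contDiff_fst).mul ((hW j).smooth.comp contDiff_snd)
  have h2 : HasCompactSupport (Function.uncurry φ) := by
    refine HasCompactSupport.intro (K := tsupport θ ×ˢ (⋃ j, tsupport (W j)))
      (hθc.isCompact.prod (isCompact_iUnion fun j => (hW j).cpt.isCompact)) ?_
    rintro ⟨t, x⟩ hx
    ext j
    change θ t * W j x = 0
    simp only [Set.mem_prod, not_and_or, Set.mem_iUnion, not_exists] at hx
    rcases hx with hx | hx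
    · rw [image_eq_zero_of_notMem_tsupport hx, zero_mul]
    · rw [image_eq_zero_of_notMem_tsupport (hx j), mul_zero]
  have h3 := hs.weak φ h1 h2 (fun t x => by
    simp only [hφ, pd_const_mul (hWd _), ← Finset.mul_sum, hdiv, mul_zero])
  refine Eq.trans ?_ h3
  simp only [hφ, pd_const_mul (hWd _), pd_const_mul (hWd2 _ _)]
  congr 1
  · congr 1; ext t
    have hd : ∀ x j, deriv (fun s => θ s * W j x) t = deriv θ t * W j x := fun x j =>
      deriv_mul_const (hθ.differentiable (by simp) t) _
    simp only [hd]
    rw [GG, HH, ← integral_const_mul, ← integral_const_mul, ← integral_add ((int_GG (hs.mem t) hW).const_mul _)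
      ((int_HH (hs.mem t) hW ν).const_mul _)]
    congr 1; ext x
    simp only [Fin.sum_univ_three]; ring
  · rw [GG, ← integral_const_mul]
    congr 1; ext x
    simp only [Fin.sum_univ_three]; ring

/-- Fourier transform of `u_i u_j` -/
def qq (u : V → V) (i j : Fin 3) (ξ : V) : ℂ := Fi (fun x => comp u i x * comp u j x) (-ξ)

/-- `|ξ|²` times the right-hand side of the equation on the Fourier side -/
def PP (ν : ℝ) (u : V → V) (w : Fin 3 → V → ℂ) (m : Fin 3) (ξ : V) : ℂ :=
  -(4 * π ^ 2 * ν * ((‖ξ‖ ^ 2 : ℝ) : ℂ) ^ 2) * w m ξ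
    + ∑ i : Fin 3, ∑ j : Fin 3, (2 * π * Complex.I * ((ξ i : ℝ) : ℂ)) * (((ξ j : ℝ) : ℂ) * ((ξ m : ℝ) : ℂ)
      - (if j = m then ((‖ξ‖ ^ 2 : ℝ) : ℂ) else 0)) * qq u i j ξ

lemma qq_cont {u : V → V} (h : MemLp u 2 volume) (i j : Fin 3) : Continuous (qq u i j) :=
  (continuous_Fi (int_uu h i j)).comp continuous_neg

lemma qq_le (u : V → V) (i j : Fin 3) (ξ : V) :
    ‖qq u i j ξ‖ ≤ ∫ x, ‖comp u i x * comp u j x‖ := norm_Fi_le _ _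

lemma int_wF {v : V → ℂ} (hv : MemLp v 2 volume) {f : V → ℝ} (hf : TF f) :
    Integrable (fun ξ => v ξ * Fi (cc f) ξ) := by
  have := memLp_mul_int hv (schwartz_memLp2 hf.K)
  rwa [hf.K_coe] at this

lemma int_qF {u : V → V} (h : MemLp u 2 volume) {f : V → ℝ} (hf : TF f) (i j : Fin 3) :
    Integrable (fun ξ => Fi (cc f) ξ * qq u i j ξ) := by
  have := int_bdd_mul (qq_cont h i j) (qq_le u i j) hf.K.integrable
  rw [hf.K_coe] at this
  exact this.congr (Eventually.of_forall fun ξ => mul_comm _ _)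

lemma lin_fourier {u : V → V} {w : Fin 3 → V → ℂ} (hw : ∀ m, IsFourierPair (comp u m) (w m))
    {W : Fin 3 → V → ℝ} (hW : ∀ j, TF (W j)) :
    ((∫ x, ∑ j, u x j * W j x : ℝ) : ℂ) = ∫ ξ, ∑ j, w j ξ * Fi (cc (W j)) ξ := by
  rw [← integral_complex_ofReal, integral_finsetSum _ (fun j _ => int_wF (hw j).2.1 (hW j))]
  simp only [← pair_mult (hw _) (hW _).int (hW _).mem]
  rw [← integral_finsetSum _ (fun j _ => memLp_mul_int (hw j).1 (hW j).mem)]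
  congr 1; ext x; simp [comp, cc]

lemma quad_fourier {u : V → V} (h : MemLp u 2 volume) {W : Fin 3 → Fin 3 → V → ℝ} (hW : ∀ i j, TF (W i j)) :
    ((∫ x, ∑ i, ∑ j, u x i * u x j * W i j x : ℝ) : ℂ) = ∫ ξ, ∑ i, ∑ j, Fi (cc (W i j)) ξ * qq u i j ξ := by
  have e : ∀ i j, ∫ ξ, Fi (cc (W i j)) ξ * qq u i j ξ = ∫ x, ((u x i * u x j * W i j x : ℝ) : ℂ) := by
    intro i j
    have := L1_mult (hW i j) (int_uu h i j)
    simp only [qq]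
    rw [← this]
    congr 1; ext x; simp [comp, cc]
  rw [← integral_complex_ofReal, integral_finsetSum _ (fun i _ => integrable_finsetSum _ fun j _ => int_qF h (hW i j) i j)]
  have e2 : ∀ i, ∫ ξ, ∑ j, Fi (cc (W i j)) ξ * qq u i j ξ = ∫ x, ∑ j, ((u x i * u x j * W i j x : ℝ) : ℂ) := fun i => by
    rw [integral_finsetSum _ (fun j _ => int_qF h (hW i j) i j),
      integral_finsetSum _ (fun j _ => (int_uuW h (hW i j) i j).ofReal)]; simp only [e]
  simp only [e2]
  rw [← integral_finsetSum _ (fun i _ => integrable_finsetSum _ fun j _ => (int_uuW h (hW i j) i j).ofReal)]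
  congr 1; ext x; push_cast; rfl

lemma GG_fourier {u : V → V} {w : Fin 3 → V → ℂ} (hw : ∀ m, IsFourierPair (comp u m) (w m))
    (hd : ∀ᵐ ξ : V, ∑ i, w i ξ * ((ξ i : ℝ) : ℂ) = 0) {f : V → ℝ} (hf : TF f) (m : Fin 3) :
    ((GG u (WW f m) : ℝ) : ℂ) = ∫ ξ, Fi (cc f) ξ * (4 * π ^ 2 * (((‖ξ‖ ^ 2 : ℝ) : ℂ) * w m ξ)) := by
  rw [GG, lin_fourier hw (WW_TF hf m)]
  apply integral_congr_ae
  filter_upwards [hd] with ξ h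
  simp only [Fi_WW hf]
  rw [Fin.sum_univ_three] at h ⊢
  generalize ((‖ξ‖ ^ 2 : ℝ) : ℂ) = N
  fin_cases m <;> simp
  · linear_combination (-(4 * π ^ 2) * Fi (cc f) ξ * (((ξ 0 : ℝ) : ℂ))) * h
  · linear_combination (-(4 * π ^ 2) * Fi (cc f) ξ * (((ξ 1 : ℝ) : ℂ))) * h
  · linear_combination (-(4 * π ^ 2) * Fi (cc f) ξ * (((ξ 2 : ℝ) : ℂ))) * h

lemma HH_fourier {u : V → V} (h : MemLp u 2 volume) {w : Fin 3 → V → ℂ} (hw : ∀ m, IsFourierPair (comp u m) (w m))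
    (hd : ∀ᵐ ξ : V, ∑ i, w i ξ * ((ξ i : ℝ) : ℂ) = 0) {f : V → ℝ} (hf : TF f) (m : Fin 3) (ν : ℝ) :
    ((HH ν u (WW f m) : ℝ) : ℂ) = ∫ ξ, Fi (cc f) ξ * (4 * π ^ 2 * PP ν u w m ξ) := by
  have hW := WW_TF hf m
  rw [HH, integral_add (int_HH1 h hW ν) (int_HH2 h hW), integral_const_mul, Complex.ofReal_add,
    Complex.ofReal_mul, lin_fourier hw (fun j => (hW j).lap), quad_fourier h (fun i j => (hW j).pd i),
    ← integral_const_mul, ← integral_add]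
  · apply integral_congr_ae
    filter_upwards [hd] with ξ hξ
    simp only [Fi_lap (hW _), Fi_pd (hW _), Fi_WW hf, PP]
    generalize ((‖ξ‖ ^ 2 : ℝ) : ℂ) = N
    rw [Fin.sum_univ_three] at hξ
    simp only [Fin.sum_univ_three]
    fin_cases m
    · simp
      linear_combination (ν * (4 * π ^ 2) ^ 2 * N * Fi (cc f) ξ * (((ξ 0 : ℝ) : ℂ))) * hξ
    · simp
      linear_combination (ν * (4 * π ^ 2) ^ 2 * N * Fi (cc f) ξ * (((ξ 1 : ℝ) : ℂ))) * hξ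
    · simp
      linear_combination (ν * (4 * π ^ 2) ^ 2 * N * Fi (cc f) ξ * (((ξ 2 : ℝ) : ℂ))) * hξ
  · exact (integrable_finsetSum _ fun j _ => int_wF (hw j).2.1 (hW j).lap).const_mul _
  · exact integrable_finsetSum _ fun i _ => integrable_finsetSum _ fun j _ => int_qF h ((hW j).pd i) i j

def wv (u : ℝ → V → V) (t : ℝ) (m : Fin 3) (ξ : V) : ℂ := Uh (fun t => comp (u t) m) (t, ξ)

lemma comp_meas {u : ℝ → V → V} (hu : Measurable (uncurry u)) (m : Fin 3) :
    Measurable (uncurry (fun t => comp (u t) m)) := by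
  have h1 : Measurable (fun q : ℝ × V => (uncurry u q) m) :=
    (EuclideanSpace.proj (𝕜 := ℝ) (ι := Fin 3) m : V →L[ℝ] ℝ).continuous.measurable.comp hu
  exact Complex.measurable_ofReal.comp h1

lemma wv_meas {u : ℝ → V → V} (hu : Measurable (uncurry u)) (m : Fin 3) :
    StronglyMeasurable (fun q : ℝ × V => wv u q.1 m q.2) := Uh_meas (comp_meas hu m)

lemma qq_meas {u : ℝ → V → V} (hu : Measurable (uncurry u)) (i j : Fin 3) :
    StronglyMeasurable (fun q : ℝ × V => qq (u q.1) i j q.2) := by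
  unfold qq Fi
  have h : StronglyMeasurable (fun q : (ℝ × V) × V =>
      (comp (u q.1.1) i q.2 * comp (u q.1.1) j q.2) * ex (-q.1.2) q.2) := by
    have hm : Measurable (fun q : (ℝ × V) × V => (q.1.1, q.2)) := by fun_prop
    have h1 : ∀ i, Measurable (fun q : (ℝ × V) × V => comp (u q.1.1) i q.2) := fun i =>
      (comp_meas hu i).comp hm
    have h2 : Continuous (fun q : (ℝ × V) × V => ex (-q.1.2) q.2) := by unfold ex; fun_prop
    exact (((h1 i).mul (h1 j)).mul h2.measurable).stronglyMeasurable
  exact h.integral_prod_right'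

section sol
variable {ν K : ℝ} {u₀ : V → V} {u : ℝ → V → V}

lemma Sol.pair (hs : Sol ν u₀ u K) (t : ℝ) (m : Fin 3) : IsFourierPair (comp (u t) m) (wv u t m) :=
  Uh_spec (v := fun t => comp (u t) m) (comp_mem (hs.mem t) m)

lemma divF_pair {u : V → V} {w : Fin 3 → V → ℂ} (hw : ∀ m, IsFourierPair (comp u m) (w m)) (hd : DivFreeF u) :
    ∀ᵐ ξ : V, ∑ i, w i ξ * ((ξ i : ℝ) : ℂ) = 0 := by
  have h : ∀ᵐ ξ : V, ∀ m, w m ξ = FT (comp u m) ξ :=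
    ae_all_iff.2 fun m => pair_unique_right (hw m) (FT_spec (hw m).1)
  filter_upwards [h, hd] with ξ h1 h2
  simp only [h1]; exact h2

lemma Sol.divw (hs : Sol ν u₀ u K) (t : ℝ) : ∀ᵐ ξ : V, ∑ i, wv u t i ξ * ((ξ i : ℝ) : ℂ) = 0 :=
  divF_pair (hs.pair t) (hs.div t)

lemma Sol.bound (hs : Sol ν u₀ u K) (t : ℝ) : ∫ x, ‖u t x‖ ^ 2 ≤ max K 0 := by
  have h := hs.bdd t
  rw [eLpNorm_two_sq] at h
  have h1 : Integrable (fun x => ‖u t x‖ ^ 2) := (hs.mem t).integrable_norm_pow (by norm_num)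
  have h2 : ∫⁻ x, ‖u t x‖ₑ ^ 2 = ENNReal.ofReal (∫ x, ‖u t x‖ ^ 2) := by
    rw [ofReal_integral_eq_lintegral_ofReal h1 (Eventually.of_forall fun x => by positivity)]
    congr 1; ext x
    rw [← ofReal_norm, ENNReal.ofReal_pow (norm_nonneg _)]
  rw [h2] at h
  have h3 := (ENNReal.ofReal_le_ofReal_iff' ).1 h
  rcases h3 with h3 | h3
  · exact h3.trans (le_max_left _ _)
  · exact h3.trans (le_max_right _ _)

lemma comp_le (v : V → V) (i : Fin 3) (x : V) : ‖comp v i x‖ ≤ ‖v x‖ := by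
  simp only [comp, Complex.norm_real]; exact coord_le _ _

lemma Sol.q_bound (hs : Sol ν u₀ u K) (t : ℝ) (i j : Fin 3) (ξ : V) : ‖qq (u t) i j ξ‖ ≤ max K 0 := by
  refine (qq_le _ _ _ _).trans (le_trans (integral_mono (int_uu (hs.mem t) i j).norm
    ((hs.mem t).integrable_norm_pow (by norm_num)) fun x => ?_) (hs.bound t))
  simp only [norm_mul]
  nlinarith [comp_le (u t) i x, comp_le (u t) j x, norm_nonneg (comp (u t) i x), norm_nonneg (comp (u t) j x)]

lemma Sol.w_bound (hs : Sol ν u₀ u K) (t : ℝ) (m : Fin 3) : ∫ ξ, ‖wv u t m ξ‖ ^ 2 ≤ max K 0 := by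
  rw [← plancherel_int (hs.pair t m)]
  refine le_trans (integral_mono (sq_int (hs.pair t m).1)
    ((hs.mem t).integrable_norm_pow (by norm_num)) fun x => ?_) (hs.bound t)
  exact pow_le_pow_left₀ (norm_nonneg _) (comp_le _ _ _) 2

/-- joint integrability -/
lemma joint_int {F : ℝ × V → ℂ} (hF : StronglyMeasurable F) {C : ℝ} (hi : ∀ t, Integrable (fun ξ => F (t, ξ)))
    (hC : ∀ t, ∫ ξ, ‖F (t, ξ)‖ ≤ C) (T : ℝ) (μ : Measure V) [SFinite μ] (hμ : μ ≤ volume) :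
    Integrable F ((volume.restrict (Set.Ioc 0 T)).prod μ) := by
  rw [integrable_prod_iff hF.aestronglyMeasurable]
  refine ⟨Eventually.of_forall fun t => (hi t).mono_measure hμ, ?_⟩
  refine Integrable.of_bound (C := C) (hF.norm.integral_prod_right').aestronglyMeasurable
    (Eventually.of_forall fun t => ?_)
  rw [Real.norm_of_nonneg (integral_nonneg fun _ => norm_nonneg _)]
  exact (integral_mono_measure hμ (Eventually.of_forall fun _ => norm_nonneg _) (hi t).norm).trans (hC t)

lemma Sol.int_w (hs : Sol ν u₀ u K) {f : V → ℝ} (hf : TF f) (m : Fin 3) (T : ℝ) :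
    Integrable (fun q : ℝ × V => Fi (cc f) q.2 * wv u q.1 m q.2) ((volume.restrict (Set.Ioc 0 T)).prod volume) := by
  have hc : Continuous (Fi (cc f)) := by rw [← hf.K_coe]; exact hf.K.continuous
  have hm : MemLp (Fi (cc f)) 2 volume := by rw [← hf.K_coe]; exact schwartz_memLp2 hf.K
  refine joint_int (F := fun q : ℝ × V => Fi (cc f) q.2 * wv u q.1 m q.2) ((hc.comp continuous_snd).stronglyMeasurable.mul (wv_meas hs.meas m))
    (C := (∫ ξ, ‖Fi (cc f) ξ‖ ^ 2) + max K 0) (fun t => memLp_mul_int hm (hs.pair t m).2.1) (fun t => ?_) T _ le_rfl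
  refine le_trans (integral_mono (memLp_mul_int hm (hs.pair t m).2.1).norm
    ((sq_int hm).add (sq_int (hs.pair t m).2.1)) fun ξ => ?_) ?_
  · simp only [norm_mul, Pi.add_apply]; nlinarith [sq_nonneg (‖Fi (cc f) ξ‖ - ‖wv u t m ξ‖), sq_nonneg ‖Fi (cc f) ξ‖, sq_nonneg ‖wv u t m ξ‖]
  · simp only [Pi.add_apply]
    rw [integral_add (sq_int hm) (sq_int (hs.pair t m).2.1)]
    linarith [hs.w_bound t m]

lemma Sol.int_q (hs : Sol ν u₀ u K) {f : V → ℝ} (hf : TF f) (i j : Fin 3) (T : ℝ) :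
    Integrable (fun q : ℝ × V => Fi (cc f) q.2 * qq (u q.1) i j q.2) ((volume.restrict (Set.Ioc 0 T)).prod volume) := by
  have hc : Continuous (Fi (cc f)) := by rw [← hf.K_coe]; exact hf.K.continuous
  have hm : Integrable (Fi (cc f)) := by rw [← hf.K_coe]; exact hf.K.integrable
  refine joint_int (F := fun q : ℝ × V => Fi (cc f) q.2 * qq (u q.1) i j q.2) ((hc.comp continuous_snd).stronglyMeasurable.mul (qq_meas hs.meas i j))
    (C := (∫ ξ, ‖Fi (cc f) ξ‖) * max K 0) (fun t => int_qF (hs.mem t) hf i j) (fun t => ?_) T _ le_rfl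
  rw [← integral_mul_const]
  refine integral_mono (int_qF (hs.mem t) hf i j).norm (hm.norm.mul_const _) fun ξ => ?_
  simp only [norm_mul]
  exact mul_le_mul_of_nonneg_left (hs.q_bound t i j ξ) (norm_nonneg _)

lemma PP_eq {f : V → ℝ} (hf : TF f) (ν : ℝ) (u : V → V) (w : Fin 3 → V → ℂ) (m : Fin 3) (ξ : V) :
    Fi (cc f) ξ * (4 * π ^ 2 * PP ν u w m ξ) =
      (-ν : ℂ) * (Fi (cc (fun x => ∑ i : Fin 3, pd (fun y => pd (fun x => ∑ i : Fin 3, pd (fun y => pd f i y) i x) i y) i x)) ξ * w m ξ)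
       + ∑ i, ∑ j, Fi (cc (fun x => pd (WW f m j) i x)) ξ * qq u i j ξ := by
  rw [Fi_lap hf.lap, Fi_lap hf]
  simp only [Fi_pd (WW_TF hf m _), Fi_WW hf, PP]
  generalize ((‖ξ‖ ^ 2 : ℝ) : ℂ) = N
  rw [mul_add, mul_add]
  congr 1
  · ring
  · simp only [Finset.mul_sum]
    refine Finset.sum_congr rfl fun i _ => Finset.sum_congr rfl fun j _ => ?_
    ring

lemma Sol.int_PP (hs : Sol ν u₀ u K) {f : V → ℝ} (hf : TF f) (m : Fin 3) (T : ℝ) :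
    Integrable (fun q : ℝ × V => Fi (cc f) q.2 * (4 * π ^ 2 * PP ν (u q.1) (wv u q.1) m q.2))
      ((volume.restrict (Set.Ioc 0 T)).prod volume) := by
  simp only [PP_eq hf]
  exact ((hs.int_w hf.lap.lap m T).const_mul _).add (integrable_finsetSum _ fun i _ =>
    integrable_finsetSum _ fun j _ => hs.int_q ((WW_TF hf m j).pd i) i j T)

lemma lap_eq {f : V → ℝ} (hf : TF f) (ξ : V) (z : ℂ) : Fi (cc f) ξ * (4 * π ^ 2 * (((‖ξ‖ ^ 2 : ℝ) : ℂ) * z))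
    = - (Fi (cc (fun x => ∑ i : Fin 3, pd (fun y => pd f i y) i x)) ξ * z) := by
  rw [Fi_lap hf]; ring

lemma Sol.int_NN (hs : Sol ν u₀ u K) {f : V → ℝ} (hf : TF f) (m : Fin 3) (T : ℝ) :
    Integrable (fun q : ℝ × V => Fi (cc f) q.2 * (4 * π ^ 2 * (((‖q.2‖ ^ 2 : ℝ) : ℂ) * wv u q.1 m q.2)))
      ((volume.restrict (Set.Ioc 0 T)).prod volume) := by
  simp only [lap_eq hf]
  exact (hs.int_w hf.lap m T).neg

/-- the defect -/
def DD (ν : ℝ) (u₀ : V → V) (u : ℝ → V → V) (m : Fin 3) (t : ℝ) (ξ : V) : ℂ :=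
  ((‖ξ‖ ^ 2 : ℝ) : ℂ) * wv u t m ξ - ((‖ξ‖ ^ 2 : ℝ) : ℂ) * FT (comp u₀ m) ξ
    - ∫ s in Set.Ioc 0 t, PP ν (u s) (wv u s) m ξ

lemma DD_eq {f : V → ℝ} (m : Fin 3) (t : ℝ) (ξ : V) :
    4 * π ^ 2 * (Fi (cc f) ξ * DD ν u₀ u m t ξ) = Fi (cc f) ξ * (4 * π ^ 2 * (((‖ξ‖ ^ 2 : ℝ) : ℂ) * wv u t m ξ))
      - Fi (cc f) ξ * (4 * π ^ 2 * (((‖ξ‖ ^ 2 : ℝ) : ℂ) * FT (comp u₀ m) ξ))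
      - ∫ s in Set.Ioc 0 t, Fi (cc f) ξ * (4 * π ^ 2 * PP ν (u s) (wv u s) m ξ) := by
  rw [integral_const_mul, integral_const_mul, DD]; ring

lemma Sol.DD_int3 (hs : Sol ν u₀ u K) {f : V → ℝ} (hf : TF f) (m : Fin 3) (t : ℝ) :
    Integrable (fun ξ => Fi (cc f) ξ * (4 * π ^ 2 * (((‖ξ‖ ^ 2 : ℝ) : ℂ) * wv u t m ξ))) ∧
    Integrable (fun ξ => Fi (cc f) ξ * (4 * π ^ 2 * (((‖ξ‖ ^ 2 : ℝ) : ℂ) * FT (comp u₀ m) ξ))) ∧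
    Integrable (fun ξ => ∫ s in Set.Ioc 0 t, Fi (cc f) ξ * (4 * π ^ 2 * PP ν (u s) (wv u s) m ξ)) := by
  refine ⟨?_, ?_, (hs.int_PP hf m t).integral_prod_right⟩
  · simp only [lap_eq hf]
    exact ((int_wF (hs.pair t m).2.1 hf.lap).congr (Eventually.of_forall fun ξ => mul_comm _ _)).neg
  · simp only [lap_eq hf]
    exact ((int_wF (FT_spec (comp_mem hs.u0mem m)).2.1 hf.lap).congr (Eventually.of_forall fun ξ => mul_comm _ _)).neg

lemma Sol.DD_int (hs : Sol ν u₀ u K) {f : V → ℝ} (hf : TF f) (m : Fin 3) (t : ℝ) :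
    Integrable (fun ξ => Fi (cc f) ξ * DD ν u₀ u m t ξ) := by
  have h := hs.DD_int3 hf m t
  have h2 : Integrable (fun ξ => (4 * π ^ 2 : ℂ) * (Fi (cc f) ξ * DD ν u₀ u m t ξ)) := by
    simp only [DD_eq]; exact (h.1.sub h.2.1).sub h.2.2
  have hne : (4 * π ^ 2 : ℂ) ≠ 0 := by
    have : (π : ℂ) ≠ 0 := by exact_mod_cast Real.pi_ne_zero
    exact mul_ne_zero (by norm_num) (pow_ne_zero 2 this)
  exact (integrable_const_mul_iff (IsUnit.mk0 _ hne) _).1 h2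

lemma Sol.DD_zero (hs : Sol ν u₀ u K) {f : V → ℝ} (hf : TF f) (m : Fin 3) :
    ∀ᵐ t : ℝ, 0 < t → ∫ ξ, Fi (cc f) ξ * DD ν u₀ u m t ξ = 0 := by
  have hG : ∀ t, ((GG (u t) (WW f m) : ℝ) : ℂ) = _ := fun t => GG_fourier (hs.pair t) (hs.divw t) hf m
  have hH : ∀ t, ((HH ν (u t) (WW f m) : ℝ) : ℂ) = _ := fun t => HH_fourier (hs.mem t) (hs.pair t) (hs.divw t) hf m ν
  have hp0 : ∀ i, IsFourierPair (comp u₀ i) (FT (comp u₀ i)) := fun i => FT_spec (comp_mem hs.u0mem i)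
  have hG0 : ((GG u₀ (WW f m) : ℝ) : ℂ) = _ := GG_fourier hp0 hs.u0div hf m
  have h1 := oneD (G := fun t => GG (u t) (WW f m)) (H := fun t => HH ν (u t) (WW f m)) (G0 := GG u₀ (WW f m))
    (fun T hT => by
      rw [intervalIntegrable_iff_integrableOn_Ioc_of_le hT]
      have := (hs.int_NN hf m T).integral_prod_left
      simp only [← hG] at this
      exact this.re)
    (fun T hT => by
      rw [intervalIntegrable_iff_integrableOn_Ioc_of_le hT]
      have := (hs.int_PP hf m T).integral_prod_left
      simp only [← hH] at this
      exact this.re)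
    (fun θ hθ hθc => weak_sep hs (WW_TF hf m) (WW_div hf m) hθ hθc)
  filter_upwards [h1] with t ht ht0
  have h2 := ht ht0
  have h3 := hs.DD_int3 hf m t
  rw [intervalIntegral.integral_of_le ht0.le] at h2
  have h4 := congrArg (fun r : ℝ => (r : ℂ)) h2
  simp only [Complex.ofReal_add, ← integral_complex_ofReal, hG, hG0, hH] at h4
  rw [integral_integral_swap (hs.int_PP hf m t)] at h4
  have hne : (4 * π ^ 2 : ℂ) ≠ 0 := by
    have : (π : ℂ) ≠ 0 := by exact_mod_cast Real.pi_ne_zero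
    exact mul_ne_zero (by norm_num) (pow_ne_zero 2 this)
  refine (mul_eq_zero.1 (?_ : (4 * π ^ 2 : ℂ) * ∫ ξ, Fi (cc f) ξ * DD ν u₀ u m t ξ = 0)).resolve_left hne
  rw [← integral_const_mul]
  simp only [DD_eq]
  have h5 : Integrable (fun ξ => Fi (cc f) ξ * (4 * π ^ 2 * (((‖ξ‖ ^ 2 : ℝ) : ℂ) * wv u t m ξ))
      - Fi (cc f) ξ * (4 * π ^ 2 * (((‖ξ‖ ^ 2 : ℝ) : ℂ) * FT (comp u₀ m) ξ))) := h3.1.sub h3.2.1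
  rw [integral_sub h5 h3.2.2, integral_sub h3.1 h3.2.1, h4]; ring

end sol

lemma bmp_TF (n : ℕ) : TF (bmp n) := ⟨(bmp n).contDiff, (bmp n).hasCompactSupport⟩

lemma bmp_nonvan (n : ℕ) {ξ : V} (h : 2 / ((n : ℝ) + 1) * ‖ξ‖ < 1 / 4) : Fi (cc (bmp n)) ξ ≠ 0 := by
  have hre : (Fi (cc (bmp n)) ξ).re = ∫ x, (bmp n) x * Real.cos (2 * π * ⟪ξ, x⟫_ℝ) := by
    rw [Fi, ← RCLike.re_eq_complex_re, ← integral_re (int_ex (bmp_TF n).int ξ)]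
    congr 1; ext x
    rw [RCLike.re_eq_complex_re, cc, Complex.re_ofReal_mul, ex, Complex.exp_ofReal_mul_I_re]
  have hpos : 0 < ∫ x, (bmp n) x * Real.cos (2 * π * ⟪ξ, x⟫_ℝ) := by
    have hc : Continuous (fun x => (bmp n) x * Real.cos (2 * π * ⟪ξ, x⟫_ℝ)) :=
      (bmp n).continuous.mul (by fun_prop)
    refine hc.integral_pos_of_hasCompactSupport_nonneg_nonzero (x := 0) ((bmp n).hasCompactSupport.mul_right)
      (fun x => ?_) ?_
    · by_cases hx : ‖x‖ < 2 / ((n : ℝ) + 1)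
      · refine mul_nonneg (bmp n).nonneg (Real.cos_nonneg_of_mem_Icc ?_)
        have h1 : |⟪ξ, x⟫_ℝ| ≤ 1 / 4 := by
          refine (abs_real_inner_le_norm _ _).trans (le_trans ?_ h.le)
          rw [mul_comm]; gcongr
        have h2 := abs_le.1 h1
        constructor <;> nlinarith [Real.pi_pos]
      · have : (bmp n) x = 0 := by
          apply (bmp n).zero_of_le_dist
          rw [dist_zero_right]; exact not_lt.1 hx
        rw [this]; simp
    · simp [(bmp n).one_of_mem_closedBall (x := 0) (by simp [Metric.mem_closedBall, (bmp n).rIn_pos.le])]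
  intro h0
  rw [h0] at hre
  simp only [Complex.zero_re] at hre
  linarith

lemma TF.shift {f : V → ℝ} (h : TF f) (a : V) : TF (fun x => f (x - a)) := by
  refine ⟨h.smooth.comp (contDiff_id.sub contDiff_const), ?_⟩
  exact h.cpt.comp_homeomorph (Homeomorph.subRight a)

section sol
variable {ν K : ℝ} {u₀ : V → V} {u : ℝ → V → V}

lemma Sol.DD_ae (hs : Sol ν u₀ u K) (m : Fin 3) :
    ∀ᵐ t : ℝ, 0 < t → ∀ᵐ ξ : V, DD ν u₀ u m t ξ = 0 := by
  have h1 : ∀ᵐ t : ℝ, ∀ n k : ℕ, 0 < t →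
      ∫ ξ, Fi (cc (fun x => bmp n (x - TopologicalSpace.denseSeq V k))) ξ * DD ν u₀ u m t ξ = 0 :=
    ae_all_iff.2 fun n => ae_all_iff.2 fun k => hs.DD_zero ((bmp_TF n).shift _) m
  filter_upwards [h1] with t ht ht0
  have h2 : ∀ n, (fun ξ => Fi (cc (bmp n)) ξ * DD ν u₀ u m t ξ) =ᵐ[volume] 0 := by
    intro n
    have hi := hs.DD_int (bmp_TF n) m t
    refine Fi_inj hi ?_
    have hc := continuous_Fi hi
    have : Fi (fun ξ => Fi (cc (bmp n)) ξ * DD ν u₀ u m t ξ) = fun _ => 0 := by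
      refine hc.ext_on (TopologicalSpace.denseRange_denseSeq V) continuous_const ?_
      rintro _ ⟨k, rfl⟩
      refine Eq.trans ?_ (ht n k ht0)
      unfold Fi
      congr 1; ext ξ
      have := Fi_shift (cc (bmp n)) (TopologicalSpace.denseSeq V k) ξ
      unfold Fi at this
      change _ = (∫ x, (cc (bmp n)) (x - TopologicalSpace.denseSeq V k) * ex ξ x) * _
      rw [this, ex_symm]; ring
    intro x; rw [this]
  have h3 : ∀ᵐ ξ : V, ∀ n, Fi (cc (bmp n)) ξ * DD ν u₀ u m t ξ = 0 := ae_all_iff.2 h2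
  filter_upwards [h3] with ξ hξ
  obtain ⟨n, hn⟩ := exists_nat_gt (8 * ‖ξ‖)
  refine (mul_eq_zero.1 (hξ n)).resolve_left (bmp_nonvan n ?_)
  rw [div_mul_eq_mul_div, div_lt_iff₀ (by positivity)]
  linarith

end sol

/-- energy density -/
def LL (ν : ℝ) (u : V → V) (w : Fin 3 → V → ℂ) (ξ : V) : ℂ :=
  -(4 * π ^ 2 * ν) * ∑ m, ((‖ξ‖ ^ 2 : ℝ) : ℂ) * (w m ξ * conj (w m ξ))
    - ∑ m, ∑ i, (2 * π * Complex.I * ((ξ i : ℝ) : ℂ)) * qq u i m ξ * conj (w m ξ)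

lemma LL_alg (ν : ℝ) (u : V → V) (w : Fin 3 → V → ℂ) (ξ : V) (h : ∑ i, w i ξ * ((ξ i : ℝ) : ℂ) = 0) :
    ∑ m, conj (w m ξ) * PP ν u w m ξ = ((‖ξ‖ ^ 2 : ℝ) : ℂ) * LL ν u w ξ := by
  have h' := congrArg conj h
  simp only [map_sum, map_mul, Complex.conj_ofReal, map_zero] at h'
  unfold PP LL
  generalize ((‖ξ‖ ^ 2 : ℝ) : ℂ) = N
  have e01 : (0 : Fin 3) ≠ 1 := by decide
  have e02 : (0 : Fin 3) ≠ 2 := by decide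
  have e12 : (1 : Fin 3) ≠ 2 := by decide
  simp only [Fin.sum_univ_three, e01, e02, e12, e01.symm, e02.symm, e12.symm, if_true, if_false] at h' ⊢
  generalize conj (w 0 ξ) = a0 at *
  generalize conj (w 1 ξ) = a1 at *
  generalize conj (w 2 ξ) = a2 at *
  generalize qq u 0 0 ξ = q00
  generalize qq u 0 1 ξ = q01
  generalize qq u 0 2 ξ = q02
  generalize qq u 1 0 ξ = q10
  generalize qq u 1 1 ξ = q11
  generalize qq u 1 2 ξ = q12
  generalize qq u 2 0 ξ = q20
  generalize qq u 2 1 ξ = q21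
  generalize qq u 2 2 ξ = q22
  generalize ((ξ 0 : ℝ) : ℂ) = x0 at *
  generalize ((ξ 1 : ℝ) : ℂ) = x1 at *
  generalize ((ξ 2 : ℝ) : ℂ) = x2 at *
  linear_combination (2 * π * Complex.I * (x0 * (q00 * x0 + q01 * x1 + q02 * x2)
    + x1 * (q10 * x0 + q11 * x1 + q12 * x2) + x2 * (q20 * x0 + q21 * x1 + q22 * x2))) * h'

lemma PP_meas {u : ℝ → V → V} (hu : Measurable (uncurry u)) (ν : ℝ) (m : Fin 3) :
    StronglyMeasurable (fun q : ℝ × V => PP ν (u q.1) (wv u q.1) m q.2) := by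
  unfold PP
  have hq := fun i j => (qq_meas hu i j).measurable
  have hw := (wv_meas hu m).measurable
  have hx : ∀ i, Measurable (fun q : ℝ × V => ((q.2 i : ℝ) : ℂ)) := fun i => by fun_prop
  have hN : Measurable (fun q : ℝ × V => ((‖q.2‖ ^ 2 : ℝ) : ℂ)) := by fun_prop
  refine Measurable.stronglyMeasurable ?_
  refine (((hN.pow_const 2).const_mul _).neg.mul hw).add (Finset.measurable_fun_sum _ fun i _ =>
    Finset.measurable_fun_sum _ fun j _ => (((hx i).const_mul _).mul (((hx j).mul (hx m)).sub ?_)).mul (hq i j))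
  split_ifs
  · exact hN
  · exact measurable_const

lemma DD_meas {u : ℝ → V → V} (hu : Measurable (uncurry u)) (ν : ℝ) {u₀ : V → V} (h0 : MemLp u₀ 2 volume) (m : Fin 3) :
    ∃ D : ℝ × V → ℂ, StronglyMeasurable D ∧ ∀ᵐ ξ : V, ∀ t, D (t, ξ) = DD ν u₀ u m t ξ := by
  have hf := (FT_spec (comp_mem h0 m)).2.1.1
  obtain ⟨g, hg, hgf⟩ := hf
  refine ⟨fun q => ((‖q.2‖ ^ 2 : ℝ) : ℂ) * wv u q.1 m q.2 - ((‖q.2‖ ^ 2 : ℝ) : ℂ) * g q.2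
    - ∫ s in Set.Ioc 0 q.1, PP ν (u s) (wv u s) m q.2, ?_, ?_⟩
  · have hN : Measurable (fun q : ℝ × V => ((‖q.2‖ ^ 2 : ℝ) : ℂ)) := by fun_prop
    refine StronglyMeasurable.sub ?_ ?_
    · exact ((hN.mul (wv_meas hu m).measurable).sub (hN.mul (hg.measurable.comp measurable_snd))).stronglyMeasurable
    · simp only [← integral_indicator measurableSet_Ioc]
      have : StronglyMeasurable (fun p : (ℝ × V) × ℝ =>
          {p : (ℝ × V) × ℝ | 0 < p.2 ∧ p.2 ≤ p.1.1}.indicator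
            (fun p => PP ν (u p.2) (wv u p.2) m p.1.2) p) := by
        refine StronglyMeasurable.indicator ?_ ?_
        · exact (PP_meas hu ν m).comp_measurable (g := fun p : (ℝ × V) × ℝ => (p.2, p.1.2)) (by fun_prop)
        · exact (measurableSet_lt measurable_const measurable_snd).inter
            (measurableSet_le measurable_snd (measurable_fst.comp measurable_fst))
      exact this.integral_prod_right'
  · filter_upwards [hgf] with ξ hξ t
    rw [DD, hξ]

section sol
variable {ν K : ℝ} {u₀ : V → V} {u : ℝ → V → V}

lemma Sol.PP_intv (hs : Sol ν u₀ u K) (m : Fin 3) :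
    ∀ᵐ ξ : V, ∀ T : ℕ, Integrable (fun s => PP ν (u s) (wv u s) m ξ) (volume.restrict (Set.Ioc 0 (T:ℝ))) := by
  have h : ∀ᵐ ξ : V, ∀ T n : ℕ, Integrable (fun s => Fi (cc (bmp n)) ξ * (4 * π ^ 2 * PP ν (u s) (wv u s) m ξ))
      (volume.restrict (Set.Ioc 0 (T:ℝ))) :=
    ae_all_iff.2 fun T => ae_all_iff.2 fun n => (hs.int_PP (bmp_TF n) m T).prod_left_ae
  filter_upwards [h] with ξ hξ T
  obtain ⟨n, hn⟩ := exists_nat_gt (8 * ‖ξ‖)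
  have h1 : Fi (cc (bmp n)) ξ ≠ 0 := by
    refine bmp_nonvan n ?_
    rw [div_mul_eq_mul_div, div_lt_iff₀ (by positivity)]
    linarith
  have hne : (4 * π ^ 2 : ℂ) ≠ 0 := by
    have : (π : ℂ) ≠ 0 := by exact_mod_cast Real.pi_ne_zero
    exact mul_ne_zero (by norm_num) (pow_ne_zero 2 this)
  have := (integrable_const_mul_iff (IsUnit.mk0 _ h1) _).1 (hξ T n)
  exact (integrable_const_mul_iff (IsUnit.mk0 _ hne) _).1 this

lemma Sol.swap_DD (hs : Sol ν u₀ u K) (m : Fin 3) :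
    ∀ᵐ ξ : V, ∀ᵐ t : ℝ, 0 < t → DD ν u₀ u m t ξ = 0 := by
  obtain ⟨D, hD, hDe⟩ := DD_meas hs.meas ν hs.u0mem m
  have h1 : ∀ᵐ t : ℝ, ∀ᵐ ξ : V, 0 < t → D (t, ξ) = 0 := by
    filter_upwards [hs.DD_ae m] with t ht
    by_cases h0 : 0 < t
    · filter_upwards [ht h0, hDe] with ξ h2 h3 _
      rw [h3, h2]
    · exact Eventually.of_forall fun _ h => absurd h h0
  rw [Measure.ae_ae_comm (p := fun t ξ => 0 < t → D (t, ξ) = 0)] at h1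
  · filter_upwards [h1, hDe] with ξ h2 h3
    filter_upwards [h2] with t h4 h5
    rw [← h3, h4 h5]
  · have e : {x : ℝ × V | 0 < x.1 → D (x.1, x.2) = 0} = {x : ℝ × V | 0 < x.1}ᶜ ∪ {x | D x = 0} := by
      ext x; simp only [Set.mem_ofPred_eq, Set.mem_union, Set.mem_compl_iff]; tauto
    rw [e]
    exact (measurableSet_lt measurable_const measurable_fst).compl.union
      (hD.measurable (measurableSet_singleton 0))

lemma Sol.swap_div (hs : Sol ν u₀ u K) :
    ∀ᵐ ξ : V, ∀ᵐ t : ℝ, ∑ i, wv u t i ξ * ((ξ i : ℝ) : ℂ) = 0 := by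
  refine (Measure.ae_ae_comm (p := fun t ξ => ∑ i, wv u t i ξ * ((ξ i : ℝ) : ℂ) = 0) ?_).1
    (Eventually.of_forall fun t => hs.divw t)
  have : Measurable (fun q : ℝ × V => ∑ i, wv u q.1 i q.2 * ((q.2 i : ℝ) : ℂ)) :=
    Finset.measurable_fun_sum _ fun i _ => (wv_meas hs.meas i).measurable.mul (by fun_prop)
  exact this (measurableSet_singleton 0)

lemma cprod_rule {z H : ℝ → ℂ} {z0 : ℂ} {M : ℝ} (hM : 0 ≤ M) (hH : Integrable H (volume.restrict (Set.Ioc 0 M)))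
    (hz : ∀ᵐ t : ℝ, 0 < t → z t = z0 + ∫ s in Set.Ioc 0 t, H s) {t : ℝ} (ht0 : 0 < t) (htM : t ≤ M)
    (hzt : z t = z0 + ∫ s in Set.Ioc 0 t, H s) :
    ‖z t‖ ^ 2 = ‖z0‖ ^ 2 + 2 * ∫ s in Set.Ioc 0 t, (conj (z s) * H s).re
      ∧ Integrable (fun s => (conj (z s) * H s).re) (volume.restrict (Set.Ioc 0 t)) := by
  have hHt : IntegrableOn H (Set.Ioc 0 t) := hH.mono_measure (Measure.restrict_mono (Set.Ioc_subset_Ioc_right htM) le_rfl)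
  have hHc : IntegrableOn H (Set.Icc 0 t) := by rwa [integrableOn_Icc_iff_integrableOn_Ioc]
  have hI : Integrable (fun s => conj (z s) * H s) (volume.restrict (Set.Ioc 0 t)) := by
    have hc : ContinuousOn (fun r => conj (z0 + ∫ s in Set.Ioc 0 r, H s)) (Set.Icc 0 t) :=
      Complex.continuous_conj.comp_continuousOn
        (continuousOn_const.add (intervalIntegral.continuousOn_primitive hHc))
    have h1 : IntegrableOn (fun r => conj (z0 + ∫ s in Set.Ioc 0 r, H s) * H r) (Set.Icc 0 t) :=
      hHc.continuousOn_mul hc isCompact_Icc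
    refine Integrable.congr (h1.mono_set Set.Ioc_subset_Icc_self) ?_
    filter_upwards [ae_restrict_of_ae hz, ae_restrict_mem measurableSet_Ioc] with s h2 h3
    rw [h2 h3.1]
  refine ⟨?_, hI.re⟩
  have hHii : ∀ {r : ℝ}, 0 < r → r ≤ t → Integrable H (volume.restrict (Set.Ioc 0 r)) := fun _ hr =>
    hHt.mono_set (Set.Ioc_subset_Ioc_right hr)
  have hre : ∀ r, 0 < r → r ≤ t → z r = z0 + ∫ s in Set.Ioc 0 r, H s →
      (z r).re = z0.re + ∫ s in (0:ℝ)..r, (H s).re := by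
    intro r hr hrt h
    rw [intervalIntegral.integral_of_le hr.le, h, Complex.add_re]
    congr 1
    exact (integral_re (hHii hr hrt)).symm
  have him : ∀ r, 0 < r → r ≤ t → z r = z0 + ∫ s in Set.Ioc 0 r, H s →
      (z r).im = z0.im + ∫ s in (0:ℝ)..r, (H s).im := by
    intro r hr hrt h
    rw [intervalIntegral.integral_of_le hr.le, h, Complex.add_im]
    congr 1
    exact (integral_im (hHii hr hrt)).symm
  have h1 := prod_rule (z := fun s => (z s).re) (H := fun s => (H s).re) (z0 := z0.re) ht0.le
    ((intervalIntegrable_iff_integrableOn_Ioc_of_le ht0.le).2 (Integrable.re hHt))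
    (by filter_upwards [hz] with r h2 h3 h4 using hre r h3 h4 (h2 h3)) ht0 le_rfl (hre t ht0 le_rfl hzt)
  have h2 := prod_rule (z := fun s => (z s).im) (H := fun s => (H s).im) (z0 := z0.im) ht0.le
    ((intervalIntegrable_iff_integrableOn_Ioc_of_le ht0.le).2 (Integrable.im hHt))
    (by filter_upwards [hz] with r h2 h3 h4 using him r h3 h4 (h2 h3)) ht0 le_rfl (him t ht0 le_rfl hzt)
  rw [intervalIntegral.integral_of_le ht0.le] at h1 h2
  have hI2 : Integrable (fun s => z s * H s) (volume.restrict (Set.Ioc 0 t)) := by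
    have hc : ContinuousOn (fun r => (z0 + ∫ s in Set.Ioc 0 r, H s)) (Set.Icc 0 t) :=
        (continuousOn_const.add (intervalIntegral.continuousOn_primitive hHc))
    have h1 : IntegrableOn (fun r => (z0 + ∫ s in Set.Ioc 0 r, H s) * H r) (Set.Icc 0 t) :=
      hHc.continuousOn_mul hc isCompact_Icc
    refine Integrable.congr (h1.mono_set Set.Ioc_subset_Icc_self) ?_
    filter_upwards [ae_restrict_of_ae hz, ae_restrict_mem measurableSet_Ioc] with s h2 h3
    rw [h2 h3.1]
  have hIr : Integrable (fun s => (z s).re * (H s).re) (volume.restrict (Set.Ioc 0 t)) := by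
    refine ((hI.re.add hI2.re).div_const 2).congr (Eventually.of_forall fun s => ?_)
    simp
  have hIi : Integrable (fun s => (z s).im * (H s).im) (volume.restrict (Set.Ioc 0 t)) := by
    refine ((hI.re.sub hI2.re).div_const 2).congr (Eventually.of_forall fun s => ?_)
    simp
  have h3 : ∫ s in Set.Ioc 0 t, (conj (z s) * H s).re =
      (∫ s in Set.Ioc 0 t, (z s).re * (H s).re) + ∫ s in Set.Ioc 0 t, (z s).im * (H s).im := by
    rw [← integral_add hIr hIi]
    congr 1; ext s
    simp
  rw [h3, ← Complex.normSq_eq_norm_sq, ← Complex.normSq_eq_norm_sq, Complex.normSq_apply, Complex.normSq_apply]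
  nlinarith [h1, h2]

lemma Sol.pt_energy (hs : Sol ν u₀ u K) : ∀ᵐ t : ℝ, 0 < t → ∀ᵐ ξ : V,
    (1 / 2) * ∑ m, ‖wv u t m ξ‖ ^ 2 = (1 / 2) * ∑ m, ‖FT (comp u₀ m) ξ‖ ^ 2
      + ∫ s in Set.Ioc 0 t, (LL ν (u s) (wv u s) ξ).re := by
  have hD : ∀ᵐ t : ℝ, ∀ m, 0 < t → ∀ᵐ ξ : V, DD ν u₀ u m t ξ = 0 := ae_all_iff.2 hs.DD_ae
  filter_upwards [hD] with t ht ht0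
  have h1 : ∀ᵐ ξ : V, ∀ m, DD ν u₀ u m t ξ = 0 := ae_all_iff.2 fun m => ht m ht0
  have h2 : ∀ᵐ ξ : V, ∀ m, ∀ᵐ t : ℝ, 0 < t → DD ν u₀ u m t ξ = 0 := ae_all_iff.2 hs.swap_DD
  have h3 : ∀ᵐ ξ : V, ∀ m, ∀ T : ℕ, Integrable (fun s => PP ν (u s) (wv u s) m ξ) (volume.restrict (Set.Ioc 0 (T:ℝ))) :=
    ae_all_iff.2 hs.PP_intv
  have h4 : ∀ᵐ ξ : V, ξ ≠ 0 := by simp [ae_iff]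
  filter_upwards [h1, h2, h3, h4, hs.swap_div] with ξ k1 k2 k3 k4 k5
  obtain ⟨T, hT⟩ := exists_nat_ge t
  have hN : (‖ξ‖ ^ 2 : ℝ) ≠ 0 := pow_ne_zero 2 (norm_ne_zero_iff.2 k4)
  have e : ∀ m s, DD ν u₀ u m s ξ = 0 → ((‖ξ‖ ^ 2 : ℝ) : ℂ) * wv u s m ξ = ((‖ξ‖ ^ 2 : ℝ) : ℂ) * FT (comp u₀ m) ξ
    + ∫ r in Set.Ioc 0 s, PP ν (u r) (wv u r) m ξ := by
    intro m s h
    rw [DD] at h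
    linear_combination h
  have key := fun m => cprod_rule (z := fun s => ((‖ξ‖ ^ 2 : ℝ) : ℂ) * wv u s m ξ)
    (H := fun s => PP ν (u s) (wv u s) m ξ) (z0 := ((‖ξ‖ ^ 2 : ℝ) : ℂ) * FT (comp u₀ m) ξ) (M := T)
    (Nat.cast_nonneg _) (k3 m T) (by filter_upwards [k2 m] with s h5 h6 using e m s (h5 h6)) ht0 hT (e m t (k1 m))
  have hsum : ∑ m, ∫ s in Set.Ioc 0 t, (conj (((‖ξ‖ ^ 2 : ℝ) : ℂ) * wv u s m ξ) * PP ν (u s) (wv u s) m ξ).re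
     = (‖ξ‖ ^ 2) ^ 2 * ∫ s in Set.Ioc 0 t, (LL ν (u s) (wv u s) ξ).re := by
    rw [← integral_finsetSum _ fun m _ => (key m).2, ← integral_const_mul]
    refine integral_congr_ae ?_
    filter_upwards [ae_restrict_of_ae k5] with s h5
    have h6 := LL_alg ν (u s) (wv u s) ξ h5
    have h7 : ∑ m, conj (((‖ξ‖ ^ 2 : ℝ) : ℂ) * wv u s m ξ) * PP ν (u s) (wv u s) m ξ
      = (((‖ξ‖ ^ 2) ^ 2 : ℝ) : ℂ) * LL ν (u s) (wv u s) ξ := by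
      simp only [map_mul, Complex.conj_ofReal, mul_assoc, ← Finset.mul_sum]
      rw [h6]; push_cast; ring
    have h8 := congrArg Complex.re h7
    rw [Complex.re_ofReal_mul, Complex.re_sum] at h8
    exact h8
  have hfin := Finset.sum_congr rfl (fun m (_ : m ∈ (Finset.univ : Finset (Fin 3))) => (key m).1)
  rw [Finset.sum_add_distrib, ← Finset.mul_sum, hsum] at hfin
  simp only [norm_mul, Complex.norm_real, mul_pow, ← Finset.mul_sum, Real.norm_of_nonneg (sq_nonneg ‖ξ‖)] at hfin
  have hN2 : (‖ξ‖ ^ 2) ^ 2 ≠ 0 := pow_ne_zero 2 hN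
  apply mul_left_cancel₀ hN2
  linear_combination (1 / 2) * hfin

end sol

lemma flip_conj {p g : V → ℂ} (hp : Integrable p) (hg : Integrable g) :
    ∫ x, g x * conj (Fi p x) = ∫ ξ, conj (p ξ) * Fi g (-ξ) := by
  have hg' : Integrable (fun x => conj (g x)) := (integrable_norm_iff (Complex.continuous_conj.comp_aestronglyMeasurable hg.1)).1 (by
    simpa using hg.norm)
  have h := congrArg conj (Fi_flip hp hg')
  rw [← integral_conj, ← integral_conj] at h
  have e : ∀ ξ, conj (Fi (fun x => conj (g x)) ξ) = Fi g (-ξ) := by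
    intro ξ
    rw [Fi, Fi, ← integral_conj]
    congr 1; ext x
    rw [map_mul, Complex.conj_conj]
    congr 1
    rw [ex, ex, ← Complex.exp_conj]
    simp [inner_neg_left, Complex.conj_ofNat]
  simp only [map_mul, Complex.conj_conj, e] at h
  rw [← h]
  congr 1; ext x; ring

lemma cutf_setInt (R : ℝ) (p : V → ℂ) : ∫ ξ, cutf R p ξ = ∫ ξ in {ξ : V | ‖ξ‖ < R}, p ξ := by
  rw [← integral_indicator (meas_ballset R)]; rfl

lemma TT_qq {u : V → V} (hu : MemLp u 2 volume) {w : Fin 3 → V → ℂ} (hw : ∀ m, MemLp (w m) 2 volume) (R : ℝ) :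
    TT R (fun i => comp u i) w = (-∑ m, ∑ i, ∫ ξ, cutf R (fun ξ => (2 * π * Complex.I * ((ξ i : ℝ) : ℂ)) * qq u i m ξ * conj (w m ξ)) ξ).re := by
  unfold TT
  congr 1
  rw [← Finset.sum_neg_distrib]
  refine Finset.sum_congr rfl fun m _ => ?_
  rw [← Finset.sum_neg_distrib]
  refine Finset.sum_congr rfl fun i _ => ?_
  rw [flip_conj ((BL.cutf (hw m) R).dmul i).int (int_uu hu i m), ← integral_neg]
  congr 1; ext ξ
  change _ * qq u i m ξ = _
  rw [dmul, cutf_apply, cutf_apply]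
  split_ifs
  · simp [Complex.conj_ofNat]; ring
  · simp

section sol
variable {ν K : ℝ} {u₀ : V → V} {u : ℝ → V → V}

/-- low-frequency dissipation -/
def Glo (R : ℝ) (w : Fin 3 → V → ℂ) : ℝ := ∑ m, ∫ ξ in {ξ : V | ‖ξ‖ < R}, ‖ξ‖ ^ 2 * ‖w m ξ‖ ^ 2

lemma wpair_int {w : V → ℂ} (hw : MemLp w 2 volume) (R : ℝ) :
    Integrable (fun ξ => cutf R (fun ξ => ((‖ξ‖ ^ 2 : ℝ) : ℂ) * (w ξ * conj (w ξ))) ξ) ∧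
    ∫ ξ, ‖cutf R (fun ξ => ((‖ξ‖ ^ 2 : ℝ) : ℂ) * (w ξ * conj (w ξ))) ξ‖ ≤ R ^ 2 * ∫ ξ, ‖w ξ‖ ^ 2 := by
  have hb : ∀ ξ, ‖cutf R (fun ξ => ((‖ξ‖ ^ 2 : ℝ) : ℂ) * (w ξ * conj (w ξ))) ξ‖ ≤ R ^ 2 * ‖w ξ‖ ^ 2 := by
    intro ξ
    rw [cutf_apply]
    split_ifs with h
    · rw [norm_mul, norm_mul, Complex.norm_real, Real.norm_of_nonneg (by positivity), RCLike.norm_conj, ← sq]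
      have := norm_nonneg ξ
      gcongr
    · simp; positivity
  have hi : Integrable (fun ξ => cutf R (fun ξ => ((‖ξ‖ ^ 2 : ℝ) : ℂ) * (w ξ * conj (w ξ))) ξ) := by
    refine Integrable.mono' ((sq_int hw).const_mul (R ^ 2)) ?_ (Eventually.of_forall hb)
    have h1 : AEStronglyMeasurable (fun ξ => ((‖ξ‖ ^ 2 : ℝ) : ℂ) * (w ξ * conj (w ξ))) volume := by
      have hN : Continuous (fun ξ : V => ((‖ξ‖ ^ 2 : ℝ) : ℂ)) := by fun_prop
      exact hN.aestronglyMeasurable.mul (hw.1.mul (Complex.continuous_conj.comp_aestronglyMeasurable hw.1))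
    exact h1.indicator (meas_ballset R)
  refine ⟨hi, ?_⟩
  rw [← integral_const_mul]
  exact integral_mono hi.norm ((sq_int hw).const_mul (R ^ 2)) hb

lemma qw_int {w q : V → ℂ} (hw : MemLp w 2 volume) (hq : Continuous q) {C : ℝ} (hC : ∀ ξ, ‖q ξ‖ ≤ C) (R : ℝ) (i : Fin 3) :
    Integrable (fun ξ => cutf R (fun ξ => (2 * π * Complex.I * ((ξ i : ℝ) : ℂ)) * q ξ * conj (w ξ)) ξ) ∧
    ∫ ξ, ‖cutf R (fun ξ => (2 * π * Complex.I * ((ξ i : ℝ) : ℂ)) * q ξ * conj (w ξ)) ξ‖ ≤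
      2 * π * |R| * C * (∫ ξ, (cutf R (fun _ => 1) ξ).re) + 2 * π * |R| * C * ∫ ξ, ‖w ξ‖ ^ 2 := by
  have hC0 : 0 ≤ C := (norm_nonneg _).trans (hC 0)
  have h1 : Integrable (fun ξ => (cutf R (fun _ => 1) ξ).re) := by
    have : Integrable (cutf R (fun _ => 1)) :=
      (integrable_indicator_iff (meas_ballset R)).2 (integrableOn_const (by
        have : {ξ : V | ‖ξ‖ < R} = Metric.ball 0 R := by ext; simp
        rw [this]; exact measure_ball_lt_top.ne))
    exact this.re
  have hb : ∀ ξ, ‖cutf R (fun ξ => (2 * π * Complex.I * ((ξ i : ℝ) : ℂ)) * q ξ * conj (w ξ)) ξ‖ ≤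
      2 * π * |R| * C * (cutf R (fun _ => 1) ξ).re + 2 * π * |R| * C * ‖w ξ‖ ^ 2 := by
    intro ξ
    rw [cutf_apply, cutf_apply]
    split_ifs with h
    · simp only [norm_mul, Complex.norm_real, RCLike.norm_conj, Complex.norm_I, Complex.norm_ofNat,
        Real.norm_of_nonneg Real.pi_pos.le, Complex.one_re, mul_one]
      have h2 : ‖ξ i‖ ≤ |R| := (coord_le ξ i).trans (h.le.trans (le_abs_self R))
      have h3 : ‖w ξ‖ ≤ 1 + ‖w ξ‖ ^ 2 := by nlinarith [sq_nonneg (‖w ξ‖ - 1), norm_nonneg (w ξ)]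
      calc 2 * π * ‖ξ i‖ * ‖q ξ‖ * ‖w ξ‖ ≤ 2 * π * |R| * C * (1 + ‖w ξ‖ ^ 2) := by
            have := Real.pi_pos
            gcongr
            exact hC ξ
        _ = _ := by ring
    · simp only [norm_zero, Complex.zero_re, mul_zero, zero_add]
      have := Real.pi_pos
      positivity
  have hi : Integrable (fun ξ => cutf R (fun ξ => (2 * π * Complex.I * ((ξ i : ℝ) : ℂ)) * q ξ * conj (w ξ)) ξ) := by
    refine Integrable.mono' ((h1.const_mul _).add ((sq_int hw).const_mul _)) ?_ (Eventually.of_forall hb)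
    have hc : Continuous (fun ξ : V => (2 * π * Complex.I * ((ξ i : ℝ) : ℂ)) * q ξ) := by fun_prop
    exact (hc.aestronglyMeasurable.mul (Complex.continuous_conj.comp_aestronglyMeasurable hw.1)).indicator (meas_ballset R)
  refine ⟨hi, ?_⟩
  rw [← integral_const_mul, ← integral_const_mul, ← integral_add (h1.const_mul _) ((sq_int hw).const_mul _)]
  exact integral_mono hi.norm ((h1.const_mul _).add ((sq_int hw).const_mul _)) hb

lemma cutf_joint {f : ℝ × V → ℂ} (hf : StronglyMeasurable f) (R : ℝ) :
    StronglyMeasurable (fun q : ℝ × V => cutf R (fun ξ => f (q.1, ξ)) q.2) := 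
  cutf_meas (w := fun t ξ => f (t, ξ)) hf R

lemma Sol.jw (hs : Sol ν u₀ u K) (R T : ℝ) (m : Fin 3) :
    Integrable (fun q : ℝ × V => cutf R (fun ξ => ((‖ξ‖ ^ 2 : ℝ) : ℂ) * (wv u q.1 m ξ * conj (wv u q.1 m ξ))) q.2)
      ((volume.restrict (Set.Ioc 0 T)).prod volume) := by
  refine joint_int (C := R ^ 2 * max K 0) ?_ (fun t => (wpair_int (hs.pair t m).2.1 R).1)
    (fun t => (wpair_int (hs.pair t m).2.1 R).2.trans ?_) T _ le_rfl
  · have hN : Measurable (fun q : ℝ × V => ((‖q.2‖ ^ 2 : ℝ) : ℂ)) := by fun_prop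
    have hw := (wv_meas hs.meas m).measurable
    exact cutf_joint (f := fun q : ℝ × V => ((‖q.2‖ ^ 2 : ℝ) : ℂ) * (wv u q.1 m q.2 * conj (wv u q.1 m q.2)))
      (hN.mul (hw.mul (Complex.continuous_conj.measurable.comp hw))).stronglyMeasurable R
  · exact mul_le_mul_of_nonneg_left (hs.w_bound t m) (sq_nonneg R)

lemma Sol.jq (hs : Sol ν u₀ u K) (R T : ℝ) (m i : Fin 3) :
    Integrable (fun q : ℝ × V => cutf R (fun ξ => (2 * π * Complex.I * ((ξ i : ℝ) : ℂ)) * qq (u q.1) i m ξ * conj (wv u q.1 m ξ)) q.2)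
      ((volume.restrict (Set.Ioc 0 T)).prod volume) := by
  refine joint_int (C := 2 * π * |R| * max K 0 * (∫ ξ, (cutf R (fun _ => 1) ξ).re) + 2 * π * |R| * max K 0 * max K 0) ?_
    (fun t => (qw_int (hs.pair t m).2.1 (qq_cont (hs.mem t) i m) (hs.q_bound t i m) R i).1)
    (fun t => (qw_int (hs.pair t m).2.1 (qq_cont (hs.mem t) i m) (hs.q_bound t i m) R i).2.trans ?_) T _ le_rfl
  · have hx : Measurable (fun q : ℝ × V => (2 * π * Complex.I * ((q.2 i : ℝ) : ℂ))) := by fun_prop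
    have hw := (wv_meas hs.meas m).measurable
    exact cutf_joint (f := fun q : ℝ × V => (2 * π * Complex.I * ((q.2 i : ℝ) : ℂ)) * qq (u q.1) i m q.2 * conj (wv u q.1 m q.2))
      ((hx.mul (qq_meas hs.meas i m).measurable).mul (Complex.continuous_conj.measurable.comp hw)).stronglyMeasurable R
  · have := Real.pi_pos
    have := hs.w_bound t m
    gcongr

lemma LL_cut (ν R : ℝ) (u : V → V) (w : Fin 3 → V → ℂ) (ξ : V) : cutf R (LL ν u w) ξ =
    -(4 * π ^ 2 * ν) * ∑ m, cutf R (fun ξ => ((‖ξ‖ ^ 2 : ℝ) : ℂ) * (w m ξ * conj (w m ξ))) ξ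
    - ∑ m, ∑ i, cutf R (fun ξ => (2 * π * Complex.I * ((ξ i : ℝ) : ℂ)) * qq u i m ξ * conj (w m ξ)) ξ := by
  simp only [cutf_apply]
  split_ifs
  · rfl
  · simp

lemma Sol.jL (hs : Sol ν u₀ u K) (R T : ℝ) :
    Integrable (fun q : ℝ × V => cutf R (LL ν (u q.1) (wv u q.1)) q.2)
      ((volume.restrict (Set.Ioc 0 T)).prod volume) := by
  simp only [LL_cut]
  exact ((integrable_finsetSum _ fun m _ => hs.jw R T m).const_mul _).sub
    (integrable_finsetSum _ fun m _ => integrable_finsetSum _ fun i _ => hs.jq R T m i)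

lemma Glo_eq {w : Fin 3 → V → ℂ} (R : ℝ) :
    ((Glo R w : ℝ) : ℂ) = ∑ m, ∫ ξ, cutf R (fun ξ => ((‖ξ‖ ^ 2 : ℝ) : ℂ) * (w m ξ * conj (w m ξ))) ξ := by
  unfold Glo
  push_cast
  refine Finset.sum_congr rfl fun m _ => ?_
  rw [cutf_setInt, ← integral_complex_ofReal]
  congr 1; ext ξ
  rw [Complex.mul_conj, Complex.normSq_eq_norm_sq]; push_cast; ring

lemma Sol.int_LL (hs : Sol ν u₀ u K) (R s : ℝ) :
    (∫ ξ, cutf R (LL ν (u s) (wv u s)) ξ).re =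
      -(4 * π ^ 2 * ν) * Glo R (wv u s) + TT R (fun i => comp (u s) i) (wv u s) := by
  have hi1 := fun m => (wpair_int (hs.pair s m).2.1 R).1
  have hi2 := fun m i => (qw_int (hs.pair s m).2.1 (qq_cont (hs.mem s) i m) (hs.q_bound s i m) R i).1
  simp only [LL_cut]
  have k1 : Integrable (fun ξ => (-(4 * π ^ 2 * ν) : ℂ) * ∑ m, cutf R (fun ξ => ((‖ξ‖ ^ 2 : ℝ) : ℂ) * (wv u s m ξ * conj (wv u s m ξ))) ξ) :=
    (integrable_finsetSum _ fun m _ => hi1 m).const_mul _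
  have k2 : Integrable (fun ξ => ∑ m, ∑ i, cutf R (fun ξ => (2 * π * Complex.I * ((ξ i : ℝ) : ℂ)) * qq (u s) i m ξ * conj (wv u s m ξ)) ξ) :=
    integrable_finsetSum _ fun m _ => integrable_finsetSum _ fun i _ => hi2 m i
  rw [integral_sub k1 k2, integral_const_mul, integral_finsetSum _ fun m _ => hi1 m, ← Glo_eq,
    integral_finsetSum _ fun m _ => integrable_finsetSum _ fun i _ => hi2 m i,
    TT_qq (hs.mem s) (fun m => (hs.pair s m).2.1), Complex.sub_re, Complex.neg_re, ← sub_eq_add_neg]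
  congr 1
  · rw [← Complex.ofReal_re (-(4 * π ^ 2 * ν) * Glo R (wv u s))]; push_cast; rfl
  · congr 1
    exact Finset.sum_congr rfl fun m _ => integral_finsetSum _ fun i _ => hi2 m i

lemma Sol.int_Glo (hs : Sol ν u₀ u K) (R T : ℝ) :
    Integrable (fun s => Glo R (wv u s)) (volume.restrict (Set.Ioc 0 T)) := by
  have : Integrable (fun s => ((Glo R (wv u s) : ℝ) : ℂ)) (volume.restrict (Set.Ioc 0 T)) := by
    simp only [Glo_eq]
    exact integrable_finsetSum _ fun m _ => (hs.jw R T m).integral_prod_left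
  exact this.re

lemma Sol.int_TT (hs : Sol ν u₀ u K) (R T : ℝ) :
    Integrable (fun s => TT R (fun i => comp (u s) i) (wv u s)) (volume.restrict (Set.Ioc 0 T)) := by
  have h1 := (hs.jL R T).integral_prod_left.re
  simp only [RCLike.re_eq_complex_re, hs.int_LL] at h1
  have h2 := (hs.int_Glo R T).const_mul (4 * π ^ 2 * ν)
  refine (h1.add h2).congr (Eventually.of_forall fun s => ?_)
  simp only [Pi.add_apply]; ring

lemma Sol.energy_low (hs : Sol ν u₀ u K) (R : ℝ) : ∀ᵐ t : ℝ, 0 < t →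
    (1 / 2) * (∑ m, ∫ ξ in {ξ : V | ‖ξ‖ < R}, ‖wv u t m ξ‖ ^ 2)
        + 4 * π ^ 2 * ν * ∫ s in Set.Ioc 0 t, Glo R (wv u s)
      = (1 / 2) * (∑ m, ∫ ξ in {ξ : V | ‖ξ‖ < R}, ‖FT (comp u₀ m) ξ‖ ^ 2)
        + ∫ s in Set.Ioc 0 t, TT R (fun i => comp (u s) i) (wv u s) := by
  filter_upwards [hs.pt_energy] with t ht ht0
  have h1 : ∫ ξ in {ξ : V | ‖ξ‖ < R}, (1 / 2) * ∑ m, ‖wv u t m ξ‖ ^ 2 =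
      ∫ ξ in {ξ : V | ‖ξ‖ < R}, ((1 / 2) * ∑ m, ‖FT (comp u₀ m) ξ‖ ^ 2
      + ∫ s in Set.Ioc 0 t, (LL ν (u s) (wv u s) ξ).re) := by
    refine integral_congr_ae (ae_restrict_of_ae (ht ht0))
  have i1 : ∀ m, IntegrableOn (fun ξ => ‖wv u t m ξ‖ ^ 2) {ξ : V | ‖ξ‖ < R} := fun m =>
    (sq_int (hs.pair t m).2.1).integrableOn
  have i2 : ∀ m, IntegrableOn (fun ξ => ‖FT (comp u₀ m) ξ‖ ^ 2) {ξ : V | ‖ξ‖ < R} := fun m =>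
    (sq_int (FT_spec (comp_mem hs.u0mem m)).2.1).integrableOn
  have hj := hs.jL R t
  have e1 : ∀ s ξ, (cutf R (LL ν (u s) (wv u s)) ξ).re = {ξ : V | ‖ξ‖ < R}.indicator (fun ξ => (LL ν (u s) (wv u s) ξ).re) ξ := by
    intro s ξ
    by_cases h : ξ ∈ {ξ : V | ‖ξ‖ < R}
    · rw [cutf, Set.indicator_of_mem h, Set.indicator_of_mem h]
    · rw [cutf, Set.indicator_of_notMem h, Set.indicator_of_notMem h]; rfl
  have e2 : (fun ξ => ∫ s in Set.Ioc 0 t, (cutf R (LL ν (u s) (wv u s)) ξ).re) =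
      {ξ : V | ‖ξ‖ < R}.indicator (fun ξ => ∫ s in Set.Ioc 0 t, (LL ν (u s) (wv u s) ξ).re) := by
    ext ξ
    simp only [e1]
    by_cases h : ξ ∈ {ξ : V | ‖ξ‖ < R}
    · simp only [Set.indicator_of_mem h]
    · simp only [Set.indicator_of_notMem h, integral_zero]
  have i3 : IntegrableOn (fun ξ => ∫ s in Set.Ioc 0 t, (LL ν (u s) (wv u s) ξ).re) {ξ : V | ‖ξ‖ < R} := by
    rw [← integrable_indicator_iff (meas_ballset R), ← e2]
    exact hj.re.integral_prod_right
  have h2 : ∫ ξ in {ξ : V | ‖ξ‖ < R}, ∫ s in Set.Ioc 0 t, (LL ν (u s) (wv u s) ξ).re =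
      ∫ s in Set.Ioc 0 t, (-(4 * π ^ 2 * ν) * Glo R (wv u s) + TT R (fun i => comp (u s) i) (wv u s)) := by
    rw [← integral_indicator (meas_ballset R), ← e2]
    have := integral_integral_swap (f := fun s ξ => (cutf R (LL ν (u s) (wv u s)) ξ).re) hj.re
    rw [← this]
    refine integral_congr_ae ?_
    filter_upwards [hj.prod_right_ae] with s h3
    rw [← hs.int_LL]
    exact integral_re h3
  rw [integral_add ((integrable_finsetSum _ fun m _ => i2 m).const_mul _) i3, h2, integral_const_mul, integral_const_mul,
    integral_finsetSum _ fun m _ => i1 m, integral_finsetSum _ fun m _ => i2 m,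
    integral_add ((hs.int_Glo R t).const_mul _) (hs.int_TT R t), integral_const_mul] at h1
  rw [h1]; ring

end sol

section sol
variable {ν K : ℝ} {u₀ : V → V} {u : ℝ → V → V}

def hiS (R : ℝ) (w : Fin 3 → V → ℂ) : ℝ := ∑ m, hiA R (w m)

lemma hiS_nonneg (R : ℝ) (w : Fin 3 → V → ℂ) : 0 ≤ hiS R w :=
  Finset.sum_nonneg fun m _ => setIntegral_nonneg (meas_hiset R) fun ξ _ => sq_nonneg _

lemma hiS_anti {R R' : ℝ} (h : R ≤ R') {w : Fin 3 → V → ℂ} (hw : ∀ m, MemLp (w m) 2 volume) : hiS R' w ≤ hiS R w :=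
  Finset.sum_le_sum fun m _ => setIntegral_mono_set (sq_int (hw m)).integrableOn
    (Eventually.of_forall fun ξ => sq_nonneg _) (HasSubset.Subset.eventuallyLE fun _ hx => h.trans hx)

lemma hiS_le {R : ℝ} {w : Fin 3 → V → ℂ} (hw : ∀ m, MemLp (w m) 2 volume) : hiS R w ≤ ∑ m, ∫ ξ, ‖w m ξ‖ ^ 2 :=
  Finset.sum_le_sum fun m _ => setIntegral_le_integral (sq_int (hw m)) (Eventually.of_forall fun ξ => sq_nonneg _)

lemma lo_hi {R : ℝ} {w : Fin 3 → V → ℂ} (hw : ∀ m, MemLp (w m) 2 volume) :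
    ∑ m, ∫ ξ, ‖w m ξ‖ ^ 2 = (∑ m, ∫ ξ in {ξ : V | ‖ξ‖ < R}, ‖w m ξ‖ ^ 2) + hiS R w := by
  rw [hiS, ← Finset.sum_add_distrib]
  refine Finset.sum_congr rfl fun m _ => ?_
  rw [← integral_add_compl (meas_ballset R) (sq_int (hw m))]
  have h : {ξ : V | ‖ξ‖ < R}ᶜ = {ξ : V | R ≤ ‖ξ‖} := by ext ξ; simp
  rw [h]; rfl

lemma frSq_ae {u : V → V} {w : Fin 3 → V → ℂ} (hw : ∀ m, IsFourierPair (comp u m) (w m)) :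
    ∀ᵐ ξ : V, frSq u ξ = ENNReal.ofReal (∑ m, ‖w m ξ‖ ^ 2) := by
  have h : ∀ᵐ ξ : V, ∀ m, w m ξ = FT (comp u m) ξ :=
    ae_all_iff.2 fun m => pair_unique_right (hw m) (FT_spec (hw m).1)
  filter_upwards [h] with ξ h1
  rw [frSq, ENNReal.ofReal_sum_of_nonneg fun m _ => sq_nonneg _]
  refine Finset.sum_congr rfl fun m _ => ?_
  rw [h1, ENNReal.ofReal_pow (norm_nonneg _), ofReal_norm]; rfl

lemma eLp_eq {u : V → V} (hu : MemLp u 2 volume) {w : Fin 3 → V → ℂ} (hw : ∀ m, IsFourierPair (comp u m) (w m)) :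
    eLpNorm u 2 volume ^ 2 = ENNReal.ofReal (∑ m, ∫ ξ, ‖w m ξ‖ ^ 2) := by
  have h1 : Integrable (fun x => ‖u x‖ ^ 2) := hu.integrable_norm_pow (by norm_num)
  rw [eLpNorm_two_sq]
  have h2 : ∫⁻ x, ‖u x‖ₑ ^ 2 = ENNReal.ofReal (∫ x, ‖u x‖ ^ 2) := by
    rw [ofReal_integral_eq_lintegral_ofReal h1 (Eventually.of_forall fun x => by positivity)]
    congr 1; ext x
    rw [← ofReal_norm, ENNReal.ofReal_pow (norm_nonneg _)]
  rw [h2]; congr 1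
  simp only [← plancherel_int (hw _)]
  rw [← integral_finsetSum _ fun m _ => sq_int (hw m).1]
  congr 1; ext x
  rw [EuclideanSpace.norm_sq_eq]
  simp [comp]

lemma grad_lower {u : V → V} {w : Fin 3 → V → ℂ} (hw : ∀ m, IsFourierPair (comp u m) (w m)) {R : ℝ} (hR : 0 ≤ R) :
    ENNReal.ofReal (4 * π ^ 2 * (Glo R w + R ^ 2 * hiS R w)) ≤ gradSq4π u := by
  have hw2 := fun m => sq_int (hw m).2.1
  have i1 : ∀ m, Integrable ({ξ : V | ‖ξ‖ < R}.indicator (fun ξ => ‖ξ‖ ^ 2 * ‖w m ξ‖ ^ 2)) := by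
    intro m
    have h1 : AEStronglyMeasurable (fun ξ => ‖ξ‖ ^ 2 * ‖w m ξ‖ ^ 2) volume :=
      (by fun_prop : Continuous (fun ξ : V => ‖ξ‖ ^ 2)).aestronglyMeasurable.mul (hw2 m).1
    refine Integrable.mono' ((hw2 m).const_mul (R ^ 2)) (h1.indicator (meas_ballset R)) (Eventually.of_forall fun ξ => ?_)
    by_cases h : ξ ∈ {ξ : V | ‖ξ‖ < R}
    · rw [Set.indicator_of_mem h, Real.norm_of_nonneg (by positivity)]
      have h2 : ‖ξ‖ ≤ R := le_of_lt h
      gcongr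
    · rw [Set.indicator_of_notMem h]; simp; positivity
  have i2 : ∀ m, Integrable ({ξ : V | R ≤ ‖ξ‖}.indicator (fun ξ => ‖w m ξ‖ ^ 2)) := fun m =>
    (hw2 m).indicator (meas_hiset R)
  have e : 4 * π ^ 2 * (Glo R w + R ^ 2 * hiS R w) = ∫ ξ, 4 * π ^ 2 *
      (∑ m, ({ξ : V | ‖ξ‖ < R}.indicator (fun ξ => ‖ξ‖ ^ 2 * ‖w m ξ‖ ^ 2) ξ
        + R ^ 2 * {ξ : V | R ≤ ‖ξ‖}.indicator (fun ξ => ‖w m ξ‖ ^ 2) ξ)) := by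
    have i3 : ∀ m, Integrable (fun ξ => {ξ : V | ‖ξ‖ < R}.indicator (fun ξ => ‖ξ‖ ^ 2 * ‖w m ξ‖ ^ 2) ξ
        + R ^ 2 * {ξ : V | R ≤ ‖ξ‖}.indicator (fun ξ => ‖w m ξ‖ ^ 2) ξ) := fun m => (i1 m).add ((i2 m).const_mul _)
    rw [integral_const_mul, integral_finsetSum _ fun m _ => i3 m]
    congr 1
    rw [Glo, hiS, Finset.mul_sum, ← Finset.sum_add_distrib]
    refine Finset.sum_congr rfl fun m _ => ?_
    rw [integral_add (i1 m) ((i2 m).const_mul _), integral_const_mul, integral_indicator (meas_ballset R),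
      integral_indicator (meas_hiset R)]
    rfl
  rw [e, ofReal_integral_eq_lintegral_ofReal]
  · refine lintegral_mono_ae ?_
    filter_upwards [frSq_ae hw] with ξ h1
    rw [h1, ← ENNReal.ofReal_coe_nnreal, ← ENNReal.ofReal_pow (by positivity), ← ENNReal.ofReal_mul (by positivity),
      ← ENNReal.ofReal_mul (by positivity)]
    apply ENNReal.ofReal_le_ofReal
    rw [coe_nnnorm, mul_assoc (4 * π ^ 2), Finset.mul_sum (a := ‖ξ‖ ^ 2)]
    refine mul_le_mul_of_nonneg_left (Finset.sum_le_sum fun m _ => ?_) (by positivity)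
    by_cases h : ‖ξ‖ < R
    · rw [Set.indicator_of_mem (by exact h), Set.indicator_of_notMem (by simpa using h)]; simp
    · rw [Set.indicator_of_notMem (by exact h), Set.indicator_of_mem (by exact not_lt.1 h), zero_add]
      have := not_lt.1 h
      gcongr
  · exact (integrable_finsetSum _ fun m _ => (i1 m).add ((i2 m).const_mul _)).const_mul _
  · refine Eventually.of_forall fun ξ => mul_nonneg (by positivity) (Finset.sum_nonneg fun m _ => add_nonneg ?_
      (mul_nonneg (by positivity) ?_))
    · exact Set.indicator_nonneg (fun _ _ => by positivity) _
    · exact Set.indicator_nonneg (fun _ _ => by positivity) _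

lemma Sol.hiS_meas (hs : Sol ν u₀ u K) (R : ℝ) : StronglyMeasurable (fun t => hiS R (wv u t)) := by
  unfold hiS hiA
  refine Finset.stronglyMeasurable_fun_sum _ fun m _ => ?_
  have : StronglyMeasurable (fun q : ℝ × V => ‖wv u q.1 m q.2‖ ^ 2) := (wv_meas hs.meas m).norm.pow 2
  exact this.integral_prod_right'

lemma Sol.hiS_bound (hs : Sol ν u₀ u K) (R t : ℝ) : hiS R (wv u t) ≤ 3 * max K 0 := by
  refine (hiS_le fun m => (hs.pair t m).2.1).trans ?_
  refine (Finset.sum_le_sum fun m _ => hs.w_bound t m).trans ?_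
  simp

lemma Sol.hiS_int (hs : Sol ν u₀ u K) (R T : ℝ) :
    Integrable (fun t => hiS R (wv u t)) (volume.restrict (Set.Ioc 0 T)) :=
  Integrable.of_bound (C := 3 * max K 0) (hs.hiS_meas R).aestronglyMeasurable (Eventually.of_forall fun t => by
    rw [Real.norm_of_nonneg (hiS_nonneg _ _)]; exact hs.hiS_bound R t)

lemma Sol.energy_high (hs : Sol ν u₀ u K) (hν : 0 < ν)
    (hE : ∀ᵐ t ∂(volume.restrict (Set.Ioi (0:ℝ))),
      (1/2 : ℝ≥0∞) * eLpNorm (u t) 2 volume ^ 2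
          + ENNReal.ofReal ν * ∫⁻ τ in Set.Ioc (0:ℝ) t, gradSq4π (u τ)
        ≤ (1/2 : ℝ≥0∞) * eLpNorm u₀ 2 volume ^ 2) {R : ℝ} (hR : 0 ≤ R) : ∀ᵐ t : ℝ, 0 < t →
    (1 / 2) * hiS R (wv u t) + 4 * π ^ 2 * ν * R ^ 2 * (∫ s in Set.Ioc 0 t, hiS R (wv u s))
      ≤ (1 / 2) * hiS R (fun m => FT (comp u₀ m)) + ∫ s in Set.Ioc 0 t, |TT R (fun i => comp (u s) i) (wv u s)| := by
  rw [ae_restrict_iff' measurableSet_Ioi] at hE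
  filter_upwards [hE, hs.energy_low R] with t h1 h2 ht
  have h1 := h1 ht
  have h2 := h2 ht
  have p0 : ∀ m, IsFourierPair (comp u₀ m) (FT (comp u₀ m)) := fun m => FT_spec (comp_mem hs.u0mem m)
  rw [eLp_eq (hs.mem t) (hs.pair t), eLp_eq hs.u0mem p0] at h1
  have hi : Integrable (fun s => 4 * π ^ 2 * (Glo R (wv u s) + R ^ 2 * hiS R (wv u s))) (volume.restrict (Set.Ioc 0 t)) :=
    ((hs.int_Glo R t).add ((hs.hiS_int R t).const_mul _)).const_mul _
  have hG : ∀ s, 0 ≤ Glo R (wv u s) := fun s => Finset.sum_nonneg fun m _ =>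
    setIntegral_nonneg (meas_ballset R) fun ξ _ => by positivity
  have hn : ∀ s, 0 ≤ 4 * π ^ 2 * (Glo R (wv u s) + R ^ 2 * hiS R (wv u s)) := fun s =>
    mul_nonneg (by positivity) (add_nonneg (hG s) (mul_nonneg (by positivity) (hiS_nonneg _ _)))
  have h3 : ENNReal.ofReal (∫ s in Set.Ioc 0 t, 4 * π ^ 2 * (Glo R (wv u s) + R ^ 2 * hiS R (wv u s)))
      ≤ ∫⁻ τ in Set.Ioc (0:ℝ) t, gradSq4π (u τ) := by
    rw [ofReal_integral_eq_lintegral_ofReal hi (Eventually.of_forall hn)]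
    exact lintegral_mono fun s => grad_lower (hs.pair s) hR
  have half : (1 / 2 : ℝ≥0∞) = ENNReal.ofReal (1 / 2) := by
    rw [ENNReal.ofReal_div_of_pos (by norm_num)]; simp
  have hs0 : ∀ w : Fin 3 → V → ℂ, 0 ≤ ∑ m, ∫ ξ, ‖w m ξ‖ ^ 2 := fun w =>
    Finset.sum_nonneg fun m _ => integral_nonneg fun ξ => by positivity
  have h4 := (add_le_add_right (mul_le_mul_right h3 (ENNReal.ofReal ν)) _).trans h1
  rw [half, ← ENNReal.ofReal_mul (by norm_num), ← ENNReal.ofReal_mul hν.le, ← ENNReal.ofReal_mul (by norm_num),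
    ← ENNReal.ofReal_add (mul_nonneg (by norm_num) (hs0 _)) (mul_nonneg hν.le (integral_nonneg hn)),
    ENNReal.ofReal_le_ofReal_iff (mul_nonneg (by norm_num) (hs0 _)), integral_const_mul,
    integral_add (hs.int_Glo R t) ((hs.hiS_int R t).const_mul _), integral_const_mul,
    lo_hi (R := R) fun m => (hs.pair t m).2.1, lo_hi (R := R) fun m => (p0 m).2.1] at h4
  have h5 : -(∫ s in Set.Ioc 0 t, TT R (fun i => comp (u s) i) (wv u s)) ≤
      ∫ s in Set.Ioc 0 t, |TT R (fun i => comp (u s) i) (wv u s)| := by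
    rw [← integral_neg]
    exact integral_mono (hs.int_TT R t).neg (hs.int_TT R t).abs fun s => neg_le_abs _
  linarith

end sol

lemma gron {T κ M : ℝ} (hκ : 0 ≤ κ) (hM : 0 ≤ M) {β : ℝ → ℝ} (hβ0 : ∀ t, 0 ≤ β t)
    (hβ : Integrable β (volume.restrict (Set.Ioc 0 T))) : ∃ D : ℝ, 0 ≤ D ∧ ∀ (Y : ℝ → ℝ) (B : ℝ),
    (∀ t, 0 ≤ Y t) → (∀ t, Y t ≤ B) → AEStronglyMeasurable Y (volume.restrict (Set.Ioc 0 T)) →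
    (∀ᵐ t, t ∈ Set.Ioc 0 T → Y t ≤ M + κ * ∫ s in Set.Ioc 0 t, β s * Y s) →
    ∀ᵐ t, t ∈ Set.Ioc 0 T → Y t ≤ D := by
  have hlim : Tendsto (fun n : ℕ => ∫ s in Set.Ioc 0 T, (β s - min (β s) n)) atTop (𝓝 (∫ s in Set.Ioc 0 T, (0:ℝ))) := by
    refine tendsto_integral_of_dominated_convergence β (fun n => ?_) hβ (fun n => Eventually.of_forall fun s => ?_)
      (Eventually.of_forall fun s => ?_)
    · exact hβ.1.sub (hβ.1.inf aestronglyMeasurable_const)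
    · have h1 : min (β s) n ≤ β s := min_le_left _ _
      have h2 : 0 ≤ min (β s) n := le_min (hβ0 s) (by positivity)
      rw [Real.norm_of_nonneg (by linarith)]; linarith
    · refine tendsto_const_nhds.congr' ?_
      obtain ⟨n, hn⟩ := exists_nat_ge (β s)
      filter_upwards [eventually_ge_atTop n] with m hm
      have : (n:ℝ) ≤ m := by exact_mod_cast hm
      rw [min_eq_left (hn.trans this), sub_self]
  rw [integral_zero] at hlim
  have hlim2 := hlim.const_mul κ
  rw [mul_zero] at hlim2
  obtain ⟨n, hn⟩ := (hlim2.eventually (gt_mem_nhds (by norm_num : (0:ℝ) < 1/4))).exists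
  obtain ⟨L, hL0, hn⟩ : ∃ L : ℝ, 0 ≤ L ∧ κ * ∫ s in Set.Ioc 0 T, (β s - min (β s) L) < 1 / 4 := ⟨(n:ℝ), by positivity, hn⟩
  set φ : ℝ → ℝ := fun s => β s - min (β s) L with hφ
  have hφ0 : ∀ s, 0 ≤ φ s := fun s => sub_nonneg.2 (min_le_left _ _)
  have hφβ : ∀ s, β s ≤ φ s + L := fun s => by
    have := min_le_right (β s) L
    simp only [hφ]; linarith
  have hφi : Integrable φ (volume.restrict (Set.Ioc 0 T)) := by
    refine Integrable.mono' hβ (hβ.1.sub (hβ.1.inf aestronglyMeasurable_const)) (Eventually.of_forall fun s => ?_)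
    rw [Real.norm_of_nonneg (hφ0 s)]
    have h2 : 0 ≤ min (β s) L := le_min (hβ0 s) hL0
    simp only [hφ]; linarith
  set lam : ℝ := 4 * κ * L + 1 with hlam
  have hl0 : 0 < lam := by positivity
  have hκL : κ * L / lam ≤ 1 / 4 := by
    rw [div_le_iff₀ hl0]; nlinarith [mul_nonneg hκ hL0]
  refine ⟨2 * M * Real.exp (lam * T), by positivity, fun Y B hY0 hYB hYm h => ?_⟩
  have hB : 0 ≤ B := (hY0 0).trans (hYB 0)
  have step : ∀ X : ℝ, 0 ≤ X → (∀ᵐ t, t ∈ Set.Ioc 0 T → Y t ≤ X * Real.exp (lam * t)) →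
      ∀ᵐ t, t ∈ Set.Ioc 0 T → Y t ≤ (M + X / 2) * Real.exp (lam * t) := by
    intro X hX hYX
    filter_upwards [h] with t h1 ht
    have h1 := h1 ht
    have hsub : Set.Ioc 0 t ⊆ Set.Ioc 0 T := Set.Ioc_subset_Ioc_right ht.2
    have hexp : IntegrableOn (fun s => Real.exp (lam * s)) (Set.Ioc 0 t) :=
      (Continuous.integrableOn_Icc (by fun_prop)).mono_set Set.Ioc_subset_Icc_self
    have hexpi : ∫ s in Set.Ioc 0 t, Real.exp (lam * s) ≤ Real.exp (lam * t) / lam := by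
      rw [← intervalIntegral.integral_of_le ht.1.le, intervalIntegral.integral_comp_mul_left (fun x => Real.exp x) hl0.ne',
        integral_exp, smul_eq_mul, div_eq_inv_mul]
      gcongr
      simp [Real.exp_pos (0:ℝ) |>.le]
    have hφt : ∫ s in Set.Ioc 0 t, φ s ≤ ∫ s in Set.Ioc 0 T, φ s :=
      setIntegral_mono_set hφi (Eventually.of_forall hφ0) (Eventually.of_forall hsub)
    have i1 : Integrable (fun s => X * Real.exp (lam * t) * φ s) (volume.restrict (Set.Ioc 0 t)) :=
      (IntegrableOn.mono_set hφi hsub).const_mul _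
    have i2 : Integrable (fun s => L * X * Real.exp (lam * s)) (volume.restrict (Set.Ioc 0 t)) :=
      hexp.const_mul _
    have h2 : ∫ s in Set.Ioc 0 t, β s * Y s ≤ ∫ s in Set.Ioc 0 t, (X * Real.exp (lam * t) * φ s + L * X * Real.exp (lam * s)) := by
      refine integral_mono_of_nonneg (Eventually.of_forall fun s => mul_nonneg (hβ0 s) (hY0 s)) (i1.add i2) ?_
      rw [EventuallyLE, ae_restrict_iff' measurableSet_Ioc]
      filter_upwards [hYX] with s h3 hs
      have h3 := h3 (hsub hs)
      have h4 : Real.exp (lam * s) ≤ Real.exp (lam * t) := Real.exp_le_exp.2 (mul_le_mul_of_nonneg_left hs.2 hl0.le)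
      calc β s * Y s ≤ (φ s + L) * (X * Real.exp (lam * s)) :=
            mul_le_mul (hφβ s) h3 (hY0 s) (add_nonneg (hφ0 s) hL0)
        _ = φ s * (X * Real.exp (lam * s)) + L * X * Real.exp (lam * s) := by ring
        _ ≤ φ s * (X * Real.exp (lam * t)) + L * X * Real.exp (lam * s) := by
            gcongr; exact hφ0 s
        _ = _ := by ring
    rw [integral_add i1 i2, integral_const_mul, integral_const_mul] at h2
    have hn' : κ * ∫ s in Set.Ioc 0 t, φ s ≤ 1 / 4 := (mul_le_mul_of_nonneg_left hφt hκ).trans hn.le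
    have e1 : 1 ≤ Real.exp (lam * t) := Real.one_le_exp (mul_nonneg hl0.le ht.1.le)
    have hXe : 0 ≤ X * Real.exp (lam * t) := by positivity
    have h5 : κ * (∫ s in Set.Ioc 0 t, β s * Y s) ≤ X * Real.exp (lam * t) * (1 / 4) + X * Real.exp (lam * t) * (1 / 4) := by
      refine (mul_le_mul_of_nonneg_left h2 hκ).trans ?_
      rw [mul_add]
      refine add_le_add ?_ ?_
      · calc _ = X * Real.exp (lam * t) * (κ * ∫ s in Set.Ioc 0 t, φ s) := by ring
          _ ≤ _ := mul_le_mul_of_nonneg_left hn' hXe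
      · calc _ ≤ κ * (L * X * (Real.exp (lam * t) / lam)) := by gcongr
          _ = X * Real.exp (lam * t) * (κ * L / lam) := by ring
          _ ≤ _ := mul_le_mul_of_nonneg_left hκL hXe
    nlinarith
  have all : ∀ n : ℕ, ∀ᵐ t, t ∈ Set.Ioc 0 T → Y t ≤ (2 * M + B / 2 ^ n) * Real.exp (lam * t) := by
    intro n
    induction n with
    | zero =>
      refine Eventually.of_forall fun t ht => (hYB t).trans ?_
      have e1 : 1 ≤ Real.exp (lam * t) := Real.one_le_exp (mul_nonneg hl0.le ht.1.le)
      rw [pow_zero, div_one]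
      nlinarith
    | succ n ih =>
      have := step _ (by positivity) ih
      filter_upwards [this] with t h1 ht
      refine (h1 ht).trans (le_of_eq ?_)
      rw [pow_succ]; field_simp; ring
  filter_upwards [ae_all_iff.2 all] with t h1 ht
  have hl : Tendsto (fun n : ℕ => (2 * M + B * (1 / 2) ^ n) * Real.exp (lam * t)) atTop (𝓝 ((2 * M + B * 0) * Real.exp (lam * t))) :=
    ((tendsto_const_nhds.add ((tendsto_pow_atTop_nhds_zero_of_lt_one (by norm_num) (by norm_num)).const_mul B)).mul_const _)
  have h2 := ge_of_tendsto' hl fun n => by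
    have := h1 n ht
    rw [one_div, inv_pow, ← div_eq_mul_inv]; exact this
  refine h2.trans ?_
  have : Real.exp (lam * t) ≤ Real.exp (lam * T) := Real.exp_le_exp.2 (mul_le_mul_of_nonneg_left ht.2 hl0.le)
  rw [mul_zero, add_zero]
  gcongr

lemma young4 {σ : ℝ} (h1 : -1 < σ) (h2 : σ < 0) {δ E : ℝ} (hδ : 0 < δ) (hE : 0 ≤ E) : ∃ C' : ℝ, 0 ≤ C' ∧
    ∀ (j : ℕ) (b : ℝ), 0 ≤ b → E * ((2 * 2 ^ (-σ) : ℝ) ^ j * b) ≤ δ * 4 ^ j + C' * b ^ ((2:ℝ) / (1 + σ)) := by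
  set θ : ℝ := (1 - σ) / 2 with hθ
  have hθ0 : 0 < θ := by rw [hθ]; linarith
  have hθ1 : 0 < 1 - θ := by rw [hθ]; linarith
  have hp : (2:ℝ) / (1 + σ) = (1 - θ)⁻¹ := by
    have : (1:ℝ) + σ ≠ 0 := by linarith
    have h3 : (1:ℝ) - θ = (1 + σ) / 2 := by rw [hθ]; ring
    rw [h3, inv_div]
  set F : ℝ := E / δ ^ θ with hF
  have hF0 : 0 ≤ F := by positivity
  refine ⟨(1 - θ) * F ^ (1 - θ)⁻¹, by positivity, fun j b hb => ?_⟩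
  have key := Real.geom_mean_le_arith_mean2_weighted hθ0.le hθ1.le (p₁ := δ * 4 ^ j) (p₂ := (F * b) ^ (1 - θ)⁻¹)
    (by positivity) (by positivity) (by ring)
  rw [← Real.rpow_mul (by positivity), inv_mul_cancel₀ hθ1.ne', Real.rpow_one, Real.mul_rpow hδ.le (by positivity),
    Real.mul_rpow hF0 hb] at key
  have hq : ((4:ℝ) ^ j) ^ θ = (2 * 2 ^ (-σ) : ℝ) ^ j := by
    rw [← Real.rpow_natCast_mul (by norm_num), mul_comm, Real.rpow_mul_natCast (by norm_num)]
    congr 1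
    have e4 : (4:ℝ) = 2 ^ (2:ℝ) := by norm_num
    rw [e4, ← Real.rpow_mul (by norm_num)]
    have : (2:ℝ) * 2 ^ (-σ) = 2 ^ (1 + -σ) := by rw [Real.rpow_add (by norm_num), Real.rpow_one]
    rw [this]; congr 1; rw [hθ]; ring
  rw [hq] at key
  have hFE : δ ^ θ * F = E := by rw [hF]; field_simp
  calc E * ((2 * 2 ^ (-σ) : ℝ) ^ j * b) = δ ^ θ * (2 * 2 ^ (-σ) : ℝ) ^ j * (F * b) := by rw [← hFE]; ring
    _ ≤ _ := key
    _ ≤ _ := by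
      rw [hp, mul_assoc (1 - θ)]
      refine add_le_add ?_ le_rfl
      have : 0 ≤ δ * 4 ^ j := by positivity
      nlinarith

lemma freq_lt {T : ℝ} (hT : 0 < T) {P : ℝ → Prop} (h : ∀ᵐ t, t ∈ Set.Ioc 0 T → P t) : ∃ᶠ t in 𝓝[Set.Icc 0 T] T, P t := by
  intro hc
  have hc' : ∀ᶠ t in 𝓝[<] T, ¬ P t := by
    have := nhdsWithin_le_of_mem (s := Set.Icc 0 T) (t := Set.Iio T) (a := T) ?_
    · exact this hc
    · filter_upwards [Ioo_mem_nhdsLT hT] with x hx using ⟨hx.1.le, hx.2.le⟩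
  obtain ⟨l, hl, hl2⟩ := (mem_nhdsLT_iff_exists_Ioo_subset).1 hc'
  have hz : volume (Set.Ioo (max l 0) T) = 0 := by
    refine measure_mono_null (fun t ht => ?_) (ae_iff.1 h)
    have h1 := hl2 ⟨(le_max_left _ _).trans_lt ht.1, ht.2⟩
    simp only [Set.mem_ofPred_eq] at h1 ⊢
    exact fun hh => h1 (hh ⟨(le_max_right _ _).trans_lt ht.1, ht.2.le⟩)
  rw [Real.volume_Ioo, ENNReal.ofReal_eq_zero] at hz
  have : max l 0 < T := max_lt hl hT
  linarith

lemma abstr {T c C A α σ : ℝ} (hT : 0 < T) (hc : 0 < c) (hC : 0 ≤ C) (hA : 0 ≤ A) (h1 : -1 < σ) (h2 : σ < 0)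
    {a : ℕ → ℝ → ℝ} {b : ℝ → ℝ} {αk : ℕ → ℝ} (ha0 : ∀ k t, 0 ≤ a k t) (haA : ∀ k t, a k t ≤ A)
    (ham : ∀ k, StronglyMeasurable (a k)) (hb0 : ∀ t, 0 ≤ b t)
    (hbi : Integrable b (volume.restrict (Set.Ioc 0 T)))
    (hbp : Integrable (fun t => b t ^ ((2:ℝ) / (1 + σ))) (volume.restrict (Set.Ioc 0 T)))
    (hα0 : ∀ k, 0 ≤ αk k)
    (hα : ∀ N, ∑ k ∈ Finset.range N, 4 ^ k * αk k ≤ α)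
    (hz : ∀ᵐ t, t ∈ Set.Ioc 0 T → (1 / 2) * a 0 t + c * (∫ s in Set.Ioc 0 t, a 0 s)
      ≤ (1 / 2) * αk 0 + C * A * ∫ s in Set.Ioc 0 t, b s)
    (hs : ∀ j : ℕ, ∀ᵐ t, t ∈ Set.Ioc 0 T → (1 / 2) * a (j + 1) t + c * 4 ^ (j + 1) * (∫ s in Set.Ioc 0 t, a (j + 1) s)
      ≤ (1 / 2) * αk (j + 1) + C * (2 * 2 ^ (-σ) : ℝ) ^ (j + 1) * ∫ s in Set.Ioc 0 t, b s * a j s) :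
    ∃ D : ℝ, ∀ N : ℕ, (∀ᵐ t, t ∈ Set.Ioc 0 T → ∑ k ∈ Finset.range N, 4 ^ k * a k t ≤ D) ∧
      ∑ k ∈ Finset.range N, 16 ^ k * (∫ s in Set.Ioc 0 T, a k s) ≤ D := by
  set q : ℝ := 2 * 2 ^ (-σ) with hq
  have hq0 : 0 < q := by positivity
  obtain ⟨C', hC', hY⟩ := young4 h1 h2 (δ := c / 2) (E := 4 * C * q) (by positivity) (by positivity)
  rw [← hq] at hY
  set β : ℝ → ℝ := fun t => b t ^ ((2:ℝ) / (1 + σ)) with hβ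
  have hβ0 : ∀ t, 0 ≤ β t := fun t => Real.rpow_nonneg (hb0 t) _
  have hα00 : 0 ≤ α := by simpa using hα 0
  set Ib : ℝ := ∫ s in Set.Ioc 0 T, b s with hIb
  have hIb0 : 0 ≤ Ib := integral_nonneg hb0
  set M : ℝ := α + 2 * (C * A * Ib) with hM
  have hM0 : 0 ≤ M := by positivity
  obtain ⟨D, hD0, hD⟩ := gron (T := T) (κ := 2 * C') (M := M) (by positivity) hM0 hβ0 hbp
  have hai : ∀ k, ∀ t, IntegrableOn (a k) (Set.Ioc 0 t) := fun k t =>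
    Integrable.of_bound (C := A) (ham k).aestronglyMeasurable (Eventually.of_forall fun s => by
      rw [Real.norm_of_nonneg (ha0 k s)]; exact haA k s)
  have hbai : ∀ k, IntegrableOn (fun s => b s * a k s) (Set.Ioc 0 T) := fun k =>
    Integrable.mul_bdd (c := A) hbi (ham k).aestronglyMeasurable (Eventually.of_forall fun s => by
      rw [Real.norm_of_nonneg (ha0 k s)]; exact haA k s)
  have hβai : ∀ k, IntegrableOn (fun s => β s * a k s) (Set.Ioc 0 T) := fun k =>
    Integrable.mul_bdd (c := A) hbp (ham k).aestronglyMeasurable (Eventually.of_forall fun s => by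
      rw [Real.norm_of_nonneg (ha0 k s)]; exact haA k s)
  -- main inequality
  have main : ∀ N : ℕ, ∀ᵐ t, t ∈ Set.Ioc 0 T → (∑ k ∈ Finset.range (N + 1), 4 ^ k * a k t)
      + c * (∑ k ∈ Finset.range (N + 1), 16 ^ k * ∫ s in Set.Ioc 0 t, a k s)
      ≤ M + 2 * C' * ∫ s in Set.Ioc 0 t, β s * (∑ k ∈ Finset.range (N + 1), 4 ^ k * a k s) := by
    intro N
    filter_upwards [hz, ae_all_iff.2 hs] with t hz hs ht
    have hsub : Set.Ioc 0 t ⊆ Set.Ioc 0 T := Set.Ioc_subset_Ioc_right ht.2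
    have hz := hz ht
    have hb1 : ∫ s in Set.Ioc 0 t, b s ≤ Ib :=
      setIntegral_mono_set hbi (Eventually.of_forall hb0) (Eventually.of_forall hsub)
    have hz2 : C * A * ∫ s in Set.Ioc 0 t, b s ≤ C * A * Ib := by gcongr
    have hY2 : ∀ j, 4 ^ (j + 1) * (C * q ^ (j + 1) * ∫ s in Set.Ioc 0 t, b s * a j s)
        ≤ c / 2 * (16 ^ j * ∫ s in Set.Ioc 0 t, a j s) + C' * (∫ s in Set.Ioc 0 t, β s * (4 ^ j * a j s)) := by
      intro j
      have i1 : IntegrableOn (fun s => c / 2 * 16 ^ j * a j s) (Set.Ioc 0 t) := (hai j t).const_mul _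
      have i2 : IntegrableOn (fun s => C' * 4 ^ j * (β s * a j s)) (Set.Ioc 0 t) := ((hβai j).mono_set hsub).const_mul _
      have i3 : IntegrableOn (fun s => 4 ^ (j + 1) * (C * q ^ (j + 1)) * (b s * a j s)) (Set.Ioc 0 t) := ((hbai j).mono_set hsub).const_mul _
      calc _ = ∫ s in Set.Ioc 0 t, 4 ^ (j + 1) * (C * q ^ (j + 1)) * (b s * a j s) := by
            rw [integral_const_mul]; ring
        _ ≤ ∫ s in Set.Ioc 0 t, (c / 2 * 16 ^ j * a j s + C' * 4 ^ j * (β s * a j s)) := by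
            refine integral_mono i3 (i1.add i2) fun s => ?_
            have h3 := mul_le_mul_of_nonneg_right (hY j (b s) (hb0 s)) (mul_nonneg (by positivity : (0:ℝ) ≤ 4 ^ j) (ha0 j s))
            have e16 : (16:ℝ) ^ j = 4 ^ j * 4 ^ j := by rw [← mul_pow]; norm_num
            calc 4 ^ (j + 1) * (C * q ^ (j + 1)) * (b s * a j s) = 4 * C * q * (q ^ j * b s) * (4 ^ j * a j s) := by ring
              _ ≤ _ := h3
              _ = c / 2 * 16 ^ j * a j s + C' * 4 ^ j * (β s * a j s) := by rw [e16]; ring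
        _ = _ := by
            rw [integral_add i1 i2, integral_const_mul, integral_const_mul]
            have : ∀ s, β s * (4 ^ j * a j s) = 4 ^ j * (β s * a j s) := fun s => by ring
            simp only [this]
            rw [integral_const_mul]; ring
    -- sum up
    have hsum : ∑ j ∈ Finset.range N, (4 ^ (j + 1) * ((1 / 2) * a (j + 1) t + c * 4 ^ (j + 1) * (∫ s in Set.Ioc 0 t, a (j + 1) s)))
        ≤ ∑ j ∈ Finset.range N, (4 ^ (j + 1) * ((1 / 2) * αk (j + 1)) +
          (c / 2 * (16 ^ j * ∫ s in Set.Ioc 0 t, a j s) + C' * (∫ s in Set.Ioc 0 t, β s * (4 ^ j * a j s)))) := by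
      refine Finset.sum_le_sum fun j _ => ?_
      have h4 := mul_le_mul_of_nonneg_left (hs j ht) (by positivity : (0:ℝ) ≤ 4 ^ (j + 1))
      rw [mul_add (4 ^ (j + 1)) ((1 / 2) * αk (j + 1))] at h4
      exact h4.trans (add_le_add le_rfl (hY2 j))
    have hint : ∫ s in Set.Ioc 0 t, β s * (∑ k ∈ Finset.range (N + 1), 4 ^ k * a k s)
        = ∑ k ∈ Finset.range (N + 1), ∫ s in Set.Ioc 0 t, β s * (4 ^ k * a k s) := by
      simp only [Finset.mul_sum]
      refine integral_finsetSum _ fun k _ => ?_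
      refine Integrable.congr (((hβai k).mono_set hsub).const_mul (4 ^ k)) (Eventually.of_forall fun s => ?_)
      simp only; ring
    have hαN := hα (N + 1)
    rw [Finset.sum_range_succ'] at hαN
    rw [hint]
    have p1 : 0 ≤ ∫ s in Set.Ioc 0 t, β s * (4 ^ N * a N s) :=
      integral_nonneg fun s => mul_nonneg (hβ0 s) (mul_nonneg (by positivity) (ha0 N s))
    have p2 : 0 ≤ ∫ s in Set.Ioc 0 t, a N s := integral_nonneg (ha0 N)
    rw [Finset.sum_range_succ (fun k => ∫ s in Set.Ioc 0 t, β s * (4 ^ k * a k s)), Finset.sum_range_succ' (fun k => 4 ^ k * a k t)]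
    have e1 : ∀ j, 4 ^ (j + 1) * ((1 / 2) * a (j + 1) t + c * 4 ^ (j + 1) * (∫ s in Set.Ioc 0 t, a (j + 1) s))
        = (1 / 2) * (4 ^ (j + 1) * a (j + 1) t) + c * (16 ^ (j + 1) * (∫ s in Set.Ioc 0 t, a (j + 1) s)) := fun j => by
      have e16 : (16:ℝ) ^ (j + 1) = 4 ^ (j + 1) * 4 ^ (j + 1) := by rw [← mul_pow]; norm_num
      rw [e16]; ring
    have e2 : ∀ j, (4:ℝ) ^ (j + 1) * ((1 / 2) * αk (j + 1)) = (1 / 2) * (4 ^ (j + 1) * αk (j + 1)) := fun j => by ring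
    simp only [e1, e2, Finset.sum_add_distrib, ← Finset.mul_sum] at hsum
    have s1 := Finset.sum_range_succ (fun k => 16 ^ k * ∫ s in Set.Ioc 0 t, a k s) N
    have s2 := Finset.sum_range_succ' (fun k => 16 ^ k * ∫ s in Set.Ioc 0 t, a k s) N
    have p3 : 0 ≤ 16 ^ N * ∫ s in Set.Ioc 0 t, a N s := by positivity
    set S1 := ∑ k ∈ Finset.range (N + 1), 16 ^ k * ∫ s in Set.Ioc 0 t, a k s
    simp only [pow_zero, one_mul] at s2 hαN ⊢
    have p4 := mul_nonneg hc.le p3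
    have p5 := mul_nonneg hC' p1
    have s1' : c * S1 = c * (∑ k ∈ Finset.range N, 16 ^ k * ∫ s in Set.Ioc 0 t, a k s) + c * (16 ^ N * ∫ s in Set.Ioc 0 t, a N s) := by
      rw [s1]; ring
    have s2' : c * S1 = c * (∑ k ∈ Finset.range N, 16 ^ (k + 1) * ∫ s in Set.Ioc 0 t, a (k + 1) s) + c * (∫ s in Set.Ioc 0 t, a 0 s) := by
      rw [s2]; ring
    have hMe : M = α + 2 * (C * A * Ib) := hM
    linarith
  have hYm : ∀ N, StronglyMeasurable (fun t => ∑ k ∈ Finset.range N, 4 ^ k * a k t) := fun N =>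
    Finset.stronglyMeasurable_fun_sum _ fun k _ => (ham k).const_mul _
  have hYb : ∀ N t, ∑ k ∈ Finset.range N, 4 ^ k * a k t ≤ ∑ k ∈ Finset.range N, 4 ^ k * A := fun N t =>
    Finset.sum_le_sum fun k _ => mul_le_mul_of_nonneg_left (haA k t) (by positivity)
  have hY0 : ∀ N t, 0 ≤ ∑ k ∈ Finset.range N, 4 ^ k * a k t := fun N t =>
    Finset.sum_nonneg fun k _ => mul_nonneg (by positivity) (ha0 k t)
  have hS0 : ∀ N t, 0 ≤ ∑ k ∈ Finset.range N, 16 ^ k * ∫ s in Set.Ioc 0 t, a k s := fun N t =>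
    Finset.sum_nonneg fun k _ => mul_nonneg (by positivity) (integral_nonneg (ha0 k))
  have hYD : ∀ N, ∀ᵐ t, t ∈ Set.Ioc 0 T → ∑ k ∈ Finset.range (N + 1), 4 ^ k * a k t ≤ D := fun N => by
    refine hD _ _ (hY0 _) (hYb _) (hYm _).aestronglyMeasurable ?_
    filter_upwards [main N] with t h3 ht
    have := mul_nonneg hc.le (hS0 (N + 1) t)
    linarith [h3 ht]
  set Iβ : ℝ := ∫ s in Set.Ioc 0 T, β s with hIβ
  have hIβ0 : 0 ≤ Iβ := integral_nonneg hβ0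
  set E : ℝ := (M + 2 * C' * (D * Iβ)) / c with hE
  have hE0 : 0 ≤ E := by positivity
  have hSE : ∀ N, ∑ k ∈ Finset.range (N + 1), 16 ^ k * (∫ s in Set.Ioc 0 T, a k s) ≤ E := by
    intro N
    have hcont : ContinuousOn (fun t => ∑ k ∈ Finset.range (N + 1), 16 ^ k * (∫ s in Set.Ioc 0 t, a k s)) (Set.Icc 0 T) := by
      refine continuousOn_finsetSum _ fun k _ => ContinuousOn.const_mul ?_ _
      refine intervalIntegral.continuousOn_primitive ?_
      rw [integrableOn_Icc_iff_integrableOn_Ioc]; exact hai k T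
    have hae : ∀ᵐ t, t ∈ Set.Ioc 0 T → ∑ k ∈ Finset.range (N + 1), 16 ^ k * (∫ s in Set.Ioc 0 t, a k s) ≤ E := by
      filter_upwards [main N] with t h3 ht
      have h3 := h3 ht
      have hsub : Set.Ioc 0 t ⊆ Set.Ioc 0 T := Set.Ioc_subset_Ioc_right ht.2
      have h4 : ∫ s in Set.Ioc 0 t, β s * (∑ k ∈ Finset.range (N + 1), 4 ^ k * a k s) ≤ D * Iβ := by
        calc _ ≤ ∫ s in Set.Ioc 0 t, D * β s := by
              refine integral_mono_of_nonneg (Eventually.of_forall fun s => mul_nonneg (hβ0 s) (hY0 _ s))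
                ((IntegrableOn.mono_set hbp hsub).const_mul _) ?_
              rw [EventuallyLE, ae_restrict_iff' measurableSet_Ioc]
              filter_upwards [hYD N] with s h5 hs
              rw [mul_comm]
              exact mul_le_mul_of_nonneg_right (h5 (hsub hs)) (hβ0 s)
          _ = D * ∫ s in Set.Ioc 0 t, β s := integral_const_mul _ _
          _ ≤ _ := mul_le_mul_of_nonneg_left (setIntegral_mono_set hbp (Eventually.of_forall hβ0) (Eventually.of_forall hsub)) hD0
      have h5 := mul_le_mul_of_nonneg_left h4 (by positivity : 0 ≤ 2 * C')
      rw [hE, le_div_iff₀ hc]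
      have := hY0 (N + 1) t
      linarith
    exact le_of_tendsto_of_frequently (hcont T ⟨hT.le, le_rfl⟩) (freq_lt hT hae)
  refine ⟨max D E, fun N => ⟨?_, ?_⟩⟩
  · filter_upwards [hYD N] with t h3 ht
    refine le_trans ?_ ((h3 ht).trans (le_max_left _ _))
    rw [Finset.sum_range_succ]
    have := mul_nonneg (by positivity : (0:ℝ) ≤ 4 ^ N) (ha0 N t)
    linarith
  · refine le_trans ?_ ((hSE N).trans (le_max_right _ _))
    rw [Finset.sum_range_succ]
    have := mul_nonneg (by positivity : (0:ℝ) ≤ 16 ^ N) (integral_nonneg (μ := volume.restrict (Set.Ioc 0 T)) (ha0 N))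
    linarith

lemma hiS_lint {w : Fin 3 → V → ℂ} (hw : ∀ m, MemLp (w m) 2 volume) (R : ℝ) :
    ∫⁻ ξ, {ξ : V | R ≤ ‖ξ‖}.indicator (fun ξ => ENNReal.ofReal (∑ m, ‖w m ξ‖ ^ 2)) ξ = ENNReal.ofReal (hiS R w) := by
  have hi : Integrable (fun ξ => ∑ m, ‖w m ξ‖ ^ 2) := integrable_finsetSum _ fun m _ => sq_int (hw m)
  rw [lintegral_indicator (meas_hiset R), ← ofReal_integral_eq_lintegral_ofReal hi.integrableOn
    (Eventually.of_forall fun ξ => Finset.sum_nonneg fun m _ => sq_nonneg _), integral_finsetSum _ fun m _ => (sq_int (hw m)).integrableOn]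
  rfl

lemma F_aem {w : Fin 3 → V → ℂ} (hw : ∀ m, MemLp (w m) 2 volume) :
    AEMeasurable (fun ξ : V => ENNReal.ofReal (∑ m, ‖w m ξ‖ ^ 2)) := by
  have hi : Integrable (fun ξ => ∑ m, ‖w m ξ‖ ^ 2) := integrable_finsetSum _ fun m _ => sq_int (hw m)
  exact hi.1.aemeasurable.ennreal_ofReal

lemma dyad_low (x : ℝ) (N : ℕ) : (∑ k ∈ Finset.range N, (if (2:ℝ) ^ k ≤ x then (4:ℝ) ^ k else 0)) ≤ 4 ^ N ∧
    (∑ k ∈ Finset.range N, (if (2:ℝ) ^ k ≤ x then (4:ℝ) ^ k else 0)) ≤ 2 * x ^ 2 := by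
  induction N with
  | zero => simp; positivity
  | succ N ih =>
    rw [Finset.sum_range_succ]
    have h4 : (0:ℝ) < 4 ^ N := by positivity
    split_ifs with h
    · have : (4:ℝ) ^ N ≤ x ^ 2 := by
        calc (4:ℝ) ^ N = (2 ^ N) ^ 2 := by rw [← pow_mul, mul_comm, pow_mul]; norm_num
          _ ≤ x ^ 2 := by gcongr
      rw [pow_succ]
      constructor <;> linarith
    · rw [pow_succ]
      constructor <;> linarith

lemma dyad_high (x : ℝ) : x < 1 ∨ ∃ k : ℕ, (2:ℝ) ^ k ≤ x ∧ x < 2 ^ (k + 1) := by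
  rcases lt_or_ge x 1 with h | h
  · exact Or.inl h
  · obtain ⟨k, h1, h2⟩ := exists_nat_pow_near h (by norm_num : (1:ℝ) < 2)
    exact Or.inr ⟨k, h1, h2⟩

lemma init_sum {w : Fin 3 → V → ℂ} {u : V → V} (hw : ∀ m, IsFourierPair (comp u m) (w m)) (hu : h1Sq u < ⊤) (N : ℕ) :
    ∑ k ∈ Finset.range N, 4 ^ k * hiS (2 ^ k) w ≤ (2 * h1Sq u).toReal := by
  have hw2 := fun m => (hw m).2.1
  rw [← ENNReal.ofReal_le_iff_le_toReal (ENNReal.mul_ne_top (by simp) hu.ne),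
    ENNReal.ofReal_sum_of_nonneg fun k _ => mul_nonneg (by positivity) (hiS_nonneg _ _)]
  have e : ∀ k : ℕ, ENNReal.ofReal (4 ^ k * hiS (2 ^ k) w) = ∫⁻ ξ, ENNReal.ofReal (4 ^ k) * {ξ : V | (2:ℝ) ^ k ≤ ‖ξ‖}.indicator (fun ξ => ENNReal.ofReal (∑ m, ‖w m ξ‖ ^ 2)) ξ := by
    intro k
    rw [ENNReal.ofReal_mul (by positivity), ← hiS_lint hw2, lintegral_const_mul' _ _ (by simp)]
  simp only [e]
  rw [← lintegral_finsetSum' _ fun k _ => ((F_aem hw2).indicator (meas_hiset _)).const_mul _, h1Sq,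
    ← lintegral_const_mul' _ _ (by simp)]
  refine lintegral_mono_ae ?_
  filter_upwards [frSq_ae hw] with ξ h1
  rw [h1]
  have e2 : ∀ k : ℕ, ENNReal.ofReal (4 ^ k) * {ξ : V | (2:ℝ) ^ k ≤ ‖ξ‖}.indicator (fun ξ => ENNReal.ofReal (∑ m, ‖w m ξ‖ ^ 2)) ξ
      = ENNReal.ofReal (if (2:ℝ) ^ k ≤ ‖ξ‖ then (4:ℝ) ^ k else 0) * ENNReal.ofReal (∑ m, ‖w m ξ‖ ^ 2) := by
    intro k
    by_cases h : (2:ℝ) ^ k ≤ ‖ξ‖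
    · rw [Set.indicator_of_mem (by exact h), if_pos h]
    · rw [Set.indicator_of_notMem (by exact h), if_neg h]; simp
  simp only [e2]
  rw [← Finset.sum_mul, ← mul_assoc]
  gcongr
  rw [← ENNReal.ofReal_sum_of_nonneg fun k _ => by positivity]
  refine (ENNReal.ofReal_le_ofReal (dyad_low ‖ξ‖ N).2).trans ?_
  rw [ENNReal.ofReal_mul (by norm_num), ENNReal.ofReal_pow (norm_nonneg _), ofReal_norm]
  have : ENNReal.ofReal 2 = 2 := by simp
  rw [this]
  gcongr
  exact le_add_self

lemma hSum_le {w : Fin 3 → V → ℂ} {u : V → V} (hw : ∀ m, IsFourierPair (comp u m) (w m)) (g : V → ℝ) (r A B : ℝ)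
    (hr : 0 ≤ r) (hA : 0 ≤ A) (hB : 0 ≤ B)
    (h1 : ∀ ξ : V, ‖ξ‖ < 1 → g ξ ≤ A) (h2 : ∀ (ξ : V) (k : ℕ), (2:ℝ) ^ k ≤ ‖ξ‖ → ‖ξ‖ < 2 ^ (k + 1) → g ξ ≤ A + B * r ^ k) :
    ∫⁻ ξ, ENNReal.ofReal (g ξ) * frSq u ξ ≤ ENNReal.ofReal A * ENNReal.ofReal (hiS 0 w)
      + ENNReal.ofReal B * ∑' k : ℕ, ENNReal.ofReal (r ^ k * hiS (2 ^ k) w) := by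
  have hw2 := fun m => (hw m).2.1
  have e : ∀ k : ℕ, ENNReal.ofReal (r ^ k * hiS (2 ^ k) w) = ∫⁻ ξ, ENNReal.ofReal (r ^ k) * {ξ : V | (2:ℝ) ^ k ≤ ‖ξ‖}.indicator (fun ξ => ENNReal.ofReal (∑ m, ‖w m ξ‖ ^ 2)) ξ := by
    intro k
    rw [ENNReal.ofReal_mul (by positivity), ← hiS_lint hw2, lintegral_const_mul' _ _ (by simp)]
  simp only [e]
  have m1 : ∀ k : ℕ, AEMeasurable (fun ξ => ENNReal.ofReal (r ^ k) * {ξ : V | (2:ℝ) ^ k ≤ ‖ξ‖}.indicator (fun ξ => ENNReal.ofReal (∑ m, ‖w m ξ‖ ^ 2)) ξ) :=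
    fun k => ((F_aem hw2).indicator (meas_hiset _)).const_mul _
  rw [← lintegral_tsum m1, ← hiS_lint hw2, ← lintegral_const_mul' _ _ (by simp), ← lintegral_const_mul' _ _ (by simp),
    ← lintegral_add_left' (((F_aem hw2).indicator (meas_hiset _)).const_mul _)]
  refine lintegral_mono_ae ?_
  filter_upwards [frSq_ae hw] with ξ h3
  rw [h3, Set.indicator_of_mem (by exact norm_nonneg ξ)]
  rcases dyad_high ‖ξ‖ with h | ⟨k, h4, h5⟩
  · refine le_trans ?_ le_self_add
    gcongr
    exact h1 ξ h
  · refine le_trans ?_ (add_le_add le_rfl (mul_le_mul_right (ENNReal.le_tsum k) _))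
    rw [Set.indicator_of_mem (by exact h4), ← mul_assoc, ← add_mul, ← ENNReal.ofReal_mul hB, ← ENNReal.ofReal_add hA (by positivity)]
    gcongr
    exact h2 ξ k h4 h5

lemma h1_le {w : Fin 3 → V → ℂ} {u : V → V} (hw : ∀ m, IsFourierPair (comp u m) (w m)) :
    h1Sq u ≤ ENNReal.ofReal 2 * ENNReal.ofReal (hiS 0 w)
      + ENNReal.ofReal 4 * ∑' k : ℕ, ENNReal.ofReal (4 ^ k * hiS (2 ^ k) w) := by
  refine le_trans (le_of_eq ?_) (hSum_le hw (fun ξ => 1 + ‖ξ‖ ^ 2) 4 2 4 (by norm_num) (by norm_num) (by norm_num) ?_ ?_)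
  · rw [h1Sq]; congr 1; ext ξ
    rw [ENNReal.ofReal_add (by norm_num) (by positivity), ENNReal.ofReal_pow (norm_nonneg _), ofReal_norm]; simp; rfl
  · intro ξ h; nlinarith [norm_nonneg ξ]
  · intro ξ k _ h
    have : ‖ξ‖ ^ 2 ≤ (2 ^ (k + 1)) ^ 2 := by gcongr
    have e4 : ((2:ℝ) ^ (k + 1)) ^ 2 = 4 * 4 ^ k := by
      have : (4:ℝ) ^ k = 2 ^ k * 2 ^ k := by rw [← mul_pow]; norm_num
      rw [this]; ring
    linarith

lemma h2_le {w : Fin 3 → V → ℂ} {u : V → V} (hw : ∀ m, IsFourierPair (comp u m) (w m)) :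
    h2Sq u ≤ ENNReal.ofReal 4 * ENNReal.ofReal (hiS 0 w)
      + ENNReal.ofReal 32 * ∑' k : ℕ, ENNReal.ofReal (16 ^ k * hiS (2 ^ k) w) := by
  refine le_trans (le_of_eq ?_) (hSum_le hw (fun ξ => (1 + ‖ξ‖ ^ 2) ^ 2) 16 4 32 (by norm_num) (by norm_num) (by norm_num) ?_ ?_)
  · rw [h2Sq]; congr 1; ext ξ
    rw [ENNReal.ofReal_pow (by positivity), ENNReal.ofReal_add (by norm_num) (by positivity), ENNReal.ofReal_pow (norm_nonneg _), ofReal_norm]; simp; rfl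
  · intro ξ h
    have : ‖ξ‖ ^ 2 ≤ 1 := by nlinarith [norm_nonneg ξ]
    nlinarith [sq_nonneg ‖ξ‖]
  · intro ξ k _ h
    have : ‖ξ‖ ^ 2 ≤ (2 ^ (k + 1)) ^ 2 := by gcongr
    have e4 : ((2:ℝ) ^ (k + 1)) ^ 2 = 4 * 4 ^ k := by
      have : (4:ℝ) ^ k = 2 ^ k * 2 ^ k := by rw [← mul_pow]; norm_num
      rw [this]; ring
    have e16 : (16:ℝ) ^ k = 4 ^ k * 4 ^ k := by rw [← mul_pow]; norm_num
    have h4 : ‖ξ‖ ^ 2 ≤ 4 * 4 ^ k := by linarith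
    rw [e16]
    nlinarith [sq_nonneg (‖ξ‖ ^ 2 - 1), sq_nonneg ‖ξ‖]

section sol2
variable {ν K : ℝ} {u₀ : V → V} {u : ℝ → V → V}

lemma Sol.regular (hs : Sol ν u₀ u K) (hν : 0 < ν)
    (hE : ∀ᵐ t ∂(volume.restrict (Set.Ioi (0:ℝ))),
      (1/2 : ℝ≥0∞) * eLpNorm (u t) 2 volume ^ 2
          + ENNReal.ofReal ν * ∫⁻ τ in Set.Ioc (0:ℝ) t, gradSq4π (u τ)
        ≤ (1/2 : ℝ≥0∞) * eLpNorm u₀ 2 volume ^ 2) (h0 : h1Sq u₀ < ⊤) {T : ℝ} (hT : 0 < T) {σ : ℝ}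
    (h1 : -1 < σ) (h2 : σ < 0)
    (hB : (∫⁻ t in Set.Ioo 0 T, besovV σ (u t) ^ ((2:ℝ) / (1 + σ))) < ⊤) : RegularOn u T := by
  set p : ℝ := (2:ℝ) / (1 + σ) with hp
  have hp1 : 1 ≤ p := by rw [hp, le_div_iff₀ (by linarith)]; linarith
  have hp0 : 0 < p := by linarith
  set qr : ℝ := (2:ℝ) ^ (-σ) with hqr
  have hqr1 : 1 < qr := Real.one_lt_rpow (by norm_num) (by linarith)
  obtain ⟨C, hC, hTT⟩ := TT_dyadic hqr1
  set w : Fin 3 → ℝ → V → ℂ := fun m t => wv u t m with hw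
  have hbm : Measurable (bb qr w) := bb_meas qr fun m => wv_meas hs.meas m
  have hble : ∀ t, bb qr w t ≤ besovV σ (u t) := fun t => bb_le fun m => hs.pair t m
  have hrr : volume.restrict (Set.Ioc (0:ℝ) T) = volume.restrict (Set.Ioo (0:ℝ) T) :=
    Measure.restrict_congr_set Ioo_ae_eq_Ioc.symm
  have hbb : ∫⁻ t in Set.Ioc 0 T, bb qr w t ^ p < ⊤ := by
    rw [hrr]
    refine lt_of_le_of_lt (lintegral_mono fun t => ?_) hB
    exact ENNReal.rpow_le_rpow (hble t) hp0.le
  set b : ℝ → ℝ := fun t => (bb qr w t).toReal with hb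
  have hb0 : ∀ t, 0 ≤ b t := fun t => ENNReal.toReal_nonneg
  have hbmeas : Measurable b := hbm.ennreal_toReal
  have hbp : Integrable (fun t => b t ^ p) (volume.restrict (Set.Ioc 0 T)) := by
    refine ⟨(hbmeas.pow_const p).aestronglyMeasurable, ?_⟩
    refine lt_of_le_of_lt (lintegral_mono fun t => ?_) hbb
    rw [← ofReal_norm, Real.norm_of_nonneg (Real.rpow_nonneg (hb0 t) _), ← ENNReal.ofReal_rpow_of_nonneg (hb0 t) hp0.le]
    exact ENNReal.rpow_le_rpow ENNReal.ofReal_toReal_le hp0.le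
  have hbi : Integrable b (volume.restrict (Set.Ioc 0 T)) := by
    refine Integrable.mono' ((integrable_const (1:ℝ)).add hbp) hbmeas.aestronglyMeasurable (Eventually.of_forall fun t => ?_)
    rw [Real.norm_of_nonneg (hb0 t)]
    have h3 := Real.rpow_nonneg (hb0 t) p
    rcases le_total (b t) 1 with h | h
    · simp only [Pi.add_apply]; linarith
    · have := Real.self_le_rpow_of_one_le h hp1
      simp only [Pi.add_apply]; linarith
  have hfin : ∀ᵐ t, t ∈ Set.Ioc 0 T → bb qr w t ≠ ⊤ := by
    rw [← ae_restrict_iff' measurableSet_Ioc]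
    filter_upwards [ae_lt_top (hbm.pow_const p) hbb.ne] with t h3 h4
    rw [h4, ENNReal.top_rpow_of_pos hp0] at h3
    exact lt_irrefl _ h3
  have hTb : ∀ᵐ t, t ∈ Set.Ioc 0 T → ∀ k : ℕ, |TT (2 ^ k) (fun i => comp (u t) i) (wv u t)|
      ≤ C * (2 * qr) ^ k * b t * hiS (rad k) (wv u t) := by
    filter_upwards [hfin] with t h3 ht k
    have sp := bb_spec (lt_trans one_pos hqr1) (w := w) (t := t) (fun m => (hs.pair t m).2.1) (h3 ht)
    exact hTT (fun i => comp (u t) i) (wv u t) (b t) (hs.pair t) (fun i x => Complex.conj_ofReal _) (hs.divw t) sp.1 sp.2 k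
  have hA : (0:ℝ) ≤ 3 * max K 0 := by positivity
  have hIk : ∀ k : ℕ, ∀ᵐ t : ℝ, t ∈ Set.Ioc 0 T → (1 / 2) * hiS (2 ^ k) (wv u t)
      + 4 * π ^ 2 * ν * 4 ^ k * (∫ s in Set.Ioc 0 t, hiS (2 ^ k) (wv u s))
      ≤ (1 / 2) * hiS (2 ^ k) (fun m => FT (comp u₀ m))
        + C * (2 * qr) ^ k * ∫ s in Set.Ioc 0 t, b s * hiS (rad k) (wv u s) := by
    intro k
    filter_upwards [hs.energy_high hν hE (R := 2 ^ k) (by positivity)] with t h3 ht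
    have h3 := h3 ht.1
    have hsub : Set.Ioc 0 t ⊆ Set.Ioc 0 T := Set.Ioc_subset_Ioc_right ht.2
    have e4 : ((2:ℝ) ^ k) ^ 2 = 4 ^ k := by rw [← pow_mul, mul_comm, pow_mul]; norm_num
    rw [e4] at h3
    refine h3.trans (add_le_add le_rfl ?_)
    have i1 : IntegrableOn (fun s => b s * hiS (rad k) (wv u s)) (Set.Ioc 0 T) :=
      Integrable.mul_bdd (c := 3 * max K 0) hbi (hs.hiS_meas _).aestronglyMeasurable (Eventually.of_forall fun s => by
        rw [Real.norm_of_nonneg (hiS_nonneg _ _)]; exact hs.hiS_bound _ s)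
    rw [← integral_const_mul]
    refine integral_mono_of_nonneg (Eventually.of_forall fun s => abs_nonneg _) ((i1.mono_set hsub).const_mul _) ?_
    rw [EventuallyLE, ae_restrict_iff' measurableSet_Ioc]
    filter_upwards [hTb] with s h4 hs'
    refine (h4 (hsub hs') k).trans (le_of_eq ?_)
    ring
  have p0 : ∀ m, IsFourierPair (comp u₀ m) (FT (comp u₀ m)) := fun m => FT_spec (comp_mem hs.u0mem m)
  obtain ⟨D, hD⟩ := abstr (a := fun k t => hiS (2 ^ k) (wv u t)) (b := b) (A := 3 * max K 0) (c := 4 * π ^ 2 * ν) (C := C)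
    (αk := fun k => hiS (2 ^ k) (fun m => FT (comp u₀ m))) (α := (2 * h1Sq u₀).toReal) hT (by positivity) hC.le hA h1 h2
    (fun k t => hiS_nonneg _ _) (fun k t => hs.hiS_bound _ t) (fun k => hs.hiS_meas _) hb0 hbi hbp
    (fun k => hiS_nonneg _ _) (fun N => init_sum p0 h0 N)
    (by
      filter_upwards [hIk 0] with t h3 ht
      have h3 := h3 ht
      rw [pow_zero (4:ℝ), mul_one, pow_zero (2 * qr), mul_one] at h3
      refine h3.trans (add_le_add le_rfl ?_)
      rw [mul_assoc C]
      refine mul_le_mul_of_nonneg_left ?_ hC.le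
      rw [← integral_const_mul]
      have hsub : Set.Ioc 0 t ⊆ Set.Ioc 0 T := Set.Ioc_subset_Ioc_right ht.2
      refine integral_mono_of_nonneg (Eventually.of_forall fun s => mul_nonneg (hb0 s) (hiS_nonneg _ _))
        ((IntegrableOn.mono_set hbi hsub).const_mul _) (Eventually.of_forall fun s => ?_)
      simp only
      rw [mul_comm]
      exact mul_le_mul_of_nonneg_right (hs.hiS_bound _ s) (hb0 s))
    (fun j => by
      filter_upwards [hIk (j + 1)] with t h3 ht
      exact h3 ht)
  have hts : ∀ (r : ℝ) (x : ℕ → ℝ), 0 ≤ r → (∀ k, 0 ≤ x k) → (∀ N, ∑ k ∈ Finset.range N, r ^ k * x k ≤ D) →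
      ∑' k, ENNReal.ofReal (r ^ k * x k) ≤ ENNReal.ofReal D := by
    intro r x hr hx hN
    refine ENNReal.tsum_le_of_sum_range_le fun N => ?_
    rw [← ENNReal.ofReal_sum_of_nonneg fun k _ => mul_nonneg (by positivity) (hx k)]
    exact ENNReal.ofReal_le_ofReal (hN N)
  constructor
  · refine lt_of_le_of_lt (essSup_le_of_ae_le (ENNReal.ofReal 2 * ENNReal.ofReal (3 * max K 0) + ENNReal.ofReal 4 * ENNReal.ofReal D) ?_) ?_
    · rw [EventuallyLE, ae_restrict_iff' measurableSet_Ioo]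
      filter_upwards [ae_all_iff.2 fun N => (hD N).1] with t h3 ht
      refine (h1_le (hs.pair t)).trans ?_
      gcongr
      · exact hs.hiS_bound _ t
      · exact hts 4 (fun k => hiS (2 ^ k) (wv u t)) (by norm_num) (fun k => hiS_nonneg _ _) fun N => h3 N ⟨ht.1, ht.2.le⟩
    · exact ENNReal.add_lt_top.2 ⟨ENNReal.mul_lt_top ENNReal.ofReal_lt_top ENNReal.ofReal_lt_top, ENNReal.mul_lt_top ENNReal.ofReal_lt_top ENNReal.ofReal_lt_top⟩
  · rw [← hrr]
    have hm : ∀ k : ℕ, Measurable (fun t => ENNReal.ofReal (16 ^ k * hiS (2 ^ k) (wv u t))) := fun k =>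
      ((hs.hiS_meas _).measurable.const_mul _).ennreal_ofReal
    have hle : ∫⁻ t in Set.Ioc 0 T, h2Sq (u t) ≤ ∫⁻ t in Set.Ioc 0 T, (ENNReal.ofReal 4 * ENNReal.ofReal (3 * max K 0)
        + ENNReal.ofReal 32 * ∑' k : ℕ, ENNReal.ofReal (16 ^ k * hiS (2 ^ k) (wv u t))) := by
      refine lintegral_mono fun t => (h2_le (hs.pair t)).trans ?_
      gcongr
      exact hs.hiS_bound _ t
    refine lt_of_le_of_lt hle ?_
    rw [lintegral_add_left measurable_const, lintegral_const, lintegral_const_mul' _ _ ENNReal.ofReal_ne_top, lintegral_tsum fun k => (hm k).aemeasurable]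
    refine ENNReal.add_lt_top.2 ⟨?_, ENNReal.mul_lt_top (by simp) ?_⟩
    · exact ENNReal.mul_lt_top (ENNReal.mul_lt_top ENNReal.ofReal_lt_top ENNReal.ofReal_lt_top) (by simp)
    · have e : ∀ k : ℕ, ∫⁻ t in Set.Ioc 0 T, ENNReal.ofReal (16 ^ k * hiS (2 ^ k) (wv u t))
          = ENNReal.ofReal (16 ^ k * ∫ t in Set.Ioc 0 T, hiS (2 ^ k) (wv u t)) := by
        intro k
        rw [← integral_const_mul, ofReal_integral_eq_lintegral_ofReal ((hs.hiS_int _ T).const_mul _)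
          (Eventually.of_forall fun t => mul_nonneg (by positivity) (hiS_nonneg _ _))]
      simp only [e]
      exact lt_of_le_of_lt (hts 16 (fun k => ∫ t in Set.Ioc 0 T, hiS (2 ^ k) (wv u t)) (by norm_num)
        (fun k => integral_nonneg fun t => hiS_nonneg _ _) fun N => (hD N).2) ENNReal.ofReal_lt_top

end sol2

lemma final_aux (ν : ℝ) (hν : 0 < ν) (u₀ : V → V) (hu₀L2 : MemLp u₀ 2 volume) (hu₀div : DivFreeF u₀)
    (hu₀H1 : h1Sq u₀ < ⊤) (u : ℝ → V → V) (hu : IsLerayHopf ν u₀ u) (T : ℝ) (hT : 0 < T) (σ : ℝ) (h1 : -1 < σ) (h2 : σ < 0)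
    (hB : (∫⁻ t in Set.Ioo 0 T, besovV σ (u t) ^ ((2:ℝ) / (1 + σ))) < ⊤) : RegularOn u T := by
  obtain ⟨u', K, hs, hae⟩ := exists_sol hu hu₀L2 hu₀div
  have hsub : Set.Ioo 0 T ⊆ Set.Ioi (0:ℝ) := fun t ht => ht.1
  have haeT : ∀ᵐ t ∂(volume.restrict (Set.Ioo 0 T)), u' t = u t := ae_restrict_of_ae_restrict_of_subset hsub hae
  have hE : ∀ᵐ t ∂(volume.restrict (Set.Ioi (0:ℝ))),
      (1/2 : ℝ≥0∞) * eLpNorm (u' t) 2 volume ^ 2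
          + ENNReal.ofReal ν * ∫⁻ τ in Set.Ioc (0:ℝ) t, gradSq4π (u' τ)
        ≤ (1/2 : ℝ≥0∞) * eLpNorm u₀ 2 volume ^ 2 := by
    filter_upwards [hae, hu.energy] with t h3 h4
    have e : ∫⁻ τ in Set.Ioc (0:ℝ) t, gradSq4π (u' τ) = ∫⁻ τ in Set.Ioc (0:ℝ) t, gradSq4π (u τ) := by
      refine lintegral_congr_ae ?_
      have : ∀ᵐ t ∂(volume.restrict (Set.Ioc 0 t)), u' t = u t :=
        ae_restrict_of_ae_restrict_of_subset (fun t ht => ht.1) hae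
      filter_upwards [this] with s h5
      rw [h5]
    rw [e, h3]; exact h4
  have hB' : (∫⁻ t in Set.Ioo 0 T, besovV σ (u' t) ^ ((2:ℝ) / (1 + σ))) < ⊤ := by
    refine lt_of_le_of_lt (le_of_eq (lintegral_congr_ae ?_)) hB
    filter_upwards [haeT] with s h5
    rw [h5]
  obtain ⟨r1, r2⟩ := hs.regular hν hE hu₀H1 hT h1 h2 hB'
  constructor
  · refine lt_of_le_of_lt (le_of_eq (essSup_congr_ae ?_)) r1
    filter_upwards [haeT] with s h5
    rw [h5]
  · refine lt_of_le_of_lt (le_of_eq (lintegral_congr_ae ?_)) r2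
    filter_upwards [haeT] with s h5
    rw [h5]

end helpers

/-- Regularity under `u ∈ L^{2/(1+σ)}(0,T; B^σ_{∞,∞})` for some
`σ ∈ (-1,0)`. -/
theorem regular_of_timeIntegrable_Besov
    (ν : ℝ) (hν : 0 < ν) (u₀ : V → V)
    (hu₀L2 : MemLp u₀ 2 volume) (hu₀div : DivFreeF u₀) (hu₀H1 : h1Sq u₀ < ⊤)
    (u : ℝ → V → V) (hu : IsLerayHopf ν u₀ u) (T : ℝ) (hT : 0 < T)
    (hbesov : ∃ σ : ℝ, -1 < σ ∧ σ < 0 ∧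
      (∫⁻ t in Set.Ioo (0:ℝ) T, besovV σ (u t) ^ ((2 : ℝ) / (1 + σ))) < ⊤) :
    RegularOn u T := by
  obtain ⟨σ, h1, h2, hB⟩ := hbesov
  exact final_aux ν hν u₀ hu₀L2 hu₀div hu₀H1 u hu T hT σ h1 h2 hB

end NSE
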